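/- arXiv:math/0002207 — 2 statements merged into one kernel-verified Lean document; each statement's English description precedes it below -/
import Mathlib

section
/- (Corollary 3.2, with transversality weakened to finiteness.) Let n ≥ 1 and let μ = (μ_1 > μ_2 > ⋯ > μ_l > 0) be a strict partition with μ_1 ≤ n; set r := n(n+1)/2 − |μ|, where |μ| = μ_1 + ⋯ + μ_l. Then there exist real numbers s_1, …, s_r such that the set of n-dimensional maximal isotropic subspaces H ⊆ ℂ^{2n+1} satisfying dim(H ∩ F_{n+1−μ_i}(0)) ≥ i for i = 1,…,l and H ∩ F_{n+1}(s_k) ≠ {0} for k = 1,…,r, is finite and every H in this set is real, i.e., stable under coordinatewise complex conjugation. (The first group of conditions defines the codimension-|μ| Schubert variety of the orthogonal Grassmannian OG(n) relative to the osculating flag at 0; the other conditions define simple Schubert varieties relative to the osculating flags at the s_k.) -/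
/-- The `i`-th coordinate function of the curve `γ : ℂ → ℂ^{2n+1}`,
`γ(s)_i = (−1)^{max(i−n−1,0)} s^{i−1}/(i−1)!` (0-indexed `i`). -/
noncomputable def gammaOC (n : ℕ) (i : Fin (2 * n + 1)) : ℂ → ℂ :=
  fun s => (-1 : ℂ) ^ ((i : ℕ) - n) * s ^ (i : ℕ) / (Nat.factorial (i : ℕ))

/-- The index pairing `i ↦ 2n+2−i` (1-indexed), i.e. `i ↦ 2n−i` (0-indexed). -/
def pairOC (n : ℕ) (i : Fin (2 * n + 1)) : Fin (2 * n + 1) :=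
  ⟨2 * n - (i : ℕ), by omega⟩

/-- The symmetric bilinear form `B(x,y) = Σ_{i=1}^{2n+1} x_i y_{2n+2−i}` on `ℂ^{2n+1}`. -/
noncomputable def formOC (n : ℕ) (x y : Fin (2 * n + 1) → ℂ) : ℂ :=
  ∑ i, x i * y (pairOC n i)

/-- The osculating subspace `F_k(s) = span{γ(s), γ'(s), …, γ^{(k-1)}(s)}`,
derivatives taken coordinatewise. -/
noncomputable def oscOC (n k : ℕ) (s : ℂ) : Submodule ℂ (Fin (2 * n + 1) → ℂ) :=
  Submodule.span ℂ (Set.range fun j : Fin k => fun i => iteratedDeriv (j : ℕ) (gammaOC n i) s)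

/-- A subspace of `ℂ^N` is real if it is stable under coordinatewise complex conjugation. -/
def conjStableOC (n : ℕ) (H : Submodule ℂ (Fin (2 * n + 1) → ℂ)) : Prop :=
  ∀ x ∈ H, (fun i => (starRingEnd ℂ) (x i)) ∈ H

namespace OrthSpinor

/-- The spinor space of `ℂ^{2n+1}`, with coordinates indexed by subsets of the `n` modes. -/
abbrev Spinor (n : ℕ) := Finset (Fin n) → ℂ

variable {n : ℕ}

/-! ### Combinatorics of strict partitions, encoded as sets of modes -/

/-- The number of elements of `A` below `k`. -/
def cnt (k : ℕ) (A : Finset (Fin n)) : ℕ := ∑ p ∈ A, if (p : ℕ) < k then 1 else 0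

/-- Containment of shifted diagrams. -/
def Dominated (A B : Finset (Fin n)) : Prop := ∀ k, cnt k A ≤ cnt k B

/-- The size of the strict partition encoded by `A`. -/
def wt (A : Finset (Fin n)) : ℕ := ∑ k ∈ Finset.range (n + 1), cnt k A

/-- Add `p` to `A` if it is missing and remove it otherwise. -/
def tog (A : Finset (Fin n)) (p : Fin n) : Finset (Fin n) :=
  if p ∈ A then A.erase p else insert p A

lemma mem_tog_self (A : Finset (Fin n)) (p : Fin n) : p ∈ tog A p ↔ p ∉ A := by
  unfold tog; split_ifs with h <;> simp [h]

lemma mem_tog_of_ne (A : Finset (Fin n)) {p q : Fin n} (h : q ≠ p) : q ∈ tog A p ↔ q ∈ A := by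
  unfold tog; split_ifs <;> simp [h]

lemma mem_tog (A : Finset (Fin n)) (p q : Fin n) : q ∈ tog A p ↔ (q ∈ A ↔ q ≠ p) := by
  by_cases h : q = p
  · subst h; simp [mem_tog_self]
  · simp [mem_tog_of_ne A h, h]

lemma tog_tog (A : Finset (Fin n)) (p : Fin n) : tog (tog A p) p = A := by
  ext q; simp only [mem_tog]; tauto

lemma tog_comm (A : Finset (Fin n)) (p q : Fin n) : tog (tog A p) q = tog (tog A q) p := by
  ext x; simp only [mem_tog]; tauto

lemma cnt_tog_of_mem {A : Finset (Fin n)} {p : Fin n} (h : p ∈ A) (k : ℕ) :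
    cnt k A = cnt k (tog A p) + if (p : ℕ) < k then 1 else 0 := by
  unfold cnt tog
  rw [if_pos h, Finset.sum_erase_add _ _ h]

lemma cnt_tog_of_notMem {A : Finset (Fin n)} {p : Fin n} (h : p ∉ A) (k : ℕ) :
    cnt k (tog A p) = cnt k A + if (p : ℕ) < k then 1 else 0 := by
  unfold cnt tog
  rw [if_neg h, Finset.sum_insert h, add_comm]

lemma cnt_mono (A : Finset (Fin n)) {k m : ℕ} (h : k ≤ m) : cnt k A ≤ cnt m A := by
  unfold cnt
  refine Finset.sum_le_sum fun p _ => ?_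
  split_ifs <;> omega

lemma cnt_succ (A : Finset (Fin n)) (p : Fin n) :
    cnt (p + 1) A = cnt p A + if p ∈ A then 1 else 0 := by
  have hs : ∀ B : Finset (Fin n), p ∉ B → cnt (p + 1) B = cnt p B := by
    intro B hB
    unfold cnt
    refine Finset.sum_congr rfl fun q hq => ?_
    have : (q : ℕ) ≠ p := fun h => hB (Fin.ext h ▸ hq)
    split_ifs <;> omega
  by_cases h : p ∈ A
  · rw [cnt_tog_of_mem h, cnt_tog_of_mem h p, hs _ (by simp [mem_tog_self, h])]
    simp [h]
  · simp [hs A h, h]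

lemma cnt_zero (A : Finset (Fin n)) : cnt 0 A = 0 := by simp [cnt]

lemma cnt_of_le (A : Finset (Fin n)) {k : ℕ} (h : n ≤ k) : cnt k A = cnt n A := by
  unfold cnt
  refine Finset.sum_congr rfl fun p _ => ?_
  have := p.2
  simp [this, this.trans_le h]

lemma mem_of_cnt_eq {A B : Finset (Fin n)} (h : ∀ k, cnt k A = cnt k B) : A = B := by
  ext p
  have h1 := cnt_succ A p
  have h2 := cnt_succ B p
  rw [h, h, h2] at h1
  by_cases ha : p ∈ A <;> by_cases hb : p ∈ B <;> simp_all

lemma Dominated.refl (A : Finset (Fin n)) : Dominated A A := fun _ => le_rfl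

lemma Dominated.trans {A B C : Finset (Fin n)} (h : Dominated A B) (h' : Dominated B C) :
    Dominated A C := fun k => (h k).trans (h' k)

lemma Dominated.wt_le {A B : Finset (Fin n)} (h : Dominated A B) : wt A ≤ wt B :=
  Finset.sum_le_sum fun k _ => h k

lemma Dominated.eq_of_wt_le {A B : Finset (Fin n)} (h : Dominated A B) (h' : wt B ≤ wt A) :
    A = B := by
  have h1 := (Finset.sum_eq_sum_iff_of_le fun k _ => h k).1 (le_antisymm h.wt_le h')
  refine mem_of_cnt_eq fun k => ?_
  by_cases hk : k ≤ n
  · exact h1 k (by simp; omega)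
  · rw [cnt_of_le A (by omega), cnt_of_le B (by omega)]
    exact h1 n (by simp)

lemma dominated_univ (A : Finset (Fin n)) : Dominated A Finset.univ := fun _ =>
  Finset.sum_le_sum_of_subset (Finset.subset_univ A)

lemma dominated_empty (A : Finset (Fin n)) : Dominated ∅ A := fun k => by simp [cnt]

lemma dominated_tog_of_mem {A : Finset (Fin n)} {p : Fin n} (h : p ∈ A) :
    Dominated (tog A p) A := fun k => by
  rw [cnt_tog_of_mem h]; omega

lemma dominated_tog_tog_of_mem {A : Finset (Fin n)} {p q : Fin n} (h : p ∈ A) (hpq : p < q) :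
    Dominated (tog (tog A p) q) A := fun k => by
  have h1 := cnt_tog_of_mem h k
  have h3 : (p : ℕ) < q := hpq
  by_cases hq : q ∈ tog A p
  · have h2 := cnt_tog_of_mem hq k
    omega
  · have h2 := cnt_tog_of_notMem hq k
    split_ifs at h1 h2 <;> omega

/-- Add a box to the diagram of `A` at mode `p`. -/
def up (A : Finset (Fin n)) (p : Fin n) : Finset (Fin n) :=
  if h : (p : ℕ) + 1 < n then tog (tog A ⟨p + 1, h⟩) p else tog A p

/-- A box can be added to the diagram of `A` at mode `p`. -/
def Addable (A : Finset (Fin n)) (p : Fin n) : Prop :=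
  p ∉ A ∧ ∀ h : (p : ℕ) + 1 < n, ⟨p + 1, h⟩ ∈ A

lemma cnt_up {A : Finset (Fin n)} {p : Fin n} (h : Addable A p) {k : ℕ} (hk : k ≤ n) :
    cnt k (up A p) = cnt k A + if k = p + 1 then 1 else 0 := by
  unfold up
  split_ifs with h1 h2 h2
  · have e1 := cnt_tog_of_mem (h.2 h1) k
    have e2 := cnt_tog_of_notMem (A := tog A ⟨p + 1, h1⟩) (p := p)
      (by rw [mem_tog_of_ne _ (by simp [Fin.ext_iff])]; exact h.1) k
    simp only at e1
    split_ifs at e1 e2 <;> omega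
  · have e1 := cnt_tog_of_mem (h.2 h1) k
    have e2 := cnt_tog_of_notMem (A := tog A ⟨p + 1, h1⟩) (p := p)
      (by rw [mem_tog_of_ne _ (by simp [Fin.ext_iff])]; exact h.1) k
    simp only at e1
    split_ifs at e1 e2 <;> omega
  · have e2 := cnt_tog_of_notMem h.1 k
    split_ifs at e2 <;> omega
  · have e2 := cnt_tog_of_notMem h.1 k
    split_ifs at e2 <;> omega

lemma cnt_up' {A : Finset (Fin n)} {p : Fin n} (h : Addable A p) (k : ℕ) :
    cnt k (up A p) = cnt k A + if min k n = p + 1 then 1 else 0 := by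
  rcases le_total k n with hk | hk
  · rw [cnt_up h hk, min_eq_left hk]
  · rw [cnt_of_le _ hk, cnt_of_le A hk, cnt_up h le_rfl, min_eq_right hk]

lemma dominated_up {A : Finset (Fin n)} {p : Fin n} (h : Addable A p) : Dominated A (up A p) :=
  fun k => by rw [cnt_up' h]; omega

lemma wt_up {A : Finset (Fin n)} {p : Fin n} (h : Addable A p) : wt (up A p) = wt A + 1 := by
  unfold wt
  rw [Finset.sum_congr rfl fun k hk => cnt_up h (by simpa [Nat.lt_succ_iff] using hk),
    Finset.sum_add_distrib]
  simp

/-- Between two comparable distinct diagrams there is one covering the smaller one. -/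
lemma Dominated.exists_addable {A B : Finset (Fin n)} (h : Dominated A B) (hne : A ≠ B) :
    ∃ p, Addable A p ∧ Dominated (up A p) B := by
  classical
  set T : Finset (Fin n) := {p | p ∉ A ∧ cnt (p + 1) A < cnt (p + 1) B}
  have hT : T.Nonempty := by
    have hex : ∃ k, cnt k A < cnt k B := by
      by_contra! hc
      exact hne (mem_of_cnt_eq fun k => le_antisymm (h k) (hc k))
    have hk := Nat.find_spec hex
    have hmin := fun m (hm : m < Nat.find hex) => Nat.find_min hex hm
    set k := Nat.find hex
    clear_value k
    have hkn : k ≤ n := by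
      by_contra hkn
      rw [cnt_of_le A (by omega), cnt_of_le B (by omega)] at hk
      exact hmin n (by omega) hk
    obtain ⟨m, rfl⟩ : ∃ m, k = m + 1 := by
      rcases Nat.eq_zero_or_pos k with h0 | h0
      · rw [h0] at hk; simp [cnt_zero] at hk
      · exact ⟨k - 1, by omega⟩
    refine ⟨⟨m, by omega⟩, ?_⟩
    have e1 := cnt_succ A ⟨m, by omega⟩
    have e2 := cnt_succ B ⟨m, by omega⟩
    have e3 := hmin m (by omega)
    simp only at e1 e2
    simp only [T, Finset.mem_filter, Finset.mem_univ, true_and]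
    refine ⟨fun hm => ?_, hk⟩
    rw [if_pos hm] at e1
    split_ifs at e2 <;> omega
  obtain ⟨p, hp, hmax⟩ := T.exists_max_image id hT
  simp only [T, Finset.mem_filter, Finset.mem_univ, true_and, id] at hp hmax
  have hadd : Addable A p := by
    refine ⟨hp.1, fun h1 => ?_⟩
    by_contra hc
    have e1 := cnt_succ A ⟨p + 1, h1⟩
    have e2 := cnt_mono B (Nat.le_succ (p + 1))
    rw [if_neg hc] at e1
    simp only [Nat.succ_eq_add_one] at e1 e2
    have := hmax ⟨p + 1, h1⟩ ⟨hc, by simp only; omega⟩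
    simp [Fin.le_def] at this
  refine ⟨p, hadd, fun k => ?_⟩
  rw [cnt_up' hadd]
  split_ifs with hk
  · rcases le_total k n with hkn | hkn
    · rw [min_eq_left hkn] at hk; subst hk; exact hp.2
    · rw [min_eq_right hkn] at hk
      have := hp.2
      rw [← hk] at this
      rw [cnt_of_le A hkn, cnt_of_le B hkn]; exact this
  · exact h k

lemma exists_up_eq {A : Finset (Fin n)} (hA : A.Nonempty) :
    ∃ B p, Addable B p ∧ up B p = A := by
  obtain ⟨p, hp, hmax⟩ := A.exists_max_image id hA
  simp only [id] at hmax
  by_cases h : (p : ℕ) + 1 < n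
  · have hq : (⟨p + 1, h⟩ : Fin n) ∉ A := fun hq => by
      have := hmax _ hq
      simp [Fin.le_def] at this
    refine ⟨tog (tog A p) ⟨p + 1, h⟩, p, ⟨?_, fun _ => ?_⟩, ?_⟩
    · rw [mem_tog_of_ne _ (by simp [Fin.ext_iff]), mem_tog_self]; simpa
    · rw [mem_tog_self, mem_tog_of_ne _ (by simp [Fin.ext_iff])]; exact hq
    · simp [up, h, tog_tog]
  · exact ⟨tog A p, p, ⟨by rw [mem_tog_self]; simpa, fun h' => absurd h' h⟩, by
      simp [up, h, tog_tog]⟩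

lemma wt_eq_zero {A : Finset (Fin n)} : wt A = 0 ↔ A = ∅ := by
  refine ⟨fun h => ?_, fun h => by simp [h, wt, cnt]⟩
  exact ((dominated_empty A).eq_of_wt_le (by omega)).symm

lemma wt_eq_sum (A : Finset (Fin n)) : wt A = ∑ p ∈ A, (n - p) := by
  unfold wt cnt
  rw [Finset.sum_comm]
  refine Finset.sum_congr rfl fun p _ => ?_
  rw [Finset.sum_boole]
  have : (Finset.range (n + 1)).filter (fun k => (p : ℕ) < k) = Finset.Ioc (p : ℕ) n := by
    ext k; simp; omega
  simp [this]

lemma wt_univ : wt (Finset.univ : Finset (Fin n)) = n * (n + 1) / 2 := by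
  have h : ∑ i ∈ Finset.range n, (n - i) = ∑ i ∈ Finset.range n, (i + 1) := by
    rw [← Finset.sum_range_reflect (fun i => i + 1) n]
    refine Finset.sum_congr rfl fun i hi => ?_
    have := Finset.mem_range.1 hi
    omega
  have h' := Finset.sum_range_succ' (fun i => i) n
  rw [wt_eq_sum, Fin.sum_univ_eq_sum_range (fun p => n - p) n, h, ← add_zero (∑ i ∈ _, _), ← h',
    Finset.sum_range_id, add_tsub_cancel_right, mul_comm]

/-! ### Clifford multiplication on spinors -/

/-- The Jordan–Wigner sign. -/
def sg (k : ℕ) (A : Finset (Fin n)) : ℂ := (-1) ^ cnt k A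

lemma sg_mul_self (k : ℕ) (A : Finset (Fin n)) : sg k A * sg k A = 1 := by
  unfold sg; rw [← pow_add, ← two_mul, pow_mul]; simp

lemma sg_tog (k : ℕ) (A : Finset (Fin n)) (p : Fin n) :
    sg k (tog A p) = (if (p : ℕ) < k then -1 else 1) * sg k A := by
  unfold sg
  by_cases h : p ∈ A
  · rw [cnt_tog_of_mem h k]
    split_ifs <;> simp [pow_succ]
  · rw [cnt_tog_of_notMem h k]
    split_ifs <;> simp [pow_succ]

/-- Creation (`b = true`) and annihilation (`b = false`) operators. -/
def modeOp (b : Bool) (p : Fin n) : Module.End ℂ (Spinor n) where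
  toFun ψ A := if decide (p ∈ A) = b then sg p A * ψ (tog A p) else 0
  map_add' x y := by ext A; simp only [Pi.add_apply]; split_ifs <;> ring
  map_smul' c x := by
    ext A; simp only [Pi.smul_apply, smul_eq_mul, RingHom.id_apply]; split_ifs <;> ring

/-- The parity operator. -/
def parityOp (n : ℕ) : Module.End ℂ (Spinor n) where
  toFun ψ A := sg n A * ψ A
  map_add' x y := by ext A; simp only [Pi.add_apply]; ring
  map_smul' c x := by ext A; simp only [Pi.smul_apply, smul_eq_mul, RingHom.id_apply]; ring

lemma modeOp_apply (b : Bool) (p : Fin n) (ψ : Spinor n) (A : Finset (Fin n)) :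
    modeOp b p ψ A = if decide (p ∈ A) = b then sg p A * ψ (tog A p) else 0 := rfl

lemma parityOp_apply (ψ : Spinor n) (A : Finset (Fin n)) : parityOp n ψ A = sg n A * ψ A := rfl

lemma parityOp_mul_self : parityOp n * parityOp n = 1 := by
  refine LinearMap.ext fun ψ => funext fun A => ?_
  simp only [Module.End.mul_apply, parityOp_apply, ← mul_assoc, sg_mul_self, one_mul,
    Module.End.one_apply]

lemma parityOp_anticomm (b : Bool) (p : Fin n) :
    parityOp n * modeOp b p + modeOp b p * parityOp n = 0 := by
  refine LinearMap.ext fun ψ => funext fun A => ?_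
  simp only [Module.End.mul_apply, LinearMap.add_apply, Pi.add_apply, parityOp_apply, modeOp_apply,
    sg_tog, p.2, if_true, LinearMap.zero_apply, Pi.zero_apply]
  split_ifs <;> ring

lemma modeOp_anticomm_of_ne (b c : Bool) {p q : Fin n} (h : p ≠ q) :
    modeOp b p * modeOp c q + modeOp c q * modeOp b p = 0 := by
  refine LinearMap.ext fun ψ => funext fun A => ?_
  simp only [Module.End.mul_apply, LinearMap.add_apply, Pi.add_apply, modeOp_apply,
    LinearMap.zero_apply, Pi.zero_apply, mem_tog_of_ne A h, mem_tog_of_ne A h.symm, sg_tog,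
    tog_comm A q p]
  have h' : (p : ℕ) ≠ q := fun h' => h (Fin.ext h')
  rcases lt_or_gt_of_ne h' with h1 | h1 <;> simp only [h1, h1.not_gt, if_true, if_false] <;>
    split_ifs <;> ring

lemma modeOp_anticomm_self (b c : Bool) (p : Fin n) :
    modeOp b p * modeOp c p + modeOp c p * modeOp b p = if b = c then 0 else 1 := by
  refine LinearMap.ext fun ψ => funext fun A => ?_
  have h := sg_mul_self p A
  by_cases hp : p ∈ A <;> cases b <;> cases c <;>
    simp [Module.End.mul_apply, modeOp_apply, mem_tog_self, hp, sg_tog, tog_tog, ← mul_assoc, h]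

/-- Clifford multiplication by the standard basis vectors (zero beyond the last one). -/
noncomputable def cliff (n i : ℕ) : Module.End ℂ (Spinor n) :=
  if h : i < n then modeOp true ⟨i, h⟩
  else if i = n then parityOp n
  else if h : n < i ∧ i ≤ 2 * n then (2 : ℂ) • modeOp false ⟨2 * n - i, by omega⟩
  else 0

lemma cliff_of_lt (p : Fin n) : cliff n p = modeOp true p := by simp [cliff]

lemma cliff_middle : cliff n n = parityOp n := by simp [cliff]

lemma cliff_of_gt (p : Fin n) : cliff n (2 * n - p) = (2 : ℂ) • modeOp false p := by
  have := p.2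
  unfold cliff
  rw [dif_neg (by omega), if_neg (by omega), dif_pos (by omega)]
  congr; omega

lemma cliff_of_two_mul_lt {i : ℕ} (h : 2 * n < i) : cliff n i = 0 := by
  unfold cliff
  rw [dif_neg (by omega), if_neg (by omega), dif_neg (by omega)]

lemma index_cases (n i : ℕ) :
    (∃ p : Fin n, i = p) ∨ i = n ∨ (∃ p : Fin n, i = 2 * n - p) ∨ 2 * n < i := by
  rcases lt_trichotomy i n with h | h | h
  · exact Or.inl ⟨⟨i, h⟩, rfl⟩
  · exact Or.inr (Or.inl h)
  · by_cases h' : 2 * n < i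
    · exact Or.inr (Or.inr (Or.inr h'))
    · exact Or.inr (Or.inr (Or.inl ⟨⟨2 * n - i, by omega⟩, by simp only; omega⟩))

lemma modeOp_anticomm (b c : Bool) (p q : Fin n) :
    modeOp b p * modeOp c q + modeOp c q * modeOp b p = if p = q ∧ b ≠ c then 1 else 0 := by
  by_cases h : p = q
  · subst h
    rw [modeOp_anticomm_self]
    cases b <;> cases c <;> simp
  · rw [modeOp_anticomm_of_ne b c h]; simp [h]

lemma cliff_anticomm (i j : ℕ) :
    cliff n i * cliff n j + cliff n j * cliff n i = if i + j = 2 * n then 2 else 0 := by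
  rcases index_cases n i with ⟨p, rfl⟩ | rfl | ⟨p, rfl⟩ | hi
  · rcases index_cases n j with ⟨q, rfl⟩ | rfl | ⟨q, rfl⟩ | hj
    · rw [cliff_of_lt, cliff_of_lt, modeOp_anticomm, if_neg (by simp), if_neg (by omega)]
    · rw [cliff_of_lt, cliff_middle, add_comm, parityOp_anticomm, if_neg (by omega)]
    · have : ((p : ℕ) + (2 * n - q) = 2 * n) ↔ p = q := by rw [Fin.ext_iff]; omega
      rw [cliff_of_lt, cliff_of_gt, mul_smul_comm, smul_mul_assoc, ← smul_add, modeOp_anticomm]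
      simp only [this, ne_eq, reduceCtorEq, not_false_eq_true, and_true]
      split_ifs
      · ext; simp
      · simp
    · rw [cliff_of_two_mul_lt hj, if_neg (by omega)]; simp
  · rcases index_cases i j with ⟨q, rfl⟩ | rfl | ⟨q, rfl⟩ | hj
    · rw [cliff_of_lt, cliff_middle, parityOp_anticomm, if_neg (by omega)]
    · rw [cliff_middle, parityOp_mul_self, if_pos (by omega)]; norm_num
    · rw [cliff_middle, cliff_of_gt, mul_smul_comm, smul_mul_assoc, ← smul_add, parityOp_anticomm,
        if_neg (by omega), smul_zero]
    · rw [cliff_of_two_mul_lt hj, if_neg (by omega)]; simp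
  · rcases index_cases n j with ⟨q, rfl⟩ | rfl | ⟨q, rfl⟩ | hj
    · have : (2 * n - p + (q : ℕ) = 2 * n) ↔ p = q := by rw [Fin.ext_iff]; omega
      rw [cliff_of_lt, cliff_of_gt, mul_smul_comm, smul_mul_assoc, ← smul_add, modeOp_anticomm]
      simp only [this, ne_eq, reduceCtorEq, not_false_eq_true, and_true]
      split_ifs
      · ext; simp
      · simp
    · rw [cliff_middle, cliff_of_gt, mul_smul_comm, smul_mul_assoc, ← smul_add, add_comm,
        parityOp_anticomm, if_neg (by omega), smul_zero]
    · rw [cliff_of_gt, cliff_of_gt]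
      simp only [mul_smul_comm, smul_mul_assoc, ← smul_add]
      rw [modeOp_anticomm, if_neg (by simp), if_neg (by omega), smul_zero, smul_zero]
    · rw [cliff_of_two_mul_lt hj, if_neg (by omega)]; simp
  · rw [cliff_of_two_mul_lt hi, if_neg (by omega)]; simp

/-- Clifford multiplication by a vector. -/
noncomputable def clifford (x : Fin (2 * n + 1) → ℂ) : Module.End ℂ (Spinor n) :=
  ∑ i, x i • cliff n i

lemma clifford_add (x y : Fin (2 * n + 1) → ℂ) : clifford (x + y) = clifford x + clifford y := by
  simp [clifford, add_smul, Finset.sum_add_distrib]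

lemma clifford_smul (c : ℂ) (x : Fin (2 * n + 1) → ℂ) : clifford (c • x) = c • clifford x := by
  simp [clifford, mul_smul, Finset.smul_sum]

lemma clifford_zero : clifford (0 : Fin (2 * n + 1) → ℂ) = 0 := by simp [clifford]

lemma clifford_anticomm (x y : Fin (2 * n + 1) → ℂ) :
    clifford x * clifford y + clifford y * clifford x = (2 * formOC n x y) • 1 := by
  have h1 : clifford x * clifford y = ∑ i, ∑ j, (x i * y j) • (cliff n i * cliff n j) := by
    unfold clifford
    rw [Finset.sum_mul_sum]
    refine Finset.sum_congr rfl fun i _ => Finset.sum_congr rfl fun j _ => ?_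
    rw [smul_mul_assoc, mul_smul_comm, smul_smul]
  have h2 : clifford y * clifford x = ∑ i, ∑ j, (x i * y j) • (cliff n j * cliff n i) := by
    unfold clifford
    rw [Finset.sum_mul_sum, Finset.sum_comm]
    refine Finset.sum_congr rfl fun i _ => Finset.sum_congr rfl fun j _ => ?_
    rw [smul_mul_assoc, mul_smul_comm, smul_smul, mul_comm (y j)]
  rw [h1, h2, ← Finset.sum_add_distrib, formOC, Finset.mul_sum, Finset.sum_smul]
  refine Finset.sum_congr rfl fun i _ => ?_
  rw [← Finset.sum_add_distrib, Finset.sum_eq_single (pairOC n i)]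
  · rw [← smul_add, cliff_anticomm, if_pos (by simp only [pairOC]; omega)]
    have : (2 : Module.End ℂ (Spinor n)) = (2 : ℂ) • 1 := by ext; simp
    rw [this, smul_smul]
    congr 1
    ring
  · intro j _ hj
    rw [← smul_add, cliff_anticomm, if_neg, smul_zero]
    intro h
    exact hj (Fin.ext (by simp only [pairOC]; omega))
  · simp

lemma clifford_clifford (x y : Fin (2 * n + 1) → ℂ) (ψ : Spinor n) :
    clifford x (clifford y ψ) = (2 * formOC n x y) • ψ - clifford y (clifford x ψ) := by
  have := LinearMap.congr_fun (clifford_anticomm x y) ψ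
  simp only [LinearMap.add_apply, Module.End.mul_apply, LinearMap.smul_apply,
    Module.End.one_apply] at this
  rw [← this]; abel

/-! ### The orthogonal geometry of the bilinear form -/

lemma pairOC_pairOC (i : Fin (2 * n + 1)) : pairOC n (pairOC n i) = i :=
  Fin.ext (by simp only [pairOC]; omega)

lemma sum_pairOC {M : Type*} [AddCommMonoid M] (f : Fin (2 * n + 1) → M) :
    ∑ i, f (pairOC n i) = ∑ i, f i :=
  Equiv.sum_comp (Function.Involutive.toPerm _ pairOC_pairOC) f

lemma formOC_comm (x y : Fin (2 * n + 1) → ℂ) : formOC n x y = formOC n y x := by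
  unfold formOC
  rw [← sum_pairOC]
  simp only [pairOC_pairOC, mul_comm]

/-- The form as a bilinear form. -/
noncomputable def bilin (n : ℕ) : LinearMap.BilinForm ℂ (Fin (2 * n + 1) → ℂ) :=
  LinearMap.mk₂ ℂ (formOC n)
    (fun x y z => by simp [formOC, add_mul, Finset.sum_add_distrib])
    (fun c x y => by simp [formOC, Finset.mul_sum, mul_assoc])
    (fun x y z => by simp [formOC, mul_add, Finset.sum_add_distrib])
    (fun c x y => by simp [formOC, Finset.mul_sum, mul_left_comm])

lemma formOC_add_left (x y z : Fin (2 * n + 1) → ℂ) :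
    formOC n (x + y) z = formOC n x z + formOC n y z := (bilin n).map_add₂ x y z

lemma formOC_add_right (x y z : Fin (2 * n + 1) → ℂ) :
    formOC n x (y + z) = formOC n x y + formOC n x z := (bilin n x).map_add y z

lemma formOC_smul_left (c : ℂ) (x y : Fin (2 * n + 1) → ℂ) :
    formOC n (c • x) y = c * formOC n x y := (bilin n).map_smul₂ c x y

lemma formOC_smul_right (c : ℂ) (x y : Fin (2 * n + 1) → ℂ) :
    formOC n x (c • y) = c * formOC n x y := (bilin n x).map_smul c y

lemma formOC_sub_left (x y z : Fin (2 * n + 1) → ℂ) :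
    formOC n (x - y) z = formOC n x z - formOC n y z := (bilin n).map_sub₂ x y z

lemma formOC_sub_right (x y z : Fin (2 * n + 1) → ℂ) :
    formOC n x (y - z) = formOC n x y - formOC n x z := (bilin n x).map_sub y z

lemma bilin_apply (x y : Fin (2 * n + 1) → ℂ) : bilin n x y = formOC n x y := rfl

lemma formOC_single (x : Fin (2 * n + 1) → ℂ) (i : Fin (2 * n + 1)) :
    formOC n x (Pi.single i 1) = x (pairOC n i) := by
  unfold formOC
  rw [Finset.sum_eq_single (pairOC n i)]
  · simp [pairOC_pairOC]
  · intro j _ hj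
    rw [Pi.single_eq_of_ne, mul_zero]
    rintro rfl
    exact hj (pairOC_pairOC j).symm
  · simp

lemma bilin_isRefl : (bilin n).IsRefl := fun x y h => by
  rwa [bilin_apply, formOC_comm]

lemma bilin_nondegenerate : (bilin n).Nondegenerate := by
  refine (LinearMap.IsRefl.nondegenerate_iff_separatingLeft bilin_isRefl).2 fun x hx => ?_
  ext i
  have := hx (Pi.single (pairOC n i) 1)
  rwa [bilin_apply, formOC_single, pairOC_pairOC] at this

lemma exists_formOC_eq_one {x : Fin (2 * n + 1) → ℂ} (hx : x ≠ 0) : ∃ y, formOC n x y = 1 := by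
  obtain ⟨i, hi⟩ := Function.ne_iff.1 hx
  refine ⟨(x i)⁻¹ • Pi.single (pairOC n i) 1, ?_⟩
  rw [formOC_smul_right, formOC_single, pairOC_pairOC]
  exact inv_mul_cancel₀ hi

lemma finrank_orthogonal (W : Submodule ℂ (Fin (2 * n + 1) → ℂ)) :
    Module.finrank ℂ ((bilin n).orthogonal W) = 2 * n + 1 - Module.finrank ℂ W := by
  rw [LinearMap.BilinForm.finrank_orthogonal bilin_nondegenerate]
  simp

lemma mem_orthogonal {W : Submodule ℂ (Fin (2 * n + 1) → ℂ)} {y : Fin (2 * n + 1) → ℂ} :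
    y ∈ (bilin n).orthogonal W ↔ ∀ x ∈ W, formOC n x y = 0 := Iff.rfl

lemma finrank_sup_span {W : Submodule ℂ (Fin (2 * n + 1) → ℂ)} {u : Fin (2 * n + 1) → ℂ}
    (hu : u ∉ W) : Module.finrank ℂ ↥(W ⊔ ℂ ∙ u) = Module.finrank ℂ W + 1 := by
  have h := Submodule.finrank_sup_add_finrank_inf_eq W (ℂ ∙ u)
  have hu0 : u ≠ 0 := fun h => hu (h ▸ W.zero_mem)
  rw [finrank_span_singleton hu0, (Submodule.disjoint_span_singleton' hu0).2 hu |>.eq_bot,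
    finrank_bot] at h
  omega

section Isotropic

variable {H : Submodule ℂ (Fin (2 * n + 1) → ℂ)} (hdim : Module.finrank ℂ H = n)
  (hiso : ∀ x ∈ H, ∀ y ∈ H, formOC n x y = 0)

include hdim hiso

lemma mem_of_orthogonal_of_isotropic {u : Fin (2 * n + 1) → ℂ}
    (hu : ∀ x ∈ H, formOC n x u = 0) (huu : formOC n u u = 0) : u ∈ H := by
  by_contra hn
  have h1 := finrank_sup_span hn
  have hle : H ⊔ ℂ ∙ u ≤ (bilin n).orthogonal (H ⊔ ℂ ∙ u) := by
    intro y hy x hx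
    obtain ⟨a, ha, b, hb, rfl⟩ := Submodule.mem_sup.1 hx
    obtain ⟨c, hc, d, hd, rfl⟩ := Submodule.mem_sup.1 hy
    obtain ⟨s, rfl⟩ := Submodule.mem_span_singleton.1 hb
    obtain ⟨t, rfl⟩ := Submodule.mem_span_singleton.1 hd
    have h3 := formOC_comm u c
    change formOC n _ _ = 0
    simp [formOC_add_left, formOC_add_right, formOC_smul_left, formOC_smul_right,
      hiso a ha c hc, hu a ha, huu, h3, hu c hc]
  have h2 := Submodule.finrank_mono hle
  rw [finrank_orthogonal] at h2
  omega

lemma exists_unit_normal :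
    ∃ u, (∀ x ∈ H, formOC n x u = 0) ∧ formOC n u u = 1 := by
  have h1 := finrank_orthogonal H
  obtain ⟨v, hv, hvH⟩ : ∃ v ∈ (bilin n).orthogonal H, v ∉ H := by
    by_contra! hc
    have := Submodule.finrank_mono (show (bilin n).orthogonal H ≤ H from hc)
    omega
  have hvv : formOC n v v ≠ 0 := fun h =>
    hvH (mem_of_orthogonal_of_isotropic hdim hiso (mem_orthogonal.1 hv) h)
  obtain ⟨z, hz⟩ := IsAlgClosed.exists_pow_nat_eq (formOC n v v) two_pos
  have hz0 : z ≠ 0 := fun h => hvv (by rw [← hz, h]; simp)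
  refine ⟨z⁻¹ • v, fun x hx => ?_, ?_⟩
  · rw [formOC_smul_right, mem_orthogonal.1 hv x hx, mul_zero]
  · rw [formOC_smul_left, formOC_smul_right, ← hz]
    field_simp

lemma formOC_of_normal {u a b : Fin (2 * n + 1) → ℂ} (hu : ∀ x ∈ H, formOC n x u = 0)
    (huu : formOC n u u = 1) (ha : ∀ x ∈ H, formOC n x a = 0) (hb : ∀ x ∈ H, formOC n x b = 0) :
    formOC n a b = formOC n a u * formOC n b u := by
  have huH : u ∉ H := fun h => by
    rw [hu u h] at huu; exact zero_ne_one huu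
  have hH : H = (bilin n).orthogonal (H ⊔ ℂ ∙ u) := by
    refine Submodule.eq_of_le_of_finrank_le (fun y hy x hx => ?_) ?_
    · obtain ⟨a, ha, b, hb, rfl⟩ := Submodule.mem_sup.1 hx
      obtain ⟨s, rfl⟩ := Submodule.mem_span_singleton.1 hb
      have h3 := formOC_comm u y
      change formOC n _ _ = 0
      simp [formOC_add_left, formOC_smul_left,
        hiso a ha y hy, h3, hu y hy]
    · rw [finrank_orthogonal, finrank_sup_span huH]; omega
  have hmem : a - formOC n a u • u ∈ H := by
    rw [hH]
    intro x hx
    obtain ⟨c, hc, d, hd, rfl⟩ := Submodule.mem_sup.1 hx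
    obtain ⟨s, rfl⟩ := Submodule.mem_span_singleton.1 hd
    have h3 := formOC_comm u a
    change formOC n _ _ = 0
    simp [formOC_sub_right, formOC_add_left, formOC_smul_left, formOC_smul_right,
      ha c hc, hu c hc, huu, h3, mul_comm s]
  have := hb _ hmem
  rw [formOC_sub_left, formOC_smul_left, formOC_comm u b, sub_eq_zero] at this
  exact this

omit hdim in
lemma exists_annihilated : ∃ ψ : Spinor n, ψ ≠ 0 ∧ ∀ h ∈ H, clifford h ψ = 0 := by
  classical
  have key : ∀ t : Finset (Fin (2 * n + 1) → ℂ), (t : Set (Fin (2 * n + 1) → ℂ)) ⊆ H →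
      ∃ ψ : Spinor n, ψ ≠ 0 ∧ ∀ h ∈ t, clifford h ψ = 0 := by
    intro t
    induction t using Finset.induction_on with
    | empty => exact fun _ => ⟨fun _ => 1, fun h => one_ne_zero (congrFun h ∅), by simp⟩
    | insert h t _ ih =>
      intro ht
      rw [Finset.coe_insert, Set.insert_subset_iff] at ht
      obtain ⟨ψ, h0, hψ⟩ := ih ht.2
      by_cases hz : clifford h ψ = 0
      · exact ⟨ψ, h0, by simpa [hz] using hψ⟩
      · refine ⟨clifford h ψ, hz, ?_⟩
        intro x hx
        rcases Finset.mem_insert.1 hx with rfl | hx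
        · have := clifford_clifford x x ψ
          rw [hiso x ht.1 x ht.1, mul_zero, zero_smul, zero_sub] at this
          exact self_eq_neg.1 this
        · rw [clifford_clifford, hψ x hx, hiso x (ht.2 hx) h ht.1]
          simp
  obtain ⟨t, ht⟩ := (inferInstance : Module.Finite ℂ H) |>.fg_top.map H.subtype
  rw [Submodule.map_top, Submodule.range_subtype] at ht
  obtain ⟨ψ, h0, hψ⟩ := key t (by rw [← ht]; exact Submodule.subset_span)
  refine ⟨ψ, h0, fun h hh => ?_⟩
  rw [← ht] at hh
  induction hh using Submodule.span_induction with
  | mem x hx => exact hψ x hx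
  | zero => rw [clifford_zero]; rfl
  | add x y _ _ hx hy => rw [clifford_add, LinearMap.add_apply, hx, hy, add_zero]
  | smul c x _ hx => rw [clifford_smul, LinearMap.smul_apply, hx, smul_zero]

/-- The bilinear form whose vanishing on the diagonal characterises pure spinors. -/
noncomputable def quad (A B : Finset (Fin n)) (x y : Spinor n) : ℂ :=
  ∑ i : Fin (2 * n + 1), cliff n i x A * cliff n (pairOC n i) y B - x A * y B

lemma exists_pure_spinor : ∃ ψ : Spinor n, ψ ≠ 0 ∧ (∀ h ∈ H, clifford h ψ = 0) ∧
    ∀ A B, quad A B ψ ψ = 0 := by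
  obtain ⟨u, hu, huu⟩ := exists_unit_normal hdim hiso
  obtain ⟨φ, hφ0, hφ⟩ := exists_annihilated hiso
  have huφ : clifford u (clifford u φ) = φ := by
    have := clifford_clifford u u φ
    rw [huu, mul_one, two_smul] at this
    have h2 : (2 : ℂ) • clifford u (clifford u φ) = (2 : ℂ) • φ := by
      rw [two_smul, two_smul]; nth_rewrite 1 [this]; abel
    exact smul_right_injective _ (two_ne_zero) h2
  obtain ⟨ψ, hψ0, hψ, ε, hε, hεψ⟩ : ∃ ψ : Spinor n, ψ ≠ 0 ∧ (∀ h ∈ H, clifford h ψ = 0) ∧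
      ∃ ε : ℂ, ε * ε = 1 ∧ clifford u ψ = ε • ψ := by
    by_cases h : φ + clifford u φ = 0
    · exact ⟨φ, hφ0, hφ, -1, by norm_num, by
        rw [neg_smul, one_smul]; exact eq_neg_of_add_eq_zero_right h⟩
    · refine ⟨φ + clifford u φ, h, fun x hx => ?_, 1, by norm_num, ?_⟩
      · rw [map_add, clifford_clifford, hφ x hx, hu x hx]; simp
      · rw [map_add, huφ, one_smul, add_comm]
  refine ⟨ψ, hψ0, hψ, fun A B => ?_⟩
  -- the coordinates of `v ↦ v · ψ` are represented by vectors orthogonal to `H`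
  have hrep : ∀ (C : Finset (Fin n)) (x : Fin (2 * n + 1) → ℂ),
      formOC n x (fun i => cliff n (pairOC n i) ψ C) = clifford x ψ C := by
    intro C x
    simp [formOC, clifford, pairOC_pairOC, LinearMap.sum_apply, Finset.sum_apply]
  have := formOC_of_normal hdim hiso hu huu
    (a := fun i => cliff n (pairOC n i) ψ A) (b := fun i => cliff n (pairOC n i) ψ B)
    (fun x hx => by rw [hrep, hψ x hx]; rfl) (fun x hx => by rw [hrep, hψ x hx]; rfl)
  have hnormal : ∀ C, formOC n (fun i => cliff n (pairOC n i) ψ C) u = ε * ψ C := fun C => by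
    rw [formOC_comm, hrep, hεψ]; rfl
  rw [hnormal, hnormal] at this
  simp only [formOC, pairOC_pairOC] at this
  rw [quad, ← sum_pairOC]
  simp only [pairOC_pairOC]
  rw [this, mul_mul_mul_comm, hε, one_mul, sub_self]

lemma mem_iff_clifford_eq_zero {ψ : Spinor n} (h0 : ψ ≠ 0) (hψ : ∀ h ∈ H, clifford h ψ = 0)
    (v : Fin (2 * n + 1) → ℂ) : v ∈ H ↔ clifford v ψ = 0 := by
  refine ⟨hψ v, fun hv => ?_⟩
  have key : ∀ x, clifford x ψ = 0 → formOC n x v = 0 := fun x hx => by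
    have := clifford_clifford x v ψ
    rw [hv, hx, map_zero, map_zero, sub_zero] at this
    simpa [h0] using this.symm
  exact mem_of_orthogonal_of_isotropic hdim hiso (fun x hx => key x (hψ x hx)) (key v hv)

end Isotropic

lemma functional_eq_zero {w : Fin (2 * n + 1) → ℂ} (hw : w ≠ 0) {ψ : Spinor n}
    (hψ : clifford w ψ = 0) (l : Module.Dual ℂ (Spinor n)) (hl : ∀ φ, l (clifford w φ) = 0) :
    l ψ = 0 := by
  obtain ⟨y, hy⟩ := exists_formOC_eq_one hw
  have := clifford_clifford w y ψ
  rw [hy, hψ, map_zero, sub_zero] at this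
  have h := hl (clifford y ψ)
  rw [this] at h
  simpa using h

/-! ### The lowering operator and the osculating functionals -/

/-- The operator on spinors induced by differentiation along the curve: it removes one box. -/
noncomputable def lower (n : ℕ) : Module.End ℂ (Spinor n) :=
  (2⁻¹ : ℂ) • ∑ p : Fin n, cliff n (p + 1) * cliff n (2 * n - p)

lemma lower_comm (c : ℕ) :
    lower n * cliff n c - cliff n c * lower n = (if c < n then 1 else -1 : ℂ) • cliff n (c + 1) := by
  have h : ∀ p : Fin n, cliff n (p + 1) * cliff n (2 * n - p) * cliff n c -
      cliff n c * (cliff n (p + 1) * cliff n (2 * n - p)) =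
      (2 : ℂ) • ((if (p : ℕ) = c then cliff n (c + 1) else 0) -
        if (p : ℕ) + 1 + c = 2 * n then cliff n (c + 1) else 0) := by
    intro p
    have h1 := cliff_anticomm (n := n) (2 * n - p) c
    have h2 := cliff_anticomm (n := n) (p + 1) c
    have hp := p.2
    have h3 : (2 * n - (p : ℕ) + c = 2 * n) ↔ (p : ℕ) = c := by omega
    have e : cliff n (p + 1) * cliff n (2 * n - p) * cliff n c -
        cliff n c * (cliff n (p + 1) * cliff n (2 * n - p)) =
        cliff n (p + 1) * (cliff n (2 * n - p) * cliff n c + cliff n c * cliff n (2 * n - p)) -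
        (cliff n (p + 1) * cliff n c + cliff n c * cliff n (p + 1)) * cliff n (2 * n - p) := by
      noncomm_ring
    rw [e, h1, h2]
    simp only [h3]
    have h4 : (p : ℕ) = c → cliff n ((p : ℕ) + 1) = cliff n (c + 1) := fun h => by rw [h]
    have h5 : (p : ℕ) + 1 + c = 2 * n → cliff n (2 * n - (p : ℕ)) = cliff n (c + 1) :=
      fun h => by congr 1; omega
    split_ifs with g1 g2 g2
    · omega
    · rw [h4 g1, two_smul]; noncomm_ring
    · rw [h5 g2, two_smul]; noncomm_ring
    · simp
  have h' : lower n * cliff n c - cliff n c * lower n =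
      (2⁻¹ : ℂ) • ∑ p : Fin n, (cliff n (p + 1) * cliff n (2 * n - p) * cliff n c -
      cliff n c * (cliff n (p + 1) * cliff n (2 * n - p))) := by
    rw [Finset.sum_sub_distrib, ← Finset.sum_mul, ← Finset.mul_sum, smul_sub, lower,
      smul_mul_assoc, mul_smul_comm]
  rw [h', Finset.sum_congr rfl fun p _ => h p, ← Finset.smul_sum, smul_smul,
    inv_mul_cancel₀ two_ne_zero, one_smul, Finset.sum_sub_distrib,
    Fin.sum_univ_eq_sum_range (fun p => if p = c then cliff n (c + 1) else 0) n,
    Fin.sum_univ_eq_sum_range (fun p => if p + 1 + c = 2 * n then cliff n (c + 1) else 0) n,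
    Finset.sum_ite_eq']
  by_cases hc : c < n
  · rw [if_pos (Finset.mem_range.2 hc), if_pos hc, one_smul, Finset.sum_eq_zero, sub_zero]
    intro p hp
    rw [if_neg]
    have := Finset.mem_range.1 hp
    omega
  · rw [if_neg (by simpa using hc), if_neg hc, zero_sub]
    refine Eq.trans ?_ (neg_one_smul ℂ (cliff n (c + 1))).symm
    congr 1
    by_cases h2 : c < 2 * n
    · rw [Finset.sum_eq_single (2 * n - 1 - c), if_pos (by omega)]
      · intro p _ hp
        rw [if_neg (by omega)]
      · intro hp
        rw [Finset.mem_range] at hp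
        omega
    · rw [cliff_of_two_mul_lt (by omega)]; simp

open Classical in
lemma lower_apply (ψ : Spinor n) (B : Finset (Fin n)) :
    lower n ψ B = ∑ p : Fin n, if Addable B p then ψ (up B p) else 0 := by
  have h : ∀ p : Fin n, (cliff n (p + 1) * cliff n (2 * n - p)) ψ B =
      2 * if Addable B p then ψ (up B p) else 0 := by
    intro p
    rw [cliff_of_gt, mul_smul_comm, LinearMap.smul_apply, Pi.smul_apply, smul_eq_mul]
    congr 1
    rw [Module.End.mul_apply]
    by_cases hp : p ∈ B
    · rw [if_neg fun h => h.1 hp]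
      by_cases h1 : (p : ℕ) + 1 < n
      · have : (p : ℕ) + 1 = (⟨p + 1, h1⟩ : Fin n) := rfl
        have hm := mem_tog_of_ne B (show p ≠ ⟨p + 1, h1⟩ by simp [Fin.ext_iff])
        rw [this, cliff_of_lt, modeOp_apply, modeOp_apply]
        simp [hm, hp]
      · have : (p : ℕ) + 1 = n := by omega
        rw [this, cliff_middle, parityOp_apply, modeOp_apply]
        simp [hp]
    · have hs : sg (p + 1) B = sg p B := by
        have := cnt_succ B p
        rw [if_neg hp, add_zero] at this
        rw [sg, sg, this]
      by_cases h1 : (p : ℕ) + 1 < n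
      · have : (p : ℕ) + 1 = (⟨p + 1, h1⟩ : Fin n) := rfl
        have hm := mem_tog_of_ne B (show p ≠ ⟨p + 1, h1⟩ by simp [Fin.ext_iff])
        rw [this, cliff_of_lt, modeOp_apply, modeOp_apply]
        have hadd : Addable B p ↔ (⟨p + 1, h1⟩ : Fin n) ∈ B := by simp [Addable, hp, h1]
        simp only [hadd, hm, hp, decide_false, decide_eq_true_eq, if_true, sg_tog, up, h1, dif_pos, hs]
        simp [← mul_assoc, sg_mul_self]
      · have h2 : (p : ℕ) + 1 = n := by omega
        have hadd : Addable B p := ⟨hp, fun h => absurd h h1⟩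
        rw [h2] at hs
        rw [h2, cliff_middle, parityOp_apply, modeOp_apply, if_pos hadd, hs]
        simp [hp, up, h1, ← mul_assoc, sg_mul_self]
  rw [lower, LinearMap.smul_apply, LinearMap.sum_apply, Pi.smul_apply, Finset.sum_apply,
    Finset.sum_congr rfl fun p _ => h p, ← Finset.mul_sum, smul_eq_mul, ← mul_assoc]
  norm_num

lemma exists_lower_pow_coeff (n k : ℕ) : ∃ d : Finset (Fin n) → ℝ,
    (∀ A, wt A = k → 0 < d A) ∧ (∀ A, wt A ≠ k → d A = 0) ∧
    ∀ ψ : Spinor n, (lower n ^ k) ψ ∅ = ∑ A, (d A : ℂ) * ψ A := by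
  classical
  induction k with
  | zero =>
    refine ⟨fun A => if A = ∅ then 1 else 0, fun A hA => ?_, fun A hA => ?_, fun ψ => ?_⟩
    · simp [wt_eq_zero.1 hA]
    · exact if_neg fun h => hA (wt_eq_zero.2 h)
    · rw [Finset.sum_eq_single ∅] <;> simp +contextual
  | succ k ih =>
    obtain ⟨d, hpos, hzero, hd⟩ := ih
    have hnn : ∀ B, 0 ≤ d B := fun B => by
      by_cases h : wt B = k
      · exact (hpos B h).le
      · exact (hzero B h).ge
    refine ⟨fun A => ∑ B, ∑ p, if Addable B p ∧ up B p = A then d B else 0,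
      fun A hA => ?_, fun A hA => ?_, fun ψ => ?_⟩
    · obtain ⟨B, p, hadd, hup⟩ := exists_up_eq (A := A) (by
        rw [Finset.nonempty_iff_ne_empty, ne_eq, ← wt_eq_zero]; omega)
      have hB : wt B = k := by
        have := wt_up hadd
        rw [hup] at this; omega
      have hnn' : ∀ B p, 0 ≤ if Addable B p ∧ up B p = A then d B else 0 := fun B p => by
        split_ifs
        exacts [hnn B, le_rfl]
      refine Finset.sum_pos' (fun B _ => Finset.sum_nonneg fun p _ => hnn' B p)
        ⟨B, Finset.mem_univ _, Finset.sum_pos' (fun p _ => hnn' B p) ⟨p, Finset.mem_univ _, ?_⟩⟩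
      rw [if_pos ⟨hadd, hup⟩]
      exact hpos B hB
    · refine Finset.sum_eq_zero fun B _ => Finset.sum_eq_zero fun p _ => ?_
      split_ifs with h
      · refine hzero B fun hB => hA ?_
        rw [← h.2, wt_up h.1, hB]
      · rfl
    · rw [pow_succ, Module.End.mul_apply, hd]
      simp only [lower_apply, Finset.mul_sum, Complex.ofReal_sum, Finset.sum_mul]
      rw [Finset.sum_comm' (t' := Finset.univ) (s' := fun _ => Finset.univ) (by simp)]
      rw [Finset.sum_comm]
      rw [Finset.sum_comm' (s := Finset.univ (α := Finset (Fin n)))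
        (t := fun _ => Finset.univ (α := Finset (Fin n))) (t' := Finset.univ)
        (s' := fun _ => Finset.univ) (by simp)]
      refine Finset.sum_congr rfl fun B _ => ?_
      rw [Finset.sum_comm]
      refine Finset.sum_congr rfl fun p _ => ?_
      by_cases h : Addable B p
      · simp [h, apply_ite Complex.ofReal]
      · simp [h]

/-- The functional on spinors vanishing on the spinors of those maximal isotropic subspaces
that meet the maximal isotropic osculating subspace at `s`. -/
noncomputable def osc (n : ℕ) (s : ℂ) : Module.Dual ℂ (Spinor n) :=
  ∑ k ∈ Finset.range (wt (Finset.univ : Finset (Fin n)) + 1),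
    ((-s) ^ k / (k.factorial : ℂ)) • (LinearMap.proj ∅ ∘ₗ (lower n ^ k))

lemma osc_apply (s : ℂ) (ψ : Spinor n) :
    osc n s ψ = ∑ k ∈ Finset.range (wt (Finset.univ : Finset (Fin n)) + 1),
      (-s) ^ k / (k.factorial : ℂ) * (lower n ^ k) ψ ∅ := by
  simp [osc, LinearMap.sum_apply]

lemma lower_pow_eq_zero (ψ : Spinor n) :
    (lower n ^ (wt (Finset.univ : Finset (Fin n)) + 1)) ψ ∅ = 0 := by
  obtain ⟨d, -, hzero, hd⟩ := exists_lower_pow_coeff n (wt (Finset.univ : Finset (Fin n)) + 1)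
  rw [hd]
  refine Finset.sum_eq_zero fun A _ => ?_
  rw [hzero A, Complex.ofReal_zero, zero_mul]
  have := (dominated_univ A).wt_le
  omega

lemma exists_osc_coeff (n : ℕ) : ∃ c : Finset (Fin n) → ℝ, (∀ A, c A ≠ 0) ∧
    ∀ (s : ℂ) (ψ : Spinor n), osc n s ψ = ∑ A, s ^ wt A * ((c A : ℂ) * ψ A) := by
  choose d hpos hzero hd using exists_lower_pow_coeff n
  refine ⟨fun A => (-1) ^ wt A / (wt A).factorial * d (wt A) A, fun A => ?_, fun s ψ => ?_⟩
  · exact mul_ne_zero (div_ne_zero (by simp) (by positivity)) (hpos _ A rfl).ne'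
  · simp only [osc_apply, hd, Finset.mul_sum]
    rw [Finset.sum_comm]
    refine Finset.sum_congr rfl fun A _ => ?_
    rw [Finset.sum_eq_single (wt A)]
    · push_cast
      rw [neg_pow]; ring
    · intro k _ hk
      rw [hzero k A hk.symm]; simp
    · intro h
      have := (dominated_univ A).wt_le
      simp at h; omega

lemma hasDerivAt_osc (ψ : Spinor n) (s : ℂ) :
    HasDerivAt (fun s => osc n s ψ) (-osc n s (lower n ψ)) s := by
  have h : ∀ k ∈ Finset.range (wt (Finset.univ : Finset (Fin n)) + 1),
      HasDerivAt (fun s : ℂ => (-s) ^ k / (k.factorial : ℂ) * (lower n ^ k) ψ ∅)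
        ((k * (-s) ^ (k - 1) * -1) / (k.factorial : ℂ) * (lower n ^ k) ψ ∅) s := fun k _ =>
    (((hasDerivAt_neg s).pow k).div_const _).mul_const _
  have h' := HasDerivAt.fun_sum h
  simp only [← osc_apply] at h'
  refine h'.congr_deriv (Eq.symm ?_)
  rw [Finset.sum_range_succ', osc_apply, Finset.sum_range_succ, ← Module.End.mul_apply,
    ← pow_succ, lower_pow_eq_zero]
  simp only [mul_zero, add_zero, Nat.cast_zero, zero_mul, zero_div]
  rw [← Finset.sum_neg_distrib]
  refine Finset.sum_congr rfl fun k _ => ?_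
  rw [← Module.End.mul_apply, ← pow_succ, Nat.factorial_succ, Nat.cast_mul]
  have h1 : ((k + 1 : ℕ) : ℂ) ≠ 0 := Nat.cast_ne_zero.2 (by omega)
  have h2 : (k.factorial : ℂ) ≠ 0 := Nat.cast_ne_zero.2 k.factorial_ne_zero
  rw [Nat.add_sub_cancel]
  field_simp

/-! ### Osculating flags -/

/-- The `i`-th coordinate of the `j`-th derivative of the curve. -/
noncomputable def gcoef (n j i : ℕ) (s : ℂ) : ℂ :=
  if j ≤ i then (-1) ^ (i - n) * s ^ (i - j) / ((i - j).factorial : ℂ) else 0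

lemma hasDerivAt_gcoef (n j i : ℕ) (s : ℂ) :
    HasDerivAt (gcoef n j i) (gcoef n (j + 1) i s) s := by
  unfold gcoef
  by_cases h : j ≤ i
  · simp only [h, if_true]
    refine (((hasDerivAt_pow (i - j) s).const_mul _).div_const _).congr_deriv ?_
    by_cases h' : j + 1 ≤ i
    · rw [if_pos h']
      obtain ⟨m, hm⟩ : ∃ m, i - j = m + 1 := ⟨i - j - 1, by omega⟩
      have h1 : ((m + 1 : ℕ) : ℂ) ≠ 0 := Nat.cast_ne_zero.2 (by omega)
      have h2 : (m.factorial : ℂ) ≠ 0 := Nat.cast_ne_zero.2 m.factorial_ne_zero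
      rw [hm, show i - (j + 1) = m by omega, Nat.factorial_succ, Nat.cast_mul, Nat.add_sub_cancel]
      field_simp
    · rw [if_neg h', show i - j = 0 by omega]
      simp
  · rw [if_neg (by omega)]
    simp only [h, if_false]
    exact hasDerivAt_const s 0

lemma iteratedDeriv_gammaOC (i : Fin (2 * n + 1)) (j : ℕ) :
    iteratedDeriv j (gammaOC n i) = gcoef n j i := by
  induction j with
  | zero =>
    ext s
    simp [gammaOC, gcoef]
  | succ j ih =>
    rw [iteratedDeriv_succ, ih]
    exact funext fun s => (hasDerivAt_gcoef n j i s).deriv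

lemma gcoef_succ_succ (n j i : ℕ) (s : ℂ) :
    gcoef n (j + 1) (i + 1) s = gcoef n j i s * (if i < n then 1 else -1) := by
  unfold gcoef
  by_cases h : j ≤ i
  · rw [if_pos h, if_pos (by omega), Nat.add_sub_add_right]
    split_ifs with hi
    · rw [show i + 1 - n = 0 by omega, show i - n = 0 by omega, mul_one]
    · rw [show i + 1 - n = i - n + 1 by omega, pow_succ]
      ring
  · rw [if_neg h, if_neg (by omega), zero_mul]

lemma gcoef_at_zero (n j i : ℕ) : gcoef n j i 0 = if i = j then (-1) ^ (i - n) else 0 := by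
  unfold gcoef
  by_cases h : i = j
  · subst h; simp
  · rw [if_neg h]
    split_ifs with h'
    · rw [zero_pow (by omega)]; simp
    · rfl

lemma apply_eq_zero_of_mem_oscOC {k : ℕ} {x : Fin (2 * n + 1) → ℂ} (hx : x ∈ oscOC n k 0)
    (i : Fin (2 * n + 1)) (hi : k ≤ i) : x i = 0 := by
  have : oscOC n k 0 ≤ LinearMap.ker (LinearMap.proj (R := ℂ) (φ := fun _ => ℂ) i) := by
    refine Submodule.span_le.2 ?_
    rintro _ ⟨j, rfl⟩
    have := j.2
    change iteratedDeriv (j : ℕ) (gammaOC n i) 0 = 0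
    rw [iteratedDeriv_gammaOC, gcoef_at_zero, if_neg (by omega)]
  exact this hx

lemma clifford_eq_sum_range (f : ℕ → ℂ) :
    clifford (fun i : Fin (2 * n + 1) => f i) = ∑ i ∈ Finset.range (2 * n + 1), f i • cliff n i :=
  Fin.sum_univ_eq_sum_range (fun i => f i • cliff n i) (2 * n + 1)

lemma lower_comm_clifford (j : ℕ) (s : ℂ) :
    lower n * clifford (fun i => gcoef n j i s) - clifford (fun i => gcoef n j i s) * lower n =
      clifford (fun i => gcoef n (j + 1) i s) := by
  rw [clifford_eq_sum_range fun i => gcoef n j i s,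
    clifford_eq_sum_range fun i => gcoef n (j + 1) i s,
    Finset.sum_range_succ' fun i => gcoef n (j + 1) i s • cliff n i, Finset.mul_sum,
    Finset.sum_mul, ← Finset.sum_sub_distrib, Finset.sum_range_succ]
  have h0 : gcoef n (j + 1) 0 s = 0 := by simp [gcoef]
  have h : ∀ i, lower n * (gcoef n j i s • cliff n i) - (gcoef n j i s • cliff n i) * lower n =
      gcoef n (j + 1) (i + 1) s • cliff n (i + 1) := fun i => by
    rw [gcoef_succ_succ, mul_smul, ← lower_comm, mul_smul_comm, smul_mul_assoc, smul_sub]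
  rw [h, cliff_of_two_mul_lt (by omega), smul_zero, h0, zero_smul, Finset.sum_congr rfl fun i _ => h i]

lemma osc_zero (ψ : Spinor n) : osc n 0 ψ = ψ ∅ := by
  rw [osc_apply, Finset.sum_range_succ', Finset.sum_eq_zero]
  · simp
  · intro k _
    simp

/-- The osculating functional intertwines the maximal isotropic osculating subspace with scalars. -/
lemma osc_clifford_gcoef {j : ℕ} (hj : j ≤ n) (m : ℕ) : ∀ φ : Spinor n,
    (∀ A, m ≤ wt A → φ A = 0) → ∀ s : ℂ,
      osc n s (clifford (fun i => gcoef n j i s) φ) = (if j = n then 1 else 0) * osc n s φ := by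
  induction m with
  | zero =>
    intro φ hφ s
    rw [show φ = 0 from funext fun A => hφ A (Nat.zero_le _)]
    simp
  | succ m ih =>
    intro φ hφ
    have hlow : ∀ A, m ≤ wt A → lower n φ A = 0 := fun A hA => by
      rw [lower_apply]
      refine Finset.sum_eq_zero fun p _ => ?_
      split_ifs with h
      · exact hφ _ (by rw [wt_up h]; omega)
      · rfl
    set c : ℂ := if j = n then 1 else 0 with hc
    have hexp : ∀ k s φ, osc n s (clifford (fun i => gcoef n k i s) φ) =
        ∑ i : Fin (2 * n + 1), gcoef n k i s * osc n s (cliff n i φ) := fun k s φ => by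
      simp [clifford, LinearMap.sum_apply]
    have hder : ∀ s, HasDerivAt
        (fun s => osc n s (clifford (fun i => gcoef n j i s) φ) - c * osc n s φ) 0 s := by
      intro s
      have h1 := HasDerivAt.fun_sum fun (i : Fin (2 * n + 1)) (_ : i ∈ Finset.univ) =>
        (hasDerivAt_gcoef n j i s).mul (hasDerivAt_osc (cliff n i φ) s)
      have h2 := h1.sub ((hasDerivAt_osc φ s).const_mul c)
      have h3 : osc n s (clifford (fun i => gcoef n (j + 1) i s) φ) =
          osc n s (lower n (clifford (fun i => gcoef n j i s) φ)) -
            osc n s (clifford (fun i => gcoef n j i s) (lower n φ)) := by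
        rw [← lower_comm_clifford, LinearMap.sub_apply, map_sub]; rfl
      have h4 : osc n s (lower n (clifford (fun i => gcoef n j i s) φ)) =
          ∑ i : Fin (2 * n + 1), gcoef n j i s * osc n s (lower n (cliff n i φ)) := by
        simp [clifford, LinearMap.sum_apply]
      simp only [hexp]
      refine HasDerivAt.congr_deriv h2 ?_
      rw [Finset.sum_add_distrib, ← hexp]
      simp only [mul_neg, Finset.sum_neg_distrib]
      rw [← h4, h3, ih _ hlow s]
      ring
    intro s
    have h0 : osc n 0 (clifford (fun i => gcoef n j i 0) φ) - c * osc n 0 φ = 0 := by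
      rw [osc_zero, osc_zero, clifford_eq_sum_range fun i => gcoef n j i 0,
        Finset.sum_eq_single j]
      · rw [gcoef_at_zero, if_pos rfl, show j - n = 0 by omega, pow_zero, one_smul, hc]
        rcases hj.lt_or_eq with h | h
        · have : cliff n j φ ∅ = 0 := by
            rw [show j = ((⟨j, h⟩ : Fin n) : ℕ) from rfl, cliff_of_lt, modeOp_apply]
            simp
          rw [this, if_neg h.ne]; simp
        · rw [if_pos h, h, cliff_middle, parityOp_apply]
          simp [sg, cnt]
      · intro i _ hi
        rw [gcoef_at_zero, if_neg hi, zero_smul]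
      · intro h
        simp at h; omega
    have := is_const_of_deriv_eq_zero (fun s => (hder s).differentiableAt) (fun s => (hder s).deriv)
      s 0
    exact sub_eq_zero.1 (this.trans h0)

lemma exists_osc_clifford {s : ℂ} {w : Fin (2 * n + 1) → ℂ} (hw : w ∈ oscOC n (n + 1) s) :
    ∃ c : ℂ, ∀ φ, osc n s (clifford w φ) = c * osc n s φ := by
  induction hw using Submodule.span_induction with
  | mem x hx =>
    obtain ⟨j, rfl⟩ := hx
    refine ⟨if (j : ℕ) = n then 1 else 0, fun φ => ?_⟩
    simp only [iteratedDeriv_gammaOC]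
    exact osc_clifford_gcoef (by omega) (wt Finset.univ + 1) φ (fun A hA => by
      have := (dominated_univ A).wt_le
      omega) s
  | zero => exact ⟨0, fun φ => by simp [clifford_zero]⟩
  | add x y _ _ hx hy =>
    obtain ⟨c, hc⟩ := hx
    obtain ⟨d, hd⟩ := hy
    exact ⟨c + d, fun φ => by rw [clifford_add, LinearMap.add_apply, map_add, hc, hd, add_mul]⟩
  | smul a x _ hx =>
    obtain ⟨c, hc⟩ := hx
    exact ⟨a * c, fun φ => by
      rw [clifford_smul, LinearMap.smul_apply, map_smul, hc, smul_eq_mul, mul_assoc]⟩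

lemma osc_eq_zero {s : ℂ} {w : Fin (2 * n + 1) → ℂ} (hw : w ∈ oscOC n (n + 1) s) (hw0 : w ≠ 0)
    {ψ : Spinor n} (hψ : clifford w ψ = 0) : osc n s ψ = 0 := by
  obtain ⟨c, hc⟩ := exists_osc_clifford hw
  by_cases h : c = 0
  · exact functional_eq_zero hw0 hψ _ fun φ => by rw [hc, h, zero_mul]
  · have := hc ψ
    rw [hψ, map_zero] at this
    exact (mul_eq_zero.1 this.symm).resolve_left h

lemma cnt_eq_card (k : ℕ) (A : Finset (Fin n)) : cnt k A = (A.filter fun p : Fin n => (p : ℕ) < k).card :=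
  (Finset.card_filter _ _).symm

lemma apply_eq_zero_of_cnt_lt {H : Submodule ℂ (Fin (2 * n + 1) → ℂ)} {ψ : Spinor n}
    (hψ : ∀ h ∈ H, clifford h ψ = 0) {k : ℕ} (hk : k ≤ n) {ν : Finset (Fin n)}
    (h : cnt k ν < Module.finrank ℂ ↥(H ⊓ oscOC n k 0)) : ψ ν = 0 := by
  let emb : Fin n → Fin (2 * n + 1) := fun p => ⟨p, by omega⟩
  let f : ↥(H ⊓ oscOC n k 0) →ₗ[ℂ] ({p // p ∈ ν.filter fun p : Fin n => (p : ℕ) < k} → ℂ) :=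
    (LinearMap.funLeft ℂ ℂ fun p => emb p.1) ∘ₗ (H ⊓ oscOC n k 0).subtype
  have hf : LinearMap.ker f ≠ ⊥ := LinearMap.ker_ne_bot_of_finrank_lt (by
    rw [Module.finrank_fintype_fun_eq_card, Fintype.card_coe, ← cnt_eq_card]
    exact h)
  obtain ⟨⟨w, hw⟩, hwf, hw0⟩ := Submodule.exists_mem_ne_zero_of_ne_bot hf
  have hw0' : w ≠ 0 := fun h => hw0 (Subtype.ext h)
  have hge := apply_eq_zero_of_mem_oscOC hw.2
  refine functional_eq_zero hw0' (hψ w hw.1) (LinearMap.proj ν) fun φ => ?_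
  rw [LinearMap.proj_apply, clifford, LinearMap.sum_apply, Finset.sum_apply]
  refine Finset.sum_eq_zero fun i _ => ?_
  rw [LinearMap.smul_apply, Pi.smul_apply, smul_eq_mul]
  by_cases hi : k ≤ i
  · rw [hge i hi, zero_mul]
  · by_cases hm : (⟨i, by omega⟩ : Fin n) ∈ ν
    · have := congr_fun (LinearMap.mem_ker.1 hwf)
        ⟨⟨i, by omega⟩, Finset.mem_filter.2 ⟨hm, not_le.1 hi⟩⟩
      rw [show w i = 0 from this, zero_mul]
    · rw [show (i : ℕ) = ((⟨i, by omega⟩ : Fin n) : ℕ) from rfl, cliff_of_lt, modeOp_apply]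
      simp [hm]

lemma exists_modes {l : ℕ} {μ : Fin l → ℕ} (hanti : StrictAnti μ) (hpos : ∀ i, 0 < μ i)
    (hle : ∀ i, μ i ≤ n) : ∃ M : Finset (Fin n), wt M = ∑ i, μ i ∧
      ∀ ν : Finset (Fin n), (∀ i : Fin l, (i : ℕ) + 1 ≤ cnt (n + 1 - μ i) ν) → Dominated M ν := by
  classical
  let f : Fin l → Fin n := fun i => ⟨n - μ i, by have := hpos i; have := hle i; omega⟩
  have hf : Function.Injective f := fun i j hij => hanti.injective (by
    have h1 := hle i
    have h2 := hle j
    have : n - μ i = n - μ j := congrArg Fin.val hij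
    omega)
  refine ⟨Finset.univ.image f, ?_, fun ν hν k => ?_⟩
  · rw [wt_eq_sum, Finset.sum_image fun _ _ _ _ h => hf h]
    refine Finset.sum_congr rfl fun i _ => ?_
    have := hle i
    change n - (n - μ i) = _
    omega
  · unfold cnt
    rw [Finset.sum_image fun _ _ _ _ h => hf h, ← Finset.card_filter]
    rcases (Finset.univ.filter fun i => (f i : ℕ) < k).eq_empty_or_nonempty with h | h
    · rw [h]; simp
    · obtain ⟨i, hi, hmax⟩ := Finset.exists_max_image _ id h
      have h1 : (Finset.univ.filter fun i => (f i : ℕ) < k) ⊆ Finset.Iic i := fun j hj =>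
        Finset.mem_Iic.2 (hmax j hj)
      have h2 := Finset.card_le_card h1
      rw [Fin.card_Iic] at h2
      have h3 : n - μ i < k := (Finset.mem_filter.1 hi).2
      have h4 := hpos i
      exact h2.trans ((hν i).trans (cnt_mono ν (by omega)))
/-! ### Supports of pure spinors and of tangent vectors -/

lemma quad_eq (A B : Finset (Fin n)) (x y : Spinor n) :
    quad A B x y = ∑ p : Fin n, (if (p ∈ A ↔ p ∈ B) then 0 else
      2 * (sg p A * sg p B) * (x (tog A p) * y (tog B p))) + (sg n A * sg n B - 1) * (x A * y B) := by
  have h1 : ∑ i : Fin (2 * n + 1), cliff n i x A * cliff n (pairOC n i) y B =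
      ∑ i ∈ Finset.range (2 * n + 1), cliff n i x A * cliff n (2 * n - i) y B :=
    Fin.sum_univ_eq_sum_range (fun i => cliff n i x A * cliff n (2 * n - i) y B) (2 * n + 1)
  have h2 : ∑ i ∈ Finset.range n, cliff n (n + 1 + i) x A * cliff n (2 * n - (n + 1 + i)) y B =
      ∑ i ∈ Finset.range n, cliff n (2 * n - i) x A * cliff n i y B := by
    rw [← Finset.sum_range_reflect (fun i => cliff n (2 * n - i) x A * cliff n i y B)]
    refine Finset.sum_congr rfl fun i hi => ?_
    rw [Finset.mem_range] at hi
    rw [show 2 * n - (n - 1 - i) = n + 1 + i by omega, show 2 * n - (n + 1 + i) = n - 1 - i by omega]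
  rw [quad, h1, show 2 * n + 1 = n + 1 + n by omega, Finset.sum_range_add, h2,
    Finset.sum_range_succ, show 2 * n - n = n by omega, cliff_middle, parityOp_apply, parityOp_apply,
    add_right_comm, ← Finset.sum_add_distrib,
    ← Fin.sum_univ_eq_sum_range (fun i => cliff n i x A * cliff n (2 * n - i) y B +
      cliff n (2 * n - i) x A * cliff n i y B)]
  rw [add_sub_assoc]
  congr 1
  · refine Finset.sum_congr rfl fun p _ => ?_
    rw [cliff_of_gt, cliff_of_lt]
    simp only [LinearMap.smul_apply, Pi.smul_apply, smul_eq_mul, modeOp_apply]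
    by_cases hA : p ∈ A <;> by_cases hB : p ∈ B <;> simp [hA, hB] <;> ring
  · ring

/-- Symmetrised polarisation of the quadrics cutting out pure spinors. -/
noncomputable def polar (A B : Finset (Fin n)) (x y : Spinor n) : ℂ := quad A B x y + quad A B y x

lemma apply_eq_zero_of_polar {lam : Finset (Fin n)} {ψ v : Spinor n} (hlam : ψ lam ≠ 0)
    (hpol : ∀ A B, polar A B ψ v = 0)
    (hlow : ∀ κ, Dominated κ lam → κ ≠ lam → ψ κ = 0 ∧ v κ = 0)
    (hsupp : (∀ ν, ¬ Dominated lam ν → ψ ν = 0) ∨ ψ = v) (m : ℕ) : ∀ ν : Finset (Fin n),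
      ¬ Dominated lam ν → (Finset.univ.filter fun q => ¬ (q ∈ lam ↔ q ∈ ν)).card = m → v ν = 0 := by
  induction m using Nat.strong_induction_on with
  | _ m ih =>
  intro ν hν hm
  have hboth : ∀ ν', ¬ Dominated lam ν' →
      (Finset.univ.filter fun q => ¬ (q ∈ lam ↔ q ∈ ν')) ⊂
        (Finset.univ.filter fun q => ¬ (q ∈ lam ↔ q ∈ ν)) → ψ ν' = 0 ∧ v ν' = 0 := by
    intro ν' h1 h2
    have hv : v ν' = 0 := ih _ (hm ▸ Finset.card_lt_card h2) ν' h1 rfl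
    rcases hsupp with h | h
    · exact ⟨h ν' h1, hv⟩
    · exact ⟨h ▸ hv, hv⟩
  have hne : (Finset.univ.filter fun q => ¬ (q ∈ lam ↔ q ∈ ν)).Nonempty := by
    by_contra h
    rw [Finset.not_nonempty_iff_eq_empty, Finset.filter_eq_empty_iff] at h
    refine hν ?_
    rw [show lam = ν from Finset.ext fun q => not_not.1 (h (Finset.mem_univ q))]
    exact Dominated.refl _
  obtain ⟨p, hp, hmin⟩ := Finset.exists_min_image _ id hne
  have hp' := (Finset.mem_filter.1 hp).2
  have hlt : ∀ q, ¬ (q ∈ lam ↔ q ∈ ν) → q ≠ p → p < q := fun q hq hqp =>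
    lt_of_le_of_ne (hmin q (Finset.mem_filter.2 ⟨Finset.mem_univ q, hq⟩)) hqp.symm
  have hvanish : (ψ (tog lam p) * v (tog ν p) = 0 ∧ v (tog lam p) * ψ (tog ν p) = 0) ∧
      ∀ q, ¬ (q ∈ lam ↔ q ∈ ν) → q ≠ p →
        ψ (tog (tog lam p) q) * v (tog (tog ν p) q) = 0 ∧
        v (tog (tog lam p) q) * ψ (tog (tog ν p) q) = 0 := by
    by_cases hpl : p ∈ lam
    · have h1 := hlow _ (dominated_tog_of_mem hpl) fun h => by
        have := mem_tog_self lam p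
        rw [h] at this; tauto
      refine ⟨by simp [h1.1, h1.2], fun q hq hqp => ?_⟩
      have h2 := hlow _ (dominated_tog_tog_of_mem hpl (hlt q hq hqp)) fun h => by
        have := mem_tog_self lam p
        rw [← mem_tog_of_ne _ hqp.symm, h] at this; tauto
      simp [h2.1, h2.2]
    · have hpν : p ∈ ν := by tauto
      have h1 := hboth (tog ν p) (fun h => hν (h.trans (dominated_tog_of_mem hpν))) (by
        refine (Finset.ssubset_iff_of_subset fun q hq => ?_).2 ⟨p, hp, ?_⟩
        · simp only [Finset.mem_filter, Finset.mem_univ, true_and, mem_tog] at hq ⊢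
          by_cases hqp : q = p
          · subst hqp; exact hp'
          · tauto
        · simp only [Finset.mem_filter, Finset.mem_univ, true_and, mem_tog]
          tauto)
      refine ⟨by simp [h1.1, h1.2], fun q hq hqp => ?_⟩
      have h2 := hboth (tog (tog ν p) q)
        (fun h => hν (h.trans (dominated_tog_tog_of_mem hpν (hlt q hq hqp)))) (by
        refine (Finset.ssubset_iff_of_subset fun x hx => ?_).2 ⟨p, hp, ?_⟩
        · simp only [Finset.mem_filter, Finset.mem_univ, true_and, mem_tog] at hx ⊢
          by_cases hxp : x = p
          · subst hxp; exact hp'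
          · by_cases hxq : x = q
            · subst hxq; exact hq
            · tauto
        · have := hqp.symm
          simp only [Finset.mem_filter, Finset.mem_univ, true_and, mem_tog]
          tauto)
      simp [h2.1, h2.2]
  have hpq := hpol (tog lam p) (tog ν p)
  rw [polar, quad_eq, quad_eq, Finset.sum_eq_single p, Finset.sum_eq_single p, tog_tog, tog_tog,
    hvanish.1.1, hvanish.1.2] at hpq
  · simp only [if_neg (show ¬ (p ∈ tog lam p ↔ p ∈ tog ν p) by simp only [mem_tog_self]; tauto)] at hpq
    rcases hsupp with h | h
    · rw [h ν hν] at hpq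
      simpa [sg, hlam] using hpq
    · subst h
      have : ψ lam * ψ ν = 0 := by
        have h3 : (4 : ℂ) * (sg p (tog lam p) * sg p (tog ν p)) ≠ 0 := by simp [sg]
        refine (mul_eq_zero.1 (?_ : (4 : ℂ) * (sg p (tog lam p) * sg p (tog ν p)) *
          (ψ lam * ψ ν) = 0)).resolve_left h3
        linear_combination hpq
      exact (mul_eq_zero.1 this).resolve_left hlam
  all_goals first
    | (intro q _ hqp
       by_cases hq : q ∈ lam ↔ q ∈ ν
       · rw [if_pos (by simpa only [mem_tog_of_ne _ hqp] using hq)]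
       · rw [if_neg (by simpa only [mem_tog_of_ne _ hqp] using hq)]
         first
           | rw [(hvanish.2 q hq hqp).1, mul_zero]
           | rw [(hvanish.2 q hq hqp).2, mul_zero])
    | (intro h; exact absurd (Finset.mem_univ _) h)

/-- The support of a pure spinor has a least element. -/
lemma exists_leading {ψ : Spinor n} (h0 : ψ ≠ 0) (hq : ∀ A B, quad A B ψ ψ = 0) :
    ∃ lam, ψ lam ≠ 0 ∧ ∀ ν, ψ ν ≠ 0 → Dominated lam ν := by
  classical
  have hne : (Finset.univ.filter fun A => ψ A ≠ 0).Nonempty := by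
    obtain ⟨A, hA⟩ := Function.ne_iff.1 h0
    exact ⟨A, Finset.mem_filter.2 ⟨Finset.mem_univ A, hA⟩⟩
  obtain ⟨lam, hlam, hmin⟩ := Finset.exists_min_image _ wt hne
  have hlam' := (Finset.mem_filter.1 hlam).2
  refine ⟨lam, hlam', fun ν => ?_⟩
  contrapose!
  intro hν
  refine apply_eq_zero_of_polar hlam' (fun A B => by rw [polar, hq, add_zero])
    (fun κ h1 h2 => ?_) (Or.inr rfl) _ ν hν rfl
  have : ψ κ = 0 := by
    by_contra h
    exact h2 (h1.eq_of_wt_le (hmin κ (Finset.mem_filter.2 ⟨Finset.mem_univ κ, h⟩)))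
  exact ⟨this, this⟩

/-- The spinors whose coordinates vanish unless they dominate `μ`. -/
def SuppGE (μ : Finset (Fin n)) (ψ : Spinor n) : Prop := ∀ ν, ψ ν ≠ 0 → Dominated μ ν

/-- The tangent vectors vanishing at `μ` to a point of a boundary divisor lie in its span. -/
lemma suppGE_of_polar {μ lam : Finset (Fin n)} (hwt : wt lam = wt μ + 1)
    {ψ v : Spinor n} (hlam : ψ lam ≠ 0) (hψ : SuppGE lam ψ) (hv : SuppGE μ v) (hvμ : v μ = 0)
    (hpol : ∀ A B, polar A B ψ v = 0) : SuppGE lam v := by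
  intro ν
  contrapose!
  intro hν
  refine apply_eq_zero_of_polar hlam hpol (fun κ h1 h2 => ⟨?_, ?_⟩)
    (Or.inl fun κ hκ => by_contra fun h => hκ (hψ κ h)) _ ν hν rfl
  · by_contra h
    exact h2 (h1.eq_of_wt_le (hψ κ h).wt_le)
  · by_contra h
    have h3 := hv κ h
    have h4 : wt κ ≤ wt μ := by
      by_contra h5
      exact h2 (h1.eq_of_wt_le (by omega))
    exact h ((h3.eq_of_wt_le h4) ▸ hvμ)

/-- A pure spinor supported above `μ` and vanishing at `μ` lies over a boundary divisor. -/
lemma exists_suppGE {μ : Finset (Fin n)} {ψ : Spinor n} (h0 : ψ ≠ 0)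
    (hq : ∀ A B, quad A B ψ ψ = 0) (hμ : SuppGE μ ψ) (hμ0 : ψ μ = 0) :
    ∃ lam, wt lam = wt μ + 1 ∧ Dominated μ lam ∧ SuppGE lam ψ := by
  obtain ⟨κ, h1, h2⟩ := exists_leading h0 hq
  obtain ⟨p, hadd, hp⟩ := (hμ κ h1).exists_addable fun h => h1 (h ▸ hμ0)
  exact ⟨up μ p, wt_up hadd, dominated_up hadd, fun ν hν => hp.trans (h2 ν hν)⟩
/-! ### Specialising the osculating flag to the base point -/

open Filter Topology

lemma quad_add_left (A B : Finset (Fin n)) (x y z : Spinor n) :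
    quad A B (x + y) z = quad A B x z + quad A B y z := by
  simp only [quad, map_add, Pi.add_apply, add_mul, Finset.sum_add_distrib]; ring

lemma quad_add_right (A B : Finset (Fin n)) (x y z : Spinor n) :
    quad A B x (y + z) = quad A B x y + quad A B x z := by
  simp only [quad, map_add, Pi.add_apply, mul_add, Finset.sum_add_distrib]; ring

lemma quad_smul_left (A B : Finset (Fin n)) (c : ℂ) (x y : Spinor n) :
    quad A B (c • x) y = c * quad A B x y := by
  simp only [quad, map_smul, Pi.smul_apply, smul_eq_mul, mul_sub, Finset.mul_sum, mul_assoc]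

lemma quad_smul_right (A B : Finset (Fin n)) (c : ℂ) (x y : Spinor n) :
    quad A B x (c • y) = c * quad A B x y := by
  simp only [quad, map_smul, Pi.smul_apply, smul_eq_mul, mul_sub, Finset.mul_sum, mul_left_comm]

lemma quad_star (A B : Finset (Fin n)) (x y : Spinor n) :
    quad A B (star x) (star y) = star (quad A B x y) := by
  have hs : ∀ k (A : Finset (Fin n)), (starRingEnd ℂ) (sg k A) = sg k A := fun k A => by simp [sg]
  simp only [quad_eq, Complex.star_def, map_add, map_sum, map_mul, map_sub, map_one, hs, apply_ite
    (starRingEnd ℂ), map_zero, map_ofNat, Pi.star_apply]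

lemma polar_smul_right (A B : Finset (Fin n)) (c : ℂ) (x y : Spinor n) :
    polar A B x (c • y) = c * polar A B x y := by
  rw [polar, polar, quad_smul_left, quad_smul_right, mul_add]

lemma polar_smul_left (A B : Finset (Fin n)) (c : ℂ) (x y : Spinor n) :
    polar A B (c • x) y = c * polar A B x y := by
  rw [polar, polar, quad_smul_left, quad_smul_right, mul_add]

lemma polar_sub_right (A B : Finset (Fin n)) (x y z : Spinor n) :
    polar A B x (y - z) = polar A B x y - polar A B x z := by
  rw [sub_eq_add_neg, ← neg_one_smul ℂ z, polar, quad_add_left, quad_add_right, quad_smul_left,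
    quad_smul_right, polar, polar]
  ring

lemma polar_add_sub (A B : Finset (Fin n)) (x y : Spinor n) :
    polar A B (x + y) (x - y) = 2 * (quad A B x x - quad A B y y) := by
  rw [polar_sub_right]
  simp only [polar, quad_add_left, quad_add_right]
  ring

lemma continuous_quad (A B : Finset (Fin n)) :
    Continuous fun p : Spinor n × Spinor n => quad A B p.1 p.2 := by
  simp only [quad_eq]
  refine Continuous.add (continuous_finsetSum _ fun p _ => ?_) (by fun_prop)
  split_ifs <;> fun_prop

lemma tendsto_quad {ι : Type*} {l : Filter ι} {a b : ι → Spinor n} {x y : Spinor n}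
    (ha : Tendsto a l (𝓝 x)) (hb : Tendsto b l (𝓝 y)) (A B : Finset (Fin n)) :
    Tendsto (fun i => quad A B (a i) (b i)) l (𝓝 (quad A B x y)) := by
  have h := ((continuous_quad A B).tendsto (x, y)).comp (ha.prodMk_nhds hb)
  simpa only [Function.comp_def] using h

lemma tendsto_polar {ι : Type*} {l : Filter ι} {a b : ι → Spinor n} {x y : Spinor n}
    (ha : Tendsto a l (𝓝 x)) (hb : Tendsto b l (𝓝 y)) (A B : Finset (Fin n)) :
    Tendsto (fun i => polar A B (a i) (b i)) l (𝓝 (polar A B x y)) :=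
  (tendsto_quad ha hb A B).add (tendsto_quad hb ha A B)

lemma osc_star (s : ℝ) (ψ : Spinor n) : osc n s (star ψ) = star (osc n s ψ) := by
  obtain ⟨c, -, hc⟩ := exists_osc_coeff n
  simp [hc]

/-- The linear span of the Schubert variety of `μ`. -/
def schubert (μ : Finset (Fin n)) : Submodule ℂ (Spinor n) where
  carrier := {ψ | SuppGE μ ψ}
  zero_mem' := fun ν h => absurd rfl h
  add_mem' := fun {x y} hx hy ν h => by
    by_cases h' : x ν = 0
    · exact hy ν fun h'' => h (by rw [Pi.add_apply, h', h'', add_zero])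
    · exact hx ν h'
  smul_mem' := fun c x hx ν h => hx ν fun h' => h (by rw [Pi.smul_apply, h', smul_zero])

lemma star_mem_schubert {μ : Finset (Fin n)} {ψ : Spinor n} (h : ψ ∈ schubert μ) :
    star ψ ∈ schubert μ := fun ν hν => h ν fun h' => hν (by rw [Pi.star_apply, h', star_zero])

/-- The nonzero pure spinors in a linear subspace. -/
def pureIn (V : Submodule ℂ (Spinor n)) : Set (Spinor n) :=
  {ψ | ψ ≠ 0 ∧ (∀ A B, quad A B ψ ψ = 0) ∧ ψ ∈ V}

lemma pureIn_smul {V : Submodule ℂ (Spinor n)} {ψ : Spinor n} (h : ψ ∈ pureIn V) {c : ℂ}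
    (hc : c ≠ 0) : c • ψ ∈ pureIn V :=
  ⟨smul_ne_zero hc h.1, fun A B => by rw [quad_smul_left, quad_smul_right, h.2.1]; simp,
    V.smul_mem c h.2.2⟩

lemma pureIn_mono {V V' : Submodule ℂ (Spinor n)} (h : V ≤ V') : pureIn V ⊆ pureIn V' :=
  fun _ hψ => ⟨hψ.1, hψ.2.1, h hψ.2.2⟩

lemma norm_normalize {ψ : Spinor n} (h : ψ ≠ 0) : ‖((‖ψ‖⁻¹ : ℝ) : ℂ) • ψ‖ = 1 := by
  rw [norm_smul, Complex.norm_real, norm_inv, norm_norm, inv_mul_cancel₀ (norm_ne_zero_iff.2 h)]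

lemma exists_tendsto {ι : Type*} (U : Ultrafilter ι) {a : ι → Spinor n}
    (h : ∀ᶠ i in U, ‖a i‖ = 1) : ∃ x, ‖x‖ = 1 ∧ Tendsto a U (𝓝 x) := by
  obtain ⟨x, hx, hlim⟩ := (isCompact_sphere (0 : Spinor n) 1).ultrafilter_le_nhds' (U.map a)
    (Ultrafilter.mem_map.2 (h.mono fun i hi => by simpa using hi))
  exact ⟨x, by simpa using hx, hlim⟩

lemma mem_of_tendsto_submodule {ι : Type*} {l : Filter ι} [l.NeBot] {a : ι → Spinor n}
    {x : Spinor n} (hlim : Tendsto a l (𝓝 x)) {V : Submodule ℂ (Spinor n)}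
    (h : ∀ᶠ i in l, a i ∈ V) : x ∈ V :=
  (Submodule.closed_of_finiteDimensional V).mem_of_tendsto hlim h

lemma pureIn_of_tendsto {ι : Type*} {l : Filter ι} [l.NeBot] {a : ι → Spinor n}
    {x : Spinor n} (hlim : Tendsto a l (𝓝 x)) {V : Submodule ℂ (Spinor n)} (hx : x ≠ 0)
    (h : ∀ᶠ i in l, a i ∈ pureIn V) : x ∈ pureIn V :=
  ⟨hx, fun A B => tendsto_nhds_unique (tendsto_quad hlim hlim A B)
    (tendsto_const_nhds.congr' (h.mono fun _ hi => (hi.2.1 A B).symm)),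
    mem_of_tendsto_submodule hlim (h.mono fun _ hi => hi.2.2)⟩

lemma apply_eq_zero_of_tendsto {l : Filter ℝ} [l.NeBot] (hl : l ≤ 𝓝[>] 0) {μ : Finset (Fin n)}
    {a : ℝ → Spinor n} {x : Spinor n} (hlim : Tendsto a l (𝓝 x))
    (h : ∀ᶠ s in l, a s ∈ schubert μ ∧ osc n s (a s) = 0) : x μ = 0 := by
  obtain ⟨c, hc0, hc⟩ := exists_osc_coeff n
  have hx : x ∈ schubert μ := mem_of_tendsto_submodule hlim (h.mono fun _ hs => hs.1)
  have hs : Tendsto (fun s : ℝ => (s : ℂ)) l (𝓝 0) := by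
    have := (Complex.continuous_ofReal.tendsto 0).mono_left (hl.trans nhdsWithin_le_nhds)
    rwa [Complex.ofReal_zero] at this
  have h1 : Tendsto (fun s : ℝ => ∑ A, (s : ℂ) ^ (wt A - wt μ) * ((c A : ℂ) * a s A)) l
      (𝓝 (∑ A, (0 : ℂ) ^ (wt A - wt μ) * ((c A : ℂ) * x A))) :=
    tendsto_finsetSum _ fun A _ => (hs.pow _).mul
      ((((continuous_apply A).tendsto x).comp hlim).const_mul _)
  have h2 : ∀ᶠ s : ℝ in l, ∑ A, (s : ℂ) ^ (wt A - wt μ) * ((c A : ℂ) * a s A) = 0 := by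
    filter_upwards [h, hl self_mem_nhdsWithin] with s hs hpos
    have hs0 : (s : ℂ) ≠ 0 := Complex.ofReal_ne_zero.2 (ne_of_gt hpos)
    have h3 := hs.2
    rw [hc] at h3
    refine (mul_eq_zero.1 (?_ : (s : ℂ) ^ wt μ * _ = 0)).resolve_left (pow_ne_zero _ hs0)
    rw [Finset.mul_sum, ← h3]
    refine Finset.sum_congr rfl fun A _ => ?_
    by_cases hA : a s A = 0
    · simp [hA]
    · rw [← mul_assoc, ← pow_add, Nat.add_sub_cancel' (hs.1 A hA).wt_le]
  have h4 := tendsto_nhds_unique h1 (tendsto_const_nhds.congr' (h2.mono fun _ h => h.symm))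
  rw [Finset.sum_eq_single μ] at h4
  · simpa [hc0 μ] using h4
  · intro A _ hA
    by_cases hxA : x A = 0
    · simp [hxA]
    · have : ¬ wt A ≤ wt μ := fun h => hA ((hx A hxA).eq_of_wt_le h).symm
      rw [zero_pow (by omega), zero_mul]
  · intro h
    exact absurd (Finset.mem_univ _) h

/-- The points of the Schubert variety of `μ` in `W` lie in the open cell, are reduced,
and are real. -/
def Good (μ : Finset (Fin n)) (W : Submodule ℂ (Spinor n)) : Prop :=
  ∀ ψ ∈ pureIn (schubert μ ⊓ W), ψ μ ≠ 0 ∧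
    (∀ v ∈ schubert μ ⊓ W, v μ = 0 → (∀ A B, polar A B ψ v = 0) → v = 0) ∧
    (ψ μ = 1 → star ψ = ψ)

lemma good_univ (W : Submodule ℂ (Spinor n)) : Good Finset.univ W := by
  have h : ∀ ψ ∈ schubert (Finset.univ : Finset (Fin n)), ∀ ν, ν ≠ Finset.univ → ψ ν = 0 :=
    fun ψ hψ ν hν => by_contra fun h0 => hν ((hψ ν h0).eq_of_wt_le (dominated_univ ν).wt_le).symm
  have h' : ∀ ψ ∈ schubert (Finset.univ : Finset (Fin n)), ψ Finset.univ = 0 → ψ = 0 :=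
    fun ψ hψ h0 => funext fun ν => by
      by_cases hν : ν = Finset.univ
      · rw [hν, h0, Pi.zero_apply]
      · exact h ψ hψ ν hν
  refine fun ψ hψ => ⟨fun h0 => hψ.1 (h' ψ hψ.2.2.1 h0), fun v hv h0 _ => h' v hv.1 h0, fun h1 => ?_⟩
  refine funext fun ν => ?_
  by_cases hν : ν = Finset.univ
  · rw [hν, Pi.star_apply, h1, star_one]
  · rw [Pi.star_apply, h ψ hψ.2.2.1 ν hν, star_zero]

lemma not_polar_of_tendsto {U : Ultrafilter ℝ} (hU : (U : Filter ℝ) ≤ 𝓝[>] 0) {μ lam : Finset (Fin n)}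
    {W : Submodule ℂ (Spinor n)} (hwt : wt lam = wt μ + 1)
    (hG : Good lam W) {a v : ℝ → Spinor n} {x : Spinor n} (hx : x ∈ pureIn (schubert lam ⊓ W))
    (hlim : Tendsto a U (𝓝 x))
    (hv : ∀ᶠ s in U, v s ≠ 0 ∧ v s ∈ schubert μ ⊓ (W ⊓ LinearMap.ker (osc n (s : ℂ))) ∧
      v s lam = 0 ∧ ∀ A B, polar A B (a s) (v s) = 0) : False := by
  obtain ⟨y, hy, hylim⟩ := exists_tendsto U (a := fun s => ((‖v s‖⁻¹ : ℝ) : ℂ) • v s)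
    (hv.mono fun s hs => norm_normalize hs.1)
  have hy1 : y ∈ schubert μ ⊓ W := mem_of_tendsto_submodule hylim (hv.mono fun s hs =>
    Submodule.smul_mem _ _ ⟨hs.2.1.1, hs.2.1.2.1⟩)
  have hyμ : y μ = 0 := apply_eq_zero_of_tendsto hU hylim (hv.mono fun s hs =>
    ⟨Submodule.smul_mem _ _ hs.2.1.1, LinearMap.mem_ker.1 (Submodule.smul_mem _ _ hs.2.1.2.2)⟩)
  have hylam : y lam = 0 := tendsto_nhds_unique (((continuous_apply lam).tendsto y).comp hylim)
    (tendsto_const_nhds.congr' (hv.mono fun s hs => by simp [hs.2.2.1]))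
  have hpol : ∀ A B, polar A B x y = 0 := fun A B =>
    tendsto_nhds_unique (tendsto_polar hlim hylim A B)
      (tendsto_const_nhds.congr' (hv.mono fun s hs => by
        simp only [polar_smul_right, hs.2.2.2, mul_zero]))
  obtain ⟨g1, g2, -⟩ := hG x hx
  have := g2 y ⟨suppGE_of_polar hwt g1 hx.2.2.1 hy1.1 hyμ hpol, hy1.2⟩ hylam hpol
  rw [this, norm_zero] at hy
  exact zero_ne_one hy

lemma exists_boundary_limit {U : Ultrafilter ℝ} (hU : (U : Filter ℝ) ≤ 𝓝[>] 0) {μ : Finset (Fin n)}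
    {W : Submodule ℂ (Spinor n)} {a : ℝ → Spinor n}
    (ha : ∀ᶠ s : ℝ in U, a s ∈ pureIn (schubert μ ⊓ (W ⊓ LinearMap.ker (osc n (s : ℂ))))) :
    ∃ x ∈ pureIn (schubert μ ⊓ W), x μ = 0 ∧
      Tendsto (fun s => ((‖a s‖⁻¹ : ℝ) : ℂ) • a s) U (𝓝 x) := by
  obtain ⟨x, hx, hlim⟩ := exists_tendsto U (a := fun s => ((‖a s‖⁻¹ : ℝ) : ℂ) • a s)
    (ha.mono fun s hs => norm_normalize hs.1)
  have ha' : ∀ᶠ s : ℝ in U, ((‖a s‖⁻¹ : ℝ) : ℂ) • a s ∈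
      pureIn (schubert μ ⊓ (W ⊓ LinearMap.ker (osc n (s : ℂ)))) := ha.mono fun s hs =>
    pureIn_smul hs (Complex.ofReal_ne_zero.2 (inv_ne_zero (norm_ne_zero_iff.2 hs.1)))
  refine ⟨x, pureIn_of_tendsto hlim (fun h => ?_) (ha'.mono fun s hs =>
    pureIn_mono (inf_le_inf_left _ inf_le_left) hs), apply_eq_zero_of_tendsto hU hlim
    (ha'.mono fun s hs => ⟨hs.2.2.1, hs.2.2.2.2⟩), hlim⟩
  rw [h, norm_zero] at hx
  exact zero_ne_one hx

lemma eventually_good {μ : Finset (Fin n)} {W : Submodule ℂ (Spinor n)}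
    (hW : ∀ ψ ∈ W, star ψ ∈ W) (hG : ∀ lam, wt lam = wt μ + 1 → Good lam W) :
    ∀ᶠ s : ℝ in 𝓝[>] 0, Good μ (W ⊓ LinearMap.ker (osc n (s : ℂ))) := by
  refine mem_iff_ultrafilter.2 fun U hU => ?_
  have hcell : ∀ᶠ s : ℝ in U, ∀ ψ ∈ pureIn (schubert μ ⊓ (W ⊓ LinearMap.ker (osc n (s : ℂ)))),
      ψ μ ≠ 0 := by
    have h : ∀ lam, ∀ᶠ s : ℝ in U, wt lam = wt μ + 1 →
        ∀ ψ, ψ ∉ pureIn (schubert lam ⊓ (W ⊓ LinearMap.ker (osc n (s : ℂ)))) := fun lam => by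
      by_cases hwt : wt lam = wt μ + 1
      · by_contra hcon
        rw [← Ultrafilter.eventually_not] at hcon
        push Not at hcon
        obtain ⟨a, ha⟩ := (hcon.mono fun s hs => hs.2).choice
        obtain ⟨x, hx, hx0, -⟩ := exists_boundary_limit hU ha
        exact (hG lam hwt x hx).1 hx0
      · exact Eventually.of_forall fun s h => absurd h hwt
    filter_upwards [eventually_all.2 h] with s hs ψ hψ h0
    obtain ⟨lam, hwt, -, hlam⟩ := exists_suppGE hψ.1 hψ.2.1 hψ.2.2.1 h0
    exact hs lam hwt ψ ⟨hψ.1, hψ.2.1, hlam, hψ.2.2.2⟩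
  have hlimit : ∀ a : ℝ → Spinor n,
      (∀ᶠ s : ℝ in U, a s ∈ pureIn (schubert μ ⊓ (W ⊓ LinearMap.ker (osc n (s : ℂ))))) →
      ∃ lam x, wt lam = wt μ + 1 ∧ x ∈ pureIn (schubert lam ⊓ W) ∧ x lam = 1 ∧
        (∀ᶠ s in U, a s lam ≠ 0) ∧ Tendsto (fun s => (a s lam)⁻¹ • a s) U (𝓝 x) := fun a ha => by
    obtain ⟨x, hx, hx0, hlim⟩ := exists_boundary_limit hU ha
    obtain ⟨lam, hwt, -, hlam⟩ := exists_suppGE hx.1 hx.2.1 hx.2.2.1 hx0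
    have hx' : x ∈ pureIn (schubert lam ⊓ W) := ⟨hx.1, hx.2.1, hlam, hx.2.2.2⟩
    have hxl := (hG lam hwt x hx').1
    have hliml := ((continuous_apply lam).tendsto x).comp hlim
    have hne : ∀ᶠ s in U, a s lam ≠ 0 := by
      filter_upwards [hliml.eventually_ne hxl] with s hs h
      exact hs (by simp [h])
    refine ⟨lam, (x lam)⁻¹ • x, hwt, pureIn_smul hx' (inv_ne_zero hxl), ?_, hne, ?_⟩
    · rw [Pi.smul_apply, smul_eq_mul, inv_mul_cancel₀ hxl]
    · refine ((hliml.inv₀ hxl).smul hlim).congr' ?_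
      filter_upwards [ha] with s hs
      have h1 : ((‖a s‖⁻¹ : ℝ) : ℂ) ≠ 0 :=
        Complex.ofReal_ne_zero.2 (inv_ne_zero (norm_ne_zero_iff.2 hs.1))
      rw [Function.comp_apply, Pi.smul_apply, smul_eq_mul, smul_smul, mul_inv, mul_right_comm,
        inv_mul_cancel₀ h1, one_mul]
  have htangent : ∀ᶠ s : ℝ in U, ∀ ψ ∈ pureIn (schubert μ ⊓ (W ⊓ LinearMap.ker (osc n (s : ℂ)))),
      ∀ v ∈ schubert μ ⊓ (W ⊓ LinearMap.ker (osc n (s : ℂ))), v μ = 0 →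
        (∀ A B, polar A B ψ v = 0) → v = 0 := by
    by_contra hcon
    rw [← Ultrafilter.eventually_not] at hcon
    push Not at hcon
    obtain ⟨a, ha⟩ := hcon.choice
    obtain ⟨v, hv⟩ := (ha.mono fun s hs => hs.2).choice
    obtain ⟨lam, x, hwt, hx, -, hne, hlim⟩ := hlimit a (ha.mono fun s hs => hs.1)
    refine not_polar_of_tendsto hU (v := fun s => v s - (v s lam * (a s lam)⁻¹) • a s) hwt
      (hG lam hwt) hx hlim ?_
    filter_upwards [ha, hv, hne, hcell] with s ha hv hne hcell
    refine ⟨fun h => ?_, Submodule.sub_mem _ hv.1 (Submodule.smul_mem _ _ ha.1.2.2), ?_,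
      fun A B => ?_⟩
    · have h1 := congr_fun h μ
      rw [Pi.sub_apply, hv.2.1, Pi.smul_apply, smul_eq_mul, Pi.zero_apply, zero_sub, neg_eq_zero]
        at h1
      rw [(mul_eq_zero.1 h1).resolve_right (hcell _ ha.1), zero_smul, sub_zero] at h
      exact hv.2.2.2 h
    · rw [Pi.sub_apply, Pi.smul_apply, smul_eq_mul, inv_mul_cancel_right₀ hne, sub_self]
    · rw [polar_smul_left, polar_sub_right, polar_smul_right, hv.2.2.1, polar, ha.1.2.1]
      simp
  have hreal : ∀ᶠ s : ℝ in U, ∀ ψ ∈ pureIn (schubert μ ⊓ (W ⊓ LinearMap.ker (osc n (s : ℂ)))),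
      ψ μ = 1 → star ψ = ψ := by
    by_contra hcon
    rw [← Ultrafilter.eventually_not] at hcon
    push Not at hcon
    obtain ⟨a, ha⟩ := hcon.choice
    obtain ⟨lam, x, hwt, hx, hx1, hne, hlim⟩ := hlimit a (ha.mono fun s hs => hs.1)
    have hlim' := hlim.add (hlim.star)
    rw [(hG lam hwt x hx).2.2 hx1, ← two_smul ℂ] at hlim'
    refine not_polar_of_tendsto hU
      (v := fun s => (a s lam)⁻¹ • a s - star ((a s lam)⁻¹ • a s)) hwt
      (hG lam hwt) (pureIn_smul hx two_ne_zero) hlim' ?_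
    filter_upwards [ha, hne] with s ha hne
    have hb := pureIn_smul ha.1 (inv_ne_zero hne)
    refine ⟨fun h => ?_, Submodule.sub_mem _ hb.2.2 ⟨star_mem_schubert hb.2.2.1,
      hW _ hb.2.2.2.1, ?_⟩, ?_, fun A B => ?_⟩
    · have h1 := (congr_fun (sub_eq_zero.1 h) μ).symm
      rw [Pi.star_apply, Pi.smul_apply, ha.2.1, smul_eq_mul, mul_one] at h1
      have h2 := sub_eq_zero.1 h
      rw [star_smul, h1] at h2
      exact ha.2.2 (smul_right_injective _ (inv_ne_zero hne) h2).symm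
    · rw [SetLike.mem_coe, LinearMap.mem_ker, osc_star, LinearMap.mem_ker.1 hb.2.2.2.2, star_zero]
    · rw [Pi.sub_apply, Pi.star_apply, Pi.smul_apply, smul_eq_mul, inv_mul_cancel₀ hne, star_one,
        sub_self]
    · rw [polar_add_sub, quad_star, hb.2.1, star_zero, sub_zero, mul_zero]
  filter_upwards [hcell, htangent, hreal] with s h1 h2 h3
  exact fun ψ hψ => ⟨h1 ψ hψ, h2 ψ hψ, h3 ψ hψ⟩

lemma exists_good (n r : ℕ) : ∃ s : Fin r → ℝ, ∀ μ : Finset (Fin n),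
    wt μ + r = wt (Finset.univ : Finset (Fin n)) →
      Good μ (⨅ k, LinearMap.ker (osc n (s k : ℂ))) := by
  induction r with
  | zero =>
    refine ⟨Fin.elim0, fun μ hμ => ?_⟩
    rw [(dominated_univ μ).eq_of_wt_le (by omega)]
    exact good_univ _
  | succ r ih =>
    obtain ⟨s, hs⟩ := ih
    have hW : ∀ ψ ∈ ⨅ k, LinearMap.ker (osc n (s k : ℂ)),
        star ψ ∈ ⨅ k, LinearMap.ker (osc n (s k : ℂ)) := fun ψ hψ => by
      simp only [Submodule.mem_iInf, LinearMap.mem_ker, osc_star] at hψ ⊢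
      exact fun k => by rw [hψ k, star_zero]
    have h : ∀ᶠ t : ℝ in 𝓝[>] 0, ∀ μ : Finset (Fin n),
        wt μ + (r + 1) = wt (Finset.univ : Finset (Fin n)) →
          Good μ ((⨅ k, LinearMap.ker (osc n (s k : ℂ))) ⊓ LinearMap.ker (osc n (t : ℂ))) := by
      refine eventually_all.2 fun μ => ?_
      by_cases hμ : wt μ + (r + 1) = wt (Finset.univ : Finset (Fin n))
      · exact (eventually_good hW fun lam hlam => hs lam (by omega)).mono fun t ht _ => ht
      · exact Eventually.of_forall fun t h => absurd h hμ
    obtain ⟨t, ht⟩ := h.exists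
    refine ⟨Fin.cons t s, fun μ hμ => ?_⟩
    have : (⨅ k, LinearMap.ker (osc n ((Fin.cons t s : Fin (r + 1) → ℝ) k : ℂ))) =
        (⨅ k, LinearMap.ker (osc n (s k : ℂ))) ⊓ LinearMap.ker (osc n (t : ℂ)) := by
      ext ψ
      simp only [Submodule.mem_iInf, Submodule.mem_inf, Fin.forall_fin_succ, Fin.cons_zero,
        Fin.cons_succ]
      exact and_comm
    rw [this]
    exact ht μ hμ
lemma Good.finite {μ : Finset (Fin n)} {W : Submodule ℂ (Spinor n)} (hG : Good μ W) :
    {ψ | ψ ∈ pureIn (schubert μ ⊓ W) ∧ ψ μ = 1}.Finite := by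
  by_contra hinf
  have hcompact : IsCompact {ψ | ψ ∈ pureIn (schubert μ ⊓ W) ∧ ψ μ = 1} := by
    have hT : IsCompact {ψ : Spinor n | ‖ψ‖ = 1 ∧ ψ ∈ pureIn (schubert μ ⊓ W)} := by
      refine isCompact_iff_ultrafilter_le_nhds'.2 fun U hU => ?_
      obtain ⟨x, hx, hlim⟩ := exists_tendsto U (a := id) (mem_of_superset hU fun ψ hψ => hψ.1)
      refine ⟨x, ⟨hx, pureIn_of_tendsto hlim (fun h => ?_)
        (mem_of_superset hU fun ψ hψ => hψ.2)⟩, hlim⟩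
      rw [h, norm_zero] at hx
      exact zero_ne_one hx
    have himg := hT.image_of_continuousOn (f := fun ψ => (ψ μ)⁻¹ • ψ)
      (ContinuousOn.smul (ContinuousOn.inv₀ (continuous_apply μ).continuousOn
        fun ψ hψ => (hG ψ hψ.2).1) continuousOn_id)
    convert himg using 1
    refine Set.Subset.antisymm (fun ψ hψ => ?_) ?_
    · have h0 : ((‖ψ‖⁻¹ : ℝ) : ℂ) ≠ 0 :=
        Complex.ofReal_ne_zero.2 (inv_ne_zero (norm_ne_zero_iff.2 hψ.1.1))
      refine ⟨((‖ψ‖⁻¹ : ℝ) : ℂ) • ψ, ⟨norm_normalize hψ.1.1, pureIn_smul hψ.1 h0⟩, ?_⟩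
      simp only [Pi.smul_apply, hψ.2, smul_eq_mul, mul_one, smul_smul, inv_mul_cancel₀ h0, one_smul]
    · rintro _ ⟨ψ, hψ, rfl⟩
      have h0 := (hG ψ hψ.2).1
      refine ⟨pureIn_smul hψ.2 (inv_ne_zero h0), ?_⟩
      simp only [Pi.smul_apply, smul_eq_mul, inv_mul_cancel₀ h0]
  obtain ⟨x, hx, hacc⟩ := Set.Infinite.exists_accPt_of_subset_isCompact hinf hcompact subset_rfl
  have : NeBot (𝓝[≠] x ⊓ 𝓟 {ψ | ψ ∈ pureIn (schubert μ ⊓ W) ∧ ψ μ = 1}) := hacc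
  let U : Ultrafilter (Spinor n) :=
    Ultrafilter.of (𝓝[≠] x ⊓ 𝓟 {ψ | ψ ∈ pureIn (schubert μ ⊓ W) ∧ ψ μ = 1})
  have hU : (U : Filter (Spinor n)) ≤ _ := Ultrafilter.of_le _
  have hne : ∀ᶠ ψ in U, ψ ≠ x := hU (mem_inf_of_left self_mem_nhdsWithin)
  have hS : ∀ᶠ ψ in U, ψ ∈ pureIn (schubert μ ⊓ W) ∧ ψ μ = 1 :=
    hU (mem_inf_of_right (mem_principal_self _))
  have hlim : Tendsto (fun ψ => ψ + x) U (𝓝 (x + x)) :=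
    (tendsto_id.mono_left (hU.trans (inf_le_left.trans nhdsWithin_le_nhds))).add_const x
  rw [← two_smul ℂ] at hlim
  obtain ⟨y, hy, hylim⟩ := exists_tendsto U (a := fun ψ => ((‖ψ - x‖⁻¹ : ℝ) : ℂ) • (ψ - x))
    (hne.mono fun ψ hψ => norm_normalize (sub_ne_zero.2 hψ))
  have hyV : y ∈ schubert μ ⊓ W := mem_of_tendsto_submodule hylim (hS.mono fun ψ hψ =>
    Submodule.smul_mem _ _ (Submodule.sub_mem _ hψ.1.2.2 hx.1.2.2))
  have hyμ : y μ = 0 := tendsto_nhds_unique (((continuous_apply μ).tendsto y).comp hylim)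
    (tendsto_const_nhds.congr' (hS.mono fun ψ hψ => by simp [hψ.2, hx.2]))
  have hpol : ∀ A B, polar A B ((2 : ℂ) • x) y = 0 := fun A B =>
    tendsto_nhds_unique (tendsto_polar hlim hylim A B)
      (tendsto_const_nhds.congr' (hS.mono fun ψ hψ => by
        simp only [polar_smul_right, polar_add_sub, hψ.1.2.1, hx.1.2.1, sub_self, mul_zero]))
  have h0 := (hG _ (pureIn_smul hx.1 two_ne_zero)).2.1 y hyV hyμ hpol
  rw [h0, norm_zero] at hy
  exact zero_ne_one hy

lemma clifford_star (x : Fin (2 * n + 1) → ℂ) (ψ : Spinor n) :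
    clifford (star x) (star ψ) = star (clifford x ψ) := by
  have hs : ∀ k (A : Finset (Fin n)), (starRingEnd ℂ) (sg k A) = sg k A := fun k A => by simp [sg]
  have h : ∀ i, cliff n i (star ψ) = star (cliff n i ψ) := fun i => by
    funext A
    rcases index_cases n i with ⟨p, rfl⟩ | rfl | ⟨p, rfl⟩ | hi
    · simp [cliff_of_lt, modeOp_apply, apply_ite (starRingEnd ℂ), hs]
    · simp [cliff_middle, parityOp_apply, hs]
    · simp [cliff_of_gt, modeOp_apply, apply_ite (starRingEnd ℂ), hs, map_ofNat]
    · simp [cliff_of_two_mul_lt hi]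
  simp [clifford, LinearMap.sum_apply, h]

/-- The spinor variety description of the solutions of a Schubert problem. -/
lemma exists_spinor {μ : Finset (Fin n)} {r : ℕ} {s : Fin r → ℝ}
    (hG : Good μ (⨅ k, LinearMap.ker (osc n (s k : ℂ))))
    {H : Submodule ℂ (Fin (2 * n + 1) → ℂ)} (hdim : Module.finrank ℂ H = n)
    (hiso : ∀ x ∈ H, ∀ y ∈ H, formOC n x y = 0)
    (hμ : ∀ ψ : Spinor n, (∀ h ∈ H, clifford h ψ = 0) → SuppGE μ ψ)
    (hs : ∀ k, H ⊓ oscOC n (n + 1) ((s k : ℝ) : ℂ) ≠ ⊥) :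
    ∃ ψ ∈ pureIn (schubert μ ⊓ ⨅ k, LinearMap.ker (osc n (s k : ℂ))), ψ μ = 1 ∧
      ∀ v, v ∈ H ↔ clifford v ψ = 0 := by
  obtain ⟨φ, hφ0, hφ, hquad⟩ := exists_pure_spinor hdim hiso
  have hpure : φ ∈ pureIn (schubert μ ⊓ ⨅ k, LinearMap.ker (osc n (s k : ℂ))) := by
    refine ⟨hφ0, hquad, hμ φ hφ, (Submodule.mem_iInf _).2 fun k => ?_⟩
    obtain ⟨w, hw, hw0⟩ := Submodule.exists_mem_ne_zero_of_ne_bot (hs k)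
    exact osc_eq_zero hw.2 hw0 (hφ w hw.1)
  have hφμ := (hG φ hpure).1
  have hψ := pureIn_smul hpure (inv_ne_zero hφμ)
  refine ⟨(φ μ)⁻¹ • φ, hψ, ?_, mem_iff_clifford_eq_zero hdim hiso hψ.1 fun h hh => ?_⟩
  · rw [Pi.smul_apply, smul_eq_mul, inv_mul_cancel₀ hφμ]
  · rw [map_smul, hφ h hh, smul_zero]

end OrthSpinor

/-- Corollary 3.2 (transversality weakened to finiteness): for a strict partition `μ` with
parts at most `n` and `r = n(n+1)/2 − |μ|`, there are real numbers `s_1, …, s_r` such that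
the set of maximal isotropic `H ⊆ ℂ^{2n+1}` lying in the Schubert variety
`X_μ F_•(0)` and meeting each `F_{n+1}(s_k)` nontrivially is finite and consists only of
real subspaces. -/
theorem stmt_4 (n : ℕ) (hn : 1 ≤ n) (l : ℕ) (μ : Fin l → ℕ)
    (hanti : StrictAnti μ) (hpos : ∀ i, 0 < μ i) (hle : ∀ i, μ i ≤ n) :
    ∃ s : Fin (n * (n + 1) / 2 - ∑ i, μ i) → ℝ,
      {H : Submodule ℂ (Fin (2 * n + 1) → ℂ) |
          Module.finrank ℂ H = n ∧
          (∀ x ∈ H, ∀ y ∈ H, formOC n x y = 0) ∧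
          (∀ i : Fin l, (i : ℕ) + 1 ≤ Module.finrank ℂ ↥(H ⊓ oscOC n (n + 1 - μ i) 0)) ∧
          (∀ k, H ⊓ oscOC n (n + 1) ((s k : ℝ) : ℂ) ≠ ⊥)}.Finite ∧
      ∀ H ∈ {H : Submodule ℂ (Fin (2 * n + 1) → ℂ) |
          Module.finrank ℂ H = n ∧
          (∀ x ∈ H, ∀ y ∈ H, formOC n x y = 0) ∧
          (∀ i : Fin l, (i : ℕ) + 1 ≤ Module.finrank ℂ ↥(H ⊓ oscOC n (n + 1 - μ i) 0)) ∧
          (∀ k, H ⊓ oscOC n (n + 1) ((s k : ℝ) : ℂ) ≠ ⊥)},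
        conjStableOC n H := by
  obtain ⟨M, hM, hdom⟩ := OrthSpinor.exists_modes hanti hpos hle
  obtain ⟨s, hs⟩ := OrthSpinor.exists_good n (n * (n + 1) / 2 - ∑ i, μ i)
  have hG := hs M (by
    have := (OrthSpinor.dominated_univ M).wt_le
    rw [OrthSpinor.wt_univ] at this ⊢
    omega)
  have key : ∀ H ∈ {H : Submodule ℂ (Fin (2 * n + 1) → ℂ) |
      Module.finrank ℂ H = n ∧
      (∀ x ∈ H, ∀ y ∈ H, formOC n x y = 0) ∧
      (∀ i : Fin l, (i : ℕ) + 1 ≤ Module.finrank ℂ ↥(H ⊓ oscOC n (n + 1 - μ i) 0)) ∧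
      (∀ k, H ⊓ oscOC n (n + 1) ((s k : ℝ) : ℂ) ≠ ⊥)}, _ := fun H hH =>
    OrthSpinor.exists_spinor hG hH.1 hH.2.1 (fun ψ hψ ν hν => hdom ν fun i => by
      by_contra hi
      have := hpos i
      exact hν (OrthSpinor.apply_eq_zero_of_cnt_lt hψ (k := n + 1 - μ i) (by omega)
        ((not_le.1 hi).trans_le (hH.2.2.1 i)))) hH.2.2.2
  refine ⟨s, ?_, fun H hH x hx => ?_⟩
  · refine Set.Finite.of_finite_image ((hG.finite.image fun ψ =>
      {v : Fin (2 * n + 1) → ℂ | OrthSpinor.clifford v ψ = 0}).subset ?_)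
      (SetLike.coe_injective.injOn)
    rintro _ ⟨H, hH, rfl⟩
    obtain ⟨ψ, hψ, h1, h⟩ := key H hH
    exact ⟨ψ, ⟨hψ, h1⟩, Set.ext fun v => (h v).symm⟩
  · obtain ⟨ψ, hψ, h1, h⟩ := key H hH
    have hstar := OrthSpinor.clifford_star x ψ
    rw [(hG ψ hψ).2.2 h1, (h x).1 hx, star_zero] at hstar
    exact (h _).2 hstar
end

section
/- (Theorem 4.2.) Let n ≥ 1 and let μ = (μ_1 > μ_2 > ⋯ > μ_l > 0) be a strict partition with μ_1 ≤ n such that r := n(n+1)/2 − |μ| > 1, where |μ| = μ_1 + ⋯ + μ_l. Then there exist real numbers s_1, …, s_r such that the set of Lagrangian subspaces H ⊆ ℂ^{2n} satisfying dim(H ∩ F_{n+1−μ_i}(0)) ≥ i for i = 1,…,l and H ∩ F_n(s_k) ≠ {0} for k = 1,…,r, is finite (0-dimensional) and contains no real point: no H in this set is stable under coordinatewise complex conjugation. (The first group of conditions defines the codimension-|μ| Schubert variety of the Lagrangian Grassmannian LG(n) relative to the osculating flag at 0; the other conditions define simple Schubert varieties relative to the osculating flags at the s_k.) -/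
/-- The `i`-th coordinate function of the curve `γ : ℂ → ℂ^{2n}`,
`γ(s)_i = (−1)^{max(i−n−1,0)} s^{i−1}/(i−1)!` (0-indexed `i`). -/
noncomputable def gammaLC (n : ℕ) (i : Fin (2 * n)) : ℂ → ℂ :=
  fun s => (-1 : ℂ) ^ ((i : ℕ) - n) * s ^ (i : ℕ) / (Nat.factorial (i : ℕ))

/-- The index pairing `i ↦ 2n+1−i` (1-indexed), i.e. `i ↦ 2n−1−i` (0-indexed),
for `i` among the first `n` indices. -/
def pairLC (n : ℕ) (i : Fin n) : Fin (2 * n) :=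
  ⟨2 * n - 1 - (i : ℕ), by have := i.isLt; omega⟩

/-- The inclusion of the first `n` indices into `Fin (2n)`. -/
def inclLC (n : ℕ) (i : Fin n) : Fin (2 * n) :=
  ⟨(i : ℕ), by have := i.isLt; omega⟩

/-- The alternating form `⟨x,y⟩ = Σ_{i=1}^{n} (x_i y_{2n+1−i} − y_i x_{2n+1−i})` on `ℂ^{2n}`. -/
noncomputable def formLC (n : ℕ) (x y : Fin (2 * n) → ℂ) : ℂ :=
  ∑ i : Fin n, (x (inclLC n i) * y (pairLC n i) - y (inclLC n i) * x (pairLC n i))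

/-- The osculating subspace `F_k(s) = span{γ(s), γ'(s), …, γ^{(k-1)}(s)}`,
derivatives taken coordinatewise. -/
noncomputable def oscLC (n k : ℕ) (s : ℂ) : Submodule ℂ (Fin (2 * n) → ℂ) :=
  Submodule.span ℂ (Set.range fun j : Fin k => fun i => iteratedDeriv (j : ℕ) (gammaLC n i) s)

/-- A subspace of `ℂ^N` is real if it is stable under coordinatewise complex conjugation. -/
def conjStableLC (n : ℕ) (H : Submodule ℂ (Fin (2 * n) → ℂ)) : Prop :=
  ∀ x ∈ H, (fun i => (starRingEnd ℂ) (x i)) ∈ H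

theorem zeroLocus_finite_of_isBounded {σ : Type*} [Finite σ] (S : Set (MvPolynomial σ ℂ))
    (hV : Bornology.IsBounded {x : σ → ℂ | ∀ p ∈ S, MvPolynomial.eval x p = 0}) :
    {x : σ → ℂ | ∀ p ∈ S, MvPolynomial.eval x p = 0}.Finite := by
  classical
  have := Fintype.ofFinite σ
  set V := {x : σ → ℂ | ∀ p ∈ S, MvPolynomial.eval x p = 0} with hVdef
  rcases V.eq_empty_or_nonempty with hE | ⟨x₀, hx₀⟩
  · rw [hE]; exact Set.finite_empty
  set I := Ideal.span S
  have hI : ∀ x ∈ V, ∀ p ∈ I, MvPolynomial.eval x p = 0 := by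
    intro x hx p hp
    have : I ≤ RingHom.ker (MvPolynomial.eval x) := Ideal.span_le.2 fun q hq => hx q hq
    exact this hp
  have hne : I ≠ ⊤ := by
    intro h
    have := hI x₀ hx₀ 1 (h ▸ Submodule.mem_top)
    simp at this
  have : Nontrivial (MvPolynomial σ ℂ ⧸ I) := Ideal.Quotient.nontrivial_iff.2 hne
  obtain ⟨d, g, hg, hgi⟩ := exists_integral_inj_algHom_of_fg ℂ (MvPolynomial σ ℂ ⧸ I)
  rcases Nat.eq_zero_or_pos d with rfl | hd
  · have hC : (algebraMap ℂ (MvPolynomial σ ℂ ⧸ I)).IsIntegral := by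
      have h : algebraMap ℂ (MvPolynomial σ ℂ ⧸ I)
          = g.toRingHom.comp (MvPolynomial.C : ℂ →+* MvPolynomial (Fin 0) ℂ) := by
        ext c
        exact (g.commutes c).symm
      rw [h]
      exact RingHom.IsIntegral.trans _ _
        (RingHom.isIntegral_of_surjective _ (MvPolynomial.C_surjective (Fin 0))) hgi
    choose f hf hf0 using fun i : σ => hC (Ideal.Quotient.mk I (MvPolynomial.X i))
    refine (Set.Finite.pi' (t := fun i => {z : ℂ | (f i).IsRoot z})
      fun i => Polynomial.finite_setOfPred_isRoot (hf i).ne_zero).subset fun x hx i => ?_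
    let e : MvPolynomial σ ℂ ⧸ I →+* ℂ := Ideal.Quotient.lift I (MvPolynomial.eval x) (hI x hx)
    have h := congrArg e (hf0 i)
    rw [map_zero, Polynomial.hom_eval₂] at h
    have h2 : e.comp (algebraMap ℂ (MvPolynomial σ ℂ ⧸ I)) = RingHom.id ℂ := by
      ext c
      change MvPolynomial.eval x (MvPolynomial.C c) = c
      simp
    have h3 : e (Ideal.Quotient.mk I (MvPolynomial.X i)) = x i := by
      change MvPolynomial.eval x (MvPolynomial.X i) = x i
      simp
    rw [h2, h3] at h
    exact h
  · exfalso
    let y : MvPolynomial (Fin d) ℂ := MvPolynomial.X ⟨0, hd⟩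
    obtain ⟨p, hp⟩ := Ideal.Quotient.mk_surjective (I := I) (g y)
    obtain ⟨B, hB⟩ := (hV.isCompact_closure).exists_bound_of_continuousOn
      (f := fun x => MvPolynomial.eval x p) (MvPolynomial.continuous_eval p).continuousOn
    obtain ⟨c, hc⟩ : ∃ c : ℂ, B < ‖c‖ := NormedField.exists_lt_norm ℂ B
    let P : Ideal (MvPolynomial (Fin d) ℂ) := MvPolynomial.vanishingIdeal ℂ {fun _ => c}
    have hP : P.IsMaximal := MvPolynomial.isMaximal_iff_eq_vanishingIdeal_singleton.2 ⟨_, rfl⟩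
    algebraize [g.toRingHom]
    have hker : RingHom.ker g.toRingHom = ⊥ := (RingHom.injective_iff_ker_eq_bot _).1 hg
    obtain ⟨Q, hQ, hQP⟩ := Ideal.exists_ideal_over_maximal_of_isIntegral
      (S := MvPolynomial σ ℂ ⧸ I) P (by
        change RingHom.ker g.toRingHom ≤ P
        rw [hker]; exact bot_le)
    have hQ' : (Q.comap (Ideal.Quotient.mk I)).IsMaximal :=
      Ideal.comap_isMaximal_of_surjective _ Ideal.Quotient.mk_surjective
    obtain ⟨x, hx⟩ := MvPolynomial.isMaximal_iff_eq_vanishingIdeal_singleton.1 hQ'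
    have hmem : ∀ q, Ideal.Quotient.mk I q ∈ Q → MvPolynomial.eval x q = 0 := by
      intro q hq
      have : q ∈ MvPolynomial.vanishingIdeal ℂ {x} := hx ▸ hq
      simpa [MvPolynomial.mem_vanishingIdeal_singleton_iff] using this
    have hxV : x ∈ V := fun q hq => hmem q (by
      rw [Ideal.Quotient.eq_zero_iff_mem.2 (Ideal.subset_span hq)]; exact Q.zero_mem)
    have hyP : y - MvPolynomial.C c ∈ P := by
      simp [P, y]
    rw [← hQP] at hyP
    have h1 : g (y - MvPolynomial.C c) ∈ Q := hyP
    have h2 : g (y - MvPolynomial.C c) = Ideal.Quotient.mk I (p - MvPolynomial.C c) := by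
      rw [map_sub, map_sub, hp]
      congr 1
      exact g.commutes c
    rw [h2] at h1
    have h3 := hmem _ h1
    rw [map_sub, MvPolynomial.eval_C, sub_eq_zero] at h3
    have h4 := hB x (subset_closure hxV)
    rw [h3] at h4
    exact absurd h4 (not_le.2 hc)

section

open Finset Module

/-- Coefficients of the linear functional `σ ↦ ∑ i, weightLC n i * x i * σ ^ (i.rev)` whose square
integrates to the quadratic form of the Lagrangian `F_n(s)`. -/
noncomputable def weightLC (n : ℕ) (i : Fin n) : ℂ :=
  (-1) ^ (i.rev : ℕ) / (Nat.factorial (i.rev : ℕ))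

/-- The symmetric matrix whose graph is the Lagrangian `F_n(s)`. -/
noncomputable def symLC (n : ℕ) (s : ℂ) (i k : Fin n) : ℂ :=
  weightLC n i * weightLC n k * s ^ ((i.rev : ℕ) + k.rev + 1) / ((i.rev : ℕ) + k.rev + 1 : ℕ)

/-- The graph of the symmetric matrix `symLC n s`. -/
def graphLC (n : ℕ) (s : ℂ) : Submodule ℂ (Fin (2 * n) → ℂ) where
  carrier := {v | ∀ i, v (pairLC n i) = ∑ k, symLC n s i k * v (inclLC n k)}
  add_mem' := fun ha hb i => by simp [ha i, hb i, mul_add, sum_add_distrib]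
  zero_mem' := fun i => by simp
  smul_mem' := fun c v hv i => by
    simp only [Pi.smul_apply, smul_eq_mul, hv i, mul_sum]
    exact sum_congr rfl fun k _ => by ring

/-- The vectors supported on the first `min a n` coordinates. -/
def truncLC (n a : ℕ) : Submodule ℂ (Fin (2 * n) → ℂ) where
  carrier := {v | (∀ i, v (pairLC n i) = 0) ∧ ∀ i : Fin n, a ≤ i → v (inclLC n i) = 0}
  add_mem' := fun ha hb =>
    ⟨fun i => by simp [ha.1 i, hb.1 i], fun i hi => by simp [ha.2 i hi, hb.2 i hi]⟩
  zero_mem' := ⟨fun i => rfl, fun i _ => rfl⟩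
  smul_mem' := fun c v hv =>
    ⟨fun i => by simp [hv.1 i], fun i hi => by simp [hv.2 i hi]⟩

theorem mem_graphLC {n : ℕ} {s : ℂ} {v : Fin (2 * n) → ℂ} :
    v ∈ graphLC n s ↔ ∀ i, v (pairLC n i) = ∑ k, symLC n s i k * v (inclLC n k) := Iff.rfl

theorem mem_truncLC {n a : ℕ} {v : Fin (2 * n) → ℂ} :
    v ∈ truncLC n a ↔
      (∀ i, v (pairLC n i) = 0) ∧ ∀ i : Fin n, a ≤ i → v (inclLC n i) = 0 := Iff.rfl

theorem inclLC_or_pairLC {n : ℕ} (i : Fin (2 * n)) :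
    (∃ j, i = inclLC n j) ∨ ∃ j, i = pairLC n j := by
  rcases lt_or_ge (i : ℕ) n with h | h
  · exact Or.inl ⟨⟨i, h⟩, rfl⟩
  · refine Or.inr ⟨⟨2 * n - 1 - i, by omega⟩, Fin.ext ?_⟩
    simp only [pairLC]
    omega

theorem funext_inclLC_pairLC {n : ℕ} {v w : Fin (2 * n) → ℂ}
    (h₁ : ∀ j, v (inclLC n j) = w (inclLC n j)) (h₂ : ∀ j, v (pairLC n j) = w (pairLC n j)) :
    v = w := by
  funext i
  rcases inclLC_or_pairLC i with ⟨j, rfl⟩ | ⟨j, rfl⟩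
  exacts [h₁ j, h₂ j]

theorem iteratedDeriv_gammaLC (n j : ℕ) (i : Fin (2 * n)) (s : ℂ) :
    iteratedDeriv j (gammaLC n i) s =
      if j ≤ i then (-1) ^ ((i : ℕ) - n) * s ^ ((i : ℕ) - j) / (Nat.factorial ((i : ℕ) - j))
      else 0 := by
  have h : gammaLC n i = fun s : ℂ =>
      ((-1 : ℂ) ^ ((i : ℕ) - n) / (Nat.factorial (i : ℕ))) * s ^ (i : ℕ) := by
    funext s; simp only [gammaLC]; ring
  rw [h, iteratedDeriv_const_mul_field, iteratedDeriv_pow]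
  split_ifs with hij
  · have h1 : ((Nat.factorial ((i : ℕ) - j) : ℕ) : ℂ) * ((i : ℕ).descFactorial j : ℕ)
        = (Nat.factorial (i : ℕ) : ℕ) := by
      exact_mod_cast Nat.factorial_mul_descFactorial hij
    have h2 : ((Nat.factorial (i : ℕ) : ℕ) : ℂ) ≠ 0 := by exact_mod_cast Nat.factorial_ne_zero _
    have h3 : ((Nat.factorial ((i : ℕ) - j) : ℕ) : ℂ) ≠ 0 := by
      exact_mod_cast Nat.factorial_ne_zero _
    rw [div_mul_eq_mul_div, div_eq_div_iff h2 h3, ← h1]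
    ring
  · rw [Nat.descFactorial_eq_zero_iff_lt.2 (not_le.1 hij)]
    simp

theorem oscLC_zero_le_truncLC {n a : ℕ} (ha : a ≤ n) : oscLC n a 0 ≤ truncLC n a := by
  refine Submodule.span_le.2 ?_
  rintro _ ⟨j, rfl⟩
  have hj := j.2
  have key : ∀ i : Fin (2 * n), a ≤ i → iteratedDeriv (j : ℕ) (gammaLC n i) 0 = 0 := by
    intro i hi
    rw [iteratedDeriv_gammaLC, if_pos (by omega), zero_pow (by omega)]
    simp
  refine ⟨fun i => key _ ?_, fun i hi => key _ hi⟩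
  have := i.2
  simp only [pairLC]
  omega

theorem sum_range_neg_one_pow_choose_div (p q : ℕ) :
    ∑ m ∈ range (p + 1), (-1 : ℂ) ^ m * (p.choose m) / (q + m + 1 : ℕ)
      = (p.factorial * q.factorial : ℕ) / ((p + q + 1).factorial : ℕ) := by
  induction p generalizing q with
  | zero =>
    simp [Nat.factorial_succ]
    have : (q.factorial : ℂ) ≠ 0 := by exact_mod_cast Nat.factorial_ne_zero _
    have h2 : (q + 1 : ℂ) ≠ 0 := by exact_mod_cast Nat.succ_ne_zero q
    field_simp
  | succ p ih =>
    have h : ∑ m ∈ range (p + 1 + 1), (-1 : ℂ) ^ m * ((p + 1).choose m) / (q + m + 1 : ℕ)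
        = ∑ m ∈ range (p + 1), (-1 : ℂ) ^ m * (p.choose m) / (q + m + 1 : ℕ)
          - ∑ m ∈ range (p + 1), (-1 : ℂ) ^ m * (p.choose m) / (q + 1 + m + 1 : ℕ) := by
      rw [sum_range_succ']
      have e : ∑ m ∈ range (p + 1), (-1 : ℂ) ^ m * (p.choose m) / (q + m + 1 : ℕ)
          = ∑ m ∈ range (p + 1), (-1 : ℂ) ^ (m + 1) * (p.choose (m + 1)) / (q + (m + 1) + 1 : ℕ)
            + 1 / (q + 1 : ℕ) := by
        rw [sum_range_succ', sum_range_succ _ p]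
        simp
      rw [e, add_sub_right_comm, ← sum_sub_distrib]
      simp only [pow_zero, Nat.choose_zero_right, Nat.cast_one, one_mul, add_zero]
      congr 1
      refine sum_congr rfl fun m _ => ?_
      rw [Nat.choose_succ_succ, show q + 1 + m + 1 = q + (m + 1) + 1 by ring]
      push_cast
      ring
    rw [h, ih, ih, show p + (q + 1) + 1 = p + q + 1 + 1 by ring,
      show p + 1 + q + 1 = p + q + 1 + 1 by ring, Nat.factorial_succ (p + q + 1),
      Nat.factorial_succ p, Nat.factorial_succ q]
    have h1 : ((p + q + 1).factorial : ℂ) ≠ 0 := by exact_mod_cast Nat.factorial_ne_zero _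
    have h2 : (p + q + 1 + 1 : ℂ) ≠ 0 := by exact_mod_cast Nat.succ_ne_zero (p + q + 1)
    push_cast
    field_simp
    ring

theorem oscLC_le_graphLC (n : ℕ) (s : ℂ) : oscLC n n s ≤ graphLC n s := by
  refine Submodule.span_le.2 ?_
  rintro _ ⟨j, rfl⟩
  intro i
  have hi := i.2
  have hj := j.2
  simp only [iteratedDeriv_gammaLC]
  set q : ℕ := (i.rev : ℕ) with hq
  set p : ℕ := ((j.rev : Fin n) : ℕ) with hp
  rw [Fin.val_rev] at hq hp
  rw [← Equiv.sum_comp Fin.revPerm]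
  simp only [Fin.revPerm_apply, symLC, weightLC, Fin.rev_rev]
  have hsum : ∀ f : ℕ → ℂ, (∀ m, p < m → f m = 0) →
      ∑ m : Fin n, f m = ∑ m ∈ range (p + 1), f m := by
    intro f hf
    rw [Fin.sum_univ_eq_sum_range]
    symm
    refine sum_subset (fun m hm => ?_) (fun m _ hm => hf m ?_)
    · simp only [mem_range] at hm ⊢; omega
    · simpa using hm
  have hpf : (p.factorial : ℂ) ≠ 0 := by exact_mod_cast Nat.factorial_ne_zero _
  have hqf : (q.factorial : ℂ) ≠ 0 := by exact_mod_cast Nat.factorial_ne_zero _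
  obtain ⟨f, hf⟩ : ∃ f : ℕ → ℂ, ∀ m, f m = (-1 : ℂ) ^ q / q.factorial * s ^ (p + q + 1) /
      p.factorial * ((-1 : ℂ) ^ m * (p.choose m) / (q + m + 1 : ℕ)) := ⟨_, fun _ => rfl⟩
  have hterm : ∀ m : Fin n,
      (-1 : ℂ) ^ (i.rev : ℕ) / (i.rev : ℕ).factorial * ((-1) ^ (m : ℕ) / (m : ℕ).factorial) *
          s ^ ((i.rev : ℕ) + m + 1) / ((i.rev : ℕ) + m + 1 : ℕ) *
        (if (j : ℕ) ≤ (inclLC n m.rev : ℕ) then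
          (-1) ^ ((inclLC n m.rev : ℕ) - n) * s ^ ((inclLC n m.rev : ℕ) - j) /
            ((inclLC n m.rev : ℕ) - j).factorial else 0)
      = f m := by
    intro m
    rw [hf]
    have hm := m.2
    have hv : (inclLC n m.rev : ℕ) = n - (m + 1) := by simp [inclLC, Fin.val_rev]
    rw [hv, show n - ((m : ℕ) + 1) - n = 0 by omega]
    have hiq : (i.rev : ℕ) = q := rfl
    rw [hiq]
    split_ifs with h
    · have hmp : (m : ℕ) ≤ p := by omega
      rw [show n - ((m : ℕ) + 1) - j = p - m by omega, pow_zero, one_mul,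
        Nat.cast_choose ℂ hmp, show p + q + 1 = (q + m + 1) + (p - m) by omega, pow_add]
      field_simp
      ring
    · rw [Nat.choose_eq_zero_of_lt (by omega)]
      simp
  symm
  refine (sum_congr rfl fun m _ => hterm m).trans ((hsum f fun m hm => ?_).trans ?_)
  · rw [hf, Nat.choose_eq_zero_of_lt hm]
    simp
  simp only [hf]
  rw [← mul_sum, sum_range_neg_one_pow_choose_div]
  have hv : (pairLC n i : ℕ) = n + q := by simp only [pairLC]; omega
  rw [hv, if_pos (by omega), show n + q - n = q by omega, show n + q - j = p + q + 1 by omega]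
  push_cast
  field_simp

theorem weightLC_ne_zero (n : ℕ) (i : Fin n) : weightLC n i ≠ 0 :=
  div_ne_zero (pow_ne_zero _ (by norm_num)) (by exact_mod_cast Nat.factorial_ne_zero _)

theorem conj_weightLC (n : ℕ) (i : Fin n) : (starRingEnd ℂ) (weightLC n i) = weightLC n i := by
  simp [weightLC]

theorem symLC_comm (n : ℕ) (s : ℂ) (i k : Fin n) : symLC n s i k = symLC n s k i := by
  simp only [symLC, add_comm (i.rev : ℕ) k.rev]
  ring

theorem conj_symLC (n : ℕ) (s : ℝ) (i k : Fin n) :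
    (starRingEnd ℂ) (symLC n s i k) = symLC n s i k := by
  simp [symLC, conj_weightLC]

theorem hasDerivAt_symLC (n : ℕ) (s : ℂ) (i k : Fin n) :
    HasDerivAt (fun s => symLC n s i k)
      (weightLC n i * weightLC n k * s ^ ((i.rev : ℕ) + k.rev)) s := by
  have h := ((hasDerivAt_pow ((i.rev : ℕ) + k.rev + 1) s).const_mul
    (weightLC n i * weightLC n k)).div_const (((i.rev : ℕ) + k.rev + 1 : ℕ) : ℂ)
  have h0 : (((i.rev : ℕ) + k.rev + 1 : ℕ) : ℂ) ≠ 0 :=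
    Nat.cast_ne_zero.2 (Nat.succ_ne_zero _)
  refine h.congr_deriv ?_
  rw [Nat.add_sub_cancel]
  field_simp

theorem eq_zero_of_infinite_sum_weightLC {n : ℕ} (x : Fin n → ℂ)
    (hx : {s : ℂ | ∑ k, weightLC n k * x k * s ^ (k.rev : ℕ) = 0}.Infinite) : x = 0 := by
  let P : Polynomial ℂ :=
    ∑ k : Fin n, Polynomial.C (weightLC n k * x k) * Polynomial.X ^ (k.rev : ℕ)
  have hP : P = 0 := by
    refine Polynomial.eq_zero_of_infinite_isRoot P (hx.mono fun s hs => ?_)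
    simpa [P, Polynomial.eval_finsetSum] using hs
  funext k
  have h : P.coeff (k.rev : ℕ) = weightLC n k * x k := by
    simp only [P, Polynomial.finsetSum_coeff, Polynomial.coeff_C_mul_X_pow]
    rw [sum_eq_single k (fun j _ hj => if_neg fun h => hj (Fin.rev_injective (Fin.ext h)).symm)
      (by simp), if_pos rfl]
  rw [hP, Polynomial.coeff_zero] at h
  exact (mul_eq_zero.1 h.symm).resolve_left (weightLC_ne_zero n k)

/-- The Hermitian forms of the matrices `symLC n t` strictly increase with `t`. -/
theorem strictMono_re_sum_symLC {n : ℕ} {x : Fin n → ℂ} (hx : x ≠ 0) :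
    StrictMono fun t : ℝ => (∑ i, (starRingEnd ℂ) (x i) * ∑ k, symLC n t i k * x k).re := by
  set f := fun t : ℝ => (∑ i, (starRingEnd ℂ) (x i) * ∑ k, symLC n t i k * x k).re with hf
  have hd : ∀ t : ℝ,
      HasDerivAt f (Complex.normSq (∑ k, weightLC n k * x k * (t : ℂ) ^ (k.rev : ℕ))) t := by
    intro t
    have h : HasDerivAt (fun t : ℂ => ∑ i, (starRingEnd ℂ) (x i) * ∑ k, symLC n t i k * x k)
        (∑ i, (starRingEnd ℂ) (x i) * ∑ k,
          weightLC n i * weightLC n k * (t : ℂ) ^ ((i.rev : ℕ) + k.rev) * x k) (t : ℂ) :=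
      HasDerivAt.fun_sum fun i _ => (HasDerivAt.fun_sum fun k _ =>
        (hasDerivAt_symLC n (t : ℂ) i k).mul_const (x k)).const_mul _
    have h2 := h.real_of_complex
    convert h2 using 1
    rw [← Complex.ofReal_re (Complex.normSq _), Complex.normSq_eq_conj_mul_self, map_sum, sum_mul]
    congr 1
    refine sum_congr rfl fun i _ => ?_
    rw [mul_sum, mul_sum]
    refine sum_congr rfl fun k _ => ?_
    simp only [map_mul, map_pow, conj_weightLC, Complex.conj_ofReal, pow_add]
    ring
  have hmono : Monotone f := monotone_of_deriv_nonneg (fun t => (hd t).differentiableAt)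
    fun t => by rw [(hd t).deriv]; exact Complex.normSq_nonneg _
  intro s t hst
  refine lt_of_le_of_ne (hmono hst.le) fun heq => hx ?_
  refine eq_zero_of_infinite_sum_weightLC x ?_
  refine ((Set.Ioo_infinite hst).image (Complex.ofReal_injective.injOn)).mono ?_
  rintro _ ⟨u, hu, rfl⟩
  have h0 : f =ᶠ[nhds u] fun _ => f s := by
    filter_upwards [Ioo_mem_nhds hu.1 hu.2] with v hv
    exact le_antisymm ((hmono hv.2.le).trans heq.ge) (hmono hv.1.le)
  have h1 := (hd u).unique ((hasDerivAt_const u (f s)).congr_of_eventuallyEq h0)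
  exact Complex.normSq_eq_zero.1 h1

/-- The sesquilinear form measuring how far `w` is from the graph of `symLC n s`. -/
noncomputable def hermLC (n : ℕ) (s : ℝ) (v w : Fin (2 * n) → ℂ) : ℂ :=
  ∑ i, (starRingEnd ℂ) (v (inclLC n i)) *
    (w (pairLC n i) - ∑ k, symLC n s i k * w (inclLC n k))

theorem hermLC_eq_zero {n : ℕ} {s : ℝ} (v : Fin (2 * n) → ℂ) {w : Fin (2 * n) → ℂ}
    (hw : w ∈ graphLC n s) : hermLC n s v w = 0 :=
  sum_eq_zero fun i _ => by rw [mem_graphLC.1 hw i, sub_self, mul_zero]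

theorem hermLC_add_right (n : ℕ) (s : ℝ) (v w w' : Fin (2 * n) → ℂ) :
    hermLC n s v (w + w') = hermLC n s v w + hermLC n s v w' := by
  simp only [hermLC, ← sum_add_distrib, Pi.add_apply, mul_add]
  refine sum_congr rfl fun i _ => ?_
  rw [sum_add_distrib]
  ring

theorem hermLC_add_left (n : ℕ) (s : ℝ) (v v' w : Fin (2 * n) → ℂ) :
    hermLC n s (v + v') w = hermLC n s v w + hermLC n s v' w := by
  simp only [hermLC, ← sum_add_distrib, ← add_mul, Pi.add_apply, map_add]

theorem conj_hermLC {n : ℕ} {H : Submodule ℂ (Fin (2 * n) → ℂ)} (hc : conjStableLC n H)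
    (hiso : ∀ x ∈ H, ∀ y ∈ H, formLC n x y = 0) (s : ℝ) {v w : Fin (2 * n) → ℂ}
    (hv : v ∈ H) (hw : w ∈ H) : (starRingEnd ℂ) (hermLC n s v w) = hermLC n s w v := by
  have h := hiso _ (hc w hw) _ hv
  simp only [formLC, sum_sub_distrib, sub_eq_zero] at h
  simp only [hermLC, mul_sub, sum_sub_distrib, map_sub, map_sum, map_mul, Complex.conj_conj,
    conj_symLC, mul_sum]
  congr 1
  · exact (sum_congr rfl fun i _ => mul_comm _ _).trans
      ((sum_congr rfl fun i _ => mul_comm _ _).trans h.symm)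
  · rw [sum_comm]
    refine sum_congr rfl fun i _ => sum_congr rfl fun k _ => ?_
    rw [symLC_comm n s k i]
    ring

theorem re_hermLC_sub (n : ℕ) (s : ℝ) (v : Fin (2 * n) → ℂ) :
    (hermLC n s v v).re = (∑ i, (starRingEnd ℂ) (v (inclLC n i)) * v (pairLC n i)).re -
      (∑ i, (starRingEnd ℂ) (v (inclLC n i)) * ∑ k, symLC n s i k * v (inclLC n k)).re := by
  simp only [hermLC, mul_sub, sum_sub_distrib, Complex.sub_re]

/-- A real isotropic subspace meets the Lagrangians `F_n(s)`, `s` real, in total dimension at most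
its own dimension. -/
theorem sum_finrank_inf_graphLC_le {n : ℕ} {H : Submodule ℂ (Fin (2 * n) → ℂ)}
    (hc : conjStableLC n H) (hiso : ∀ x ∈ H, ∀ y ∈ H, formLC n x y = 0) (S : Finset ℝ) :
    ∑ s ∈ S, finrank ℂ ↥(H ⊓ graphLC n s) ≤ finrank ℂ H := by
  suffices h : ∃ U ≤ H, (∀ t : ℝ, (∀ s ∈ S, s < t) → ∀ u ∈ U, u ≠ 0 → (hermLC n t u u).re < 0) ∧
      ∑ s ∈ S, finrank ℂ ↥(H ⊓ graphLC n s) = finrank ℂ U by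
    obtain ⟨U, hU, -, h⟩ := h
    exact h.le.trans (Submodule.finrank_mono hU)
  induction S using Finset.induction_on_max with
  | empty => exact ⟨⊥, bot_le, fun t _ u hu hu0 => absurd ((Submodule.mem_bot ℂ).1 hu) hu0, by simp⟩
  | insert s S hS ih =>
    obtain ⟨U, hU, hneg, hsum⟩ := ih
    have hinf : U ⊓ (H ⊓ graphLC n s) = ⊥ := by
      refine (Submodule.eq_bot_iff _).2 fun u hu => by_contra fun hu0 => ?_
      have h := hneg s hS u hu.1 hu0
      rw [hermLC_eq_zero u hu.2.2] at h
      exact lt_irrefl _ h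
    refine ⟨U ⊔ (H ⊓ graphLC n s), sup_le hU inf_le_left, fun t ht w hw hw0 => ?_, ?_⟩
    · obtain ⟨u, hu, k, hk, rfl⟩ := Submodule.mem_sup.1 hw
      have hst : s < t := ht s (mem_insert_self _ _)
      have e1 : hermLC n s (u + k) (u + k) = hermLC n s u u := by
        rw [hermLC_add_right, hermLC_eq_zero _ hk.2, add_zero, hermLC_add_left,
          ← conj_hermLC hc hiso s (hU hu) hk.1, hermLC_eq_zero _ hk.2, map_zero, add_zero]
      have hle : (hermLC n s u u).re ≤ 0 := by
        rcases eq_or_ne u 0 with rfl | hu0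
        · simp [hermLC]
        · exact (hneg s hS u hu hu0).le
      by_cases hx : (fun i => (u + k) (inclLC n i)) = 0
      · have hx' : ∀ i, (u + k) (inclLC n i) = 0 := fun i => congrFun hx i
        have e2 : ∀ r : ℝ, hermLC n r (u + k) (u + k) = 0 := fun r => by
          simp only [hermLC, hx', map_zero, zero_mul, sum_const_zero]
        have hu0 : u = 0 := by
          by_contra hu0
          have h := hneg s hS u hu hu0
          rw [← e1, e2] at h
          exact lt_irrefl _ h
        refine absurd (funext_inclLC_pairLC hx' fun j => ?_) hw0
        rw [hu0, zero_add] at hx' ⊢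
        rw [mem_graphLC.1 hk.2 j]
        simp [hx']
      · have h := strictMono_re_sum_symLC hx hst
        have e2 := re_hermLC_sub n s (u + k)
        have e3 := re_hermLC_sub n t (u + k)
        rw [e1] at e2
        linarith
    · have h := Submodule.finrank_sup_add_finrank_inf_eq U (H ⊓ graphLC n s)
      rw [hinf, finrank_bot, add_zero] at h
      rw [h, sum_insert fun h => lt_irrefl _ (hS s h), hsum, add_comm]

/-- The matrix whose kernel parametrizes the intersection of the column space of `N` with
`graphLC n s`. -/
noncomputable def meetLC {n : ℕ} (N : Matrix (Fin (2 * n)) (Fin n) ℂ) (s : ℂ) :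
    Matrix (Fin n) (Fin n) ℂ :=
  Matrix.of fun i j => N (pairLC n i) j - ∑ k, symLC n s i k * N (inclLC n k) j

theorem meetLC_mulVec {n : ℕ} (N : Matrix (Fin (2 * n)) (Fin n) ℂ) (s : ℂ) (c : Fin n → ℂ)
    (i : Fin n) : (meetLC N s).mulVec c i =
      N.mulVec c (pairLC n i) - ∑ k, symLC n s i k * N.mulVec c (inclLC n k) := by
  simp only [meetLC, Matrix.mulVec, dotProduct, Matrix.of_apply, sub_mul, sum_sub_distrib, sum_mul,
    mul_sum]
  rw [sum_comm]
  simp only [mul_assoc]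

theorem mulVec_mem_graphLC_iff {n : ℕ} {N : Matrix (Fin (2 * n)) (Fin n) ℂ} {s : ℂ}
    {c : Fin n → ℂ} : N.mulVec c ∈ graphLC n s ↔ (meetLC N s).mulVec c = 0 := by
  rw [mem_graphLC, funext_iff]
  simp only [meetLC_mulVec, Pi.zero_apply, sub_eq_zero]

theorem inf_graphLC_ne_bot_iff {n : ℕ} {N : Matrix (Fin (2 * n)) (Fin n) ℂ}
    (hN : Function.Injective N.mulVec) (s : ℂ) :
    LinearMap.range N.mulVecLin ⊓ graphLC n s ≠ ⊥ ↔ (meetLC N s).det = 0 := by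
  rw [← Matrix.exists_mulVec_eq_zero_iff, Submodule.ne_bot_iff]
  constructor
  · rintro ⟨_, ⟨⟨c, rfl⟩, hv⟩, hv0⟩
    exact ⟨c, fun h => hv0 (by simp [h]), mulVec_mem_graphLC_iff.1 hv⟩
  · rintro ⟨c, hc, h⟩
    refine ⟨N.mulVec c, ⟨⟨c, rfl⟩, mulVec_mem_graphLC_iff.2 h⟩, fun h0 => hc ?_⟩
    exact hN (h0.trans (Matrix.mulVec_zero N).symm)

/-- The entries of `symLC` as polynomials in the parameter. -/
noncomputable def symPolyLC (n : ℕ) (i k : Fin n) : Polynomial ℂ :=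
  Polynomial.C (weightLC n i * weightLC n k / ((i.rev : ℕ) + k.rev + 1 : ℕ)) *
    Polynomial.X ^ ((i.rev : ℕ) + k.rev + 1)

theorem eval_symPolyLC (n : ℕ) (i k : Fin n) (s : ℂ) :
    (symPolyLC n i k).eval s = symLC n s i k := by
  simp only [symPolyLC, symLC, Polynomial.eval_mul, Polynomial.eval_C, Polynomial.eval_pow,
    Polynomial.eval_X]
  ring

theorem derivative_symPolyLC (n : ℕ) (i k : Fin n) :
    Polynomial.derivative (symPolyLC n i k) =
      Polynomial.C (weightLC n i) * Polynomial.X ^ (i.rev : ℕ) *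
        (Polynomial.C (weightLC n k) * Polynomial.X ^ (k.rev : ℕ)) := by
  have h0 : (((i.rev : ℕ) + k.rev + 1 : ℕ) : ℂ) ≠ 0 := Nat.cast_ne_zero.2 (Nat.succ_ne_zero _)
  rw [symPolyLC, Polynomial.derivative_C_mul_X_pow, div_mul_cancel₀ _ h0, Nat.add_sub_cancel,
    Polynomial.C_mul, pow_add]
  ring

/-- Polynomial families of vectors in an isotropic subspace that lie in `graphLC n s` for each `s`
are closed under differentiation. -/
theorem derivative_mem_graphLC {n : ℕ} {N : Matrix (Fin (2 * n)) (Fin n) ℂ}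
    (hiso : ∀ x ∈ LinearMap.range N.mulVecLin, ∀ y ∈ LinearMap.range N.mulVecLin,
      formLC n x y = 0) {c : Fin n → Polynomial ℂ}
    (hc : ∀ s : ℂ, N.mulVec (fun j => (c j).eval s) ∈ graphLC n s) (s : ℂ) :
    N.mulVec (fun j => (Polynomial.derivative (c j)).eval s) ∈ graphLC n s := by
  let v : (Fin n → Polynomial ℂ) → Fin (2 * n) → Polynomial ℂ :=
    fun c i => ∑ j, Polynomial.C (N i j) * c j
  have hv : ∀ c i (s : ℂ), (v c i).eval s = N.mulVec (fun j => (c j).eval s) i := by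
    intro c i s
    simp [v, Polynomial.eval_finsetSum, Matrix.mulVec, dotProduct]
  let c' : Fin n → Polynomial ℂ := fun j => Polynomial.derivative (c j)
  have hv' : ∀ i, Polynomial.derivative (v c i) = v c' i := by
    intro i
    simp [v, c']
  have hy : ∀ i, v c (pairLC n i) = ∑ k, symPolyLC n i k * v c (inclLC n k) := by
    intro i
    refine Polynomial.funext fun t => ?_
    simp only [Polynomial.eval_finsetSum, Polynomial.eval_mul, eval_symPolyLC, hv]
    exact mem_graphLC.1 (hc t) i
  have hform : ∑ i, v c' (inclLC n i) * v c (pairLC n i)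
      = ∑ i, v c (inclLC n i) * v c' (pairLC n i) := by
    rw [← sub_eq_zero, ← sum_sub_distrib]
    refine Polynomial.funext fun t => ?_
    simp only [Polynomial.eval_finsetSum, Polynomial.eval_mul, Polynomial.eval_sub, hv,
      Polynomial.eval_zero]
    exact hiso _ ⟨_, rfl⟩ _ ⟨_, rfl⟩
  set L := ∑ k : Fin n,
    Polynomial.C (weightLC n k) * Polynomial.X ^ (k.rev : ℕ) * v c (inclLC n k) with hL
  have hy' : ∀ i, v c' (pairLC n i) = Polynomial.C (weightLC n i) * Polynomial.X ^ (i.rev : ℕ) * L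
      + ∑ k, symPolyLC n i k * v c' (inclLC n k) := by
    intro i
    rw [← hv', hy, Polynomial.derivative_sum, hL, mul_sum, ← sum_add_distrib]
    refine sum_congr rfl fun k _ => ?_
    rw [Polynomial.derivative_mul, derivative_symPolyLC, hv']
    ring
  have hL0 : L = 0 := by
    have h1 : ∑ i, v c' (inclLC n i) * v c (pairLC n i) =
        ∑ i, v c (inclLC n i) * ∑ k, symPolyLC n i k * v c' (inclLC n k) := by
      simp only [hy, mul_sum]
      rw [sum_comm]
      refine sum_congr rfl fun i _ => sum_congr rfl fun k _ => ?_
      have : symPolyLC n k i = symPolyLC n i k := by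
        simp only [symPolyLC, add_comm (k.rev : ℕ) i.rev, mul_comm (weightLC n k)]
      rw [this]
      ring
    have h2 : ∑ i, v c (inclLC n i) * v c' (pairLC n i) =
        L * L + ∑ i, v c (inclLC n i) * ∑ k, symPolyLC n i k * v c' (inclLC n k) := by
      conv_rhs => rw [hL]
      rw [← hL, sum_mul, ← sum_add_distrib]
      refine sum_congr rfl fun i _ => ?_
      rw [hy']
      ring
    rw [h1, h2] at hform
    exact mul_self_eq_zero.1 (by simpa using hform)
  rw [mem_graphLC]
  intro i
  have h := congrArg (Polynomial.eval s) (hy' i)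
  simpa only [hL0, mul_zero, zero_add, Polynomial.eval_finsetSum, Polynomial.eval_mul,
    eval_symPolyLC, hv] using h

theorem eq_zero_of_forall_mem_graphLC {n : ℕ} {v : Fin (2 * n) → ℂ}
    (hv : ∀ s : ℂ, v ∈ graphLC n s) : v = 0 := by
  have hy : ∀ i, v (pairLC n i) = 0 := fun i => by
    rw [mem_graphLC.1 (hv 0) i]
    simp [symLC]
  have hx : (fun i => v (inclLC n i)) = 0 := by
    by_contra hx
    have h := strictMono_re_sum_symLC hx zero_lt_one
    simp only [← mem_graphLC.1 (hv _), hy] at h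
    exact lt_irrefl _ h
  exact funext_inclLC_pairLC (congrFun hx) hy

/-- An isotropic subspace meets only finitely many of the Lagrangians `F_n(s)`. -/
theorem finite_setOf_inf_graphLC_ne_bot {n : ℕ} {N : Matrix (Fin (2 * n)) (Fin n) ℂ}
    (hN : Function.Injective N.mulVec)
    (hiso : ∀ x ∈ LinearMap.range N.mulVecLin, ∀ y ∈ LinearMap.range N.mulVecLin,
      formLC n x y = 0) :
    {s : ℂ | LinearMap.range N.mulVecLin ⊓ graphLC n s ≠ ⊥}.Finite := by
  have hconst : ∀ (d : ℕ) (c : Fin n → Polynomial ℂ), c ≠ 0 → (∀ j, (c j).natDegree ≤ d) →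
      ¬ ∀ s : ℂ, N.mulVec (fun j => (c j).eval s) ∈ graphLC n s := by
    intro d
    induction d with
    | zero =>
      intro c hc0 hd hc
      have hcon : ∀ j, c j = Polynomial.C ((c j).coeff 0) := fun j =>
        Polynomial.eq_C_of_natDegree_le_zero (hd j)
      have h0 : N.mulVec (fun j => (c j).coeff 0) = 0 := by
        refine eq_zero_of_forall_mem_graphLC fun s => ?_
        convert hc s using 3 with j
        rw [hcon j]
        simp
      have h1 : (fun j => (c j).coeff 0) = 0 := hN (h0.trans (Matrix.mulVec_zero N).symm)
      refine hc0 (funext fun j => ?_)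
      rw [hcon j, congrFun h1 j]
      simp
    | succ d ih =>
      intro c hc0 hd hc
      by_cases h : (fun j => Polynomial.derivative (c j)) = 0
      · refine ih c hc0 (fun j => ?_) hc
        rw [Polynomial.derivative_eq_zero.1 (congrFun h j)]
        exact Nat.zero_le d
      · refine ih _ h (fun j => ?_) (derivative_mem_graphLC hiso hc)
        have h1 := Polynomial.natDegree_derivative_le (c j)
        have h2 := hd j
        omega
  by_contra hinf
  let P : Matrix (Fin n) (Fin n) (Polynomial ℂ) := Matrix.of fun i j =>
    Polynomial.C (N (pairLC n i) j) - ∑ k, symPolyLC n i k * Polynomial.C (N (inclLC n k) j)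
  have hP : ∀ s : ℂ, P.map (Polynomial.eval s) = meetLC N s := by
    intro s
    ext i j
    simp [P, meetLC, Polynomial.eval_finsetSum, eval_symPolyLC]
  have hdet : P.det = 0 := by
    refine Polynomial.eq_zero_of_infinite_isRoot _ (Set.Infinite.mono (fun s hs => ?_) hinf)
    have h := (inf_graphLC_ne_bot_iff hN s).1 hs
    rw [← hP] at h
    have h2 := RingHom.map_det (Polynomial.evalRingHom s) P
    exact h2.trans h
  obtain ⟨c, hc0, hc⟩ := Matrix.exists_mulVec_eq_zero_iff.2 hdet
  refine hconst (univ.sup fun j => (c j).natDegree) c hc0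
    (fun j => le_sup (f := fun j => (c j).natDegree) (mem_univ j)) fun s => ?_
  rw [mulVec_mem_graphLC_iff, ← hP]
  funext i
  have h := congrArg (Polynomial.eval s) (congrFun hc i)
  simpa [Matrix.mulVec, dotProduct, Polynomial.eval_finsetSum] using h

/-- The matrix that forgets the first `min a n` coordinates. -/
def forgetLC (n a : ℕ) : Matrix (Fin (2 * n)) (Fin (2 * n)) ℂ :=
  Matrix.diagonal fun i => if (i : ℕ) < a ∧ (i : ℕ) < n then 0 else 1

theorem ker_forgetLC (n a : ℕ) : LinearMap.ker (forgetLC n a).mulVecLin = truncLC n a := by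
  ext v
  have h1 : ∀ i, (forgetLC n a).mulVec v i =
      if (i : ℕ) < a ∧ (i : ℕ) < n then 0 else v i := by
    intro i
    rw [forgetLC, Matrix.mulVec_diagonal]
    split_ifs <;> simp
  rw [LinearMap.mem_ker, Matrix.mulVecLin_apply, mem_truncLC]
  constructor
  · intro h
    refine ⟨fun j => ?_, fun j hj => ?_⟩
    · have h2 := congrFun h (pairLC n j)
      rw [h1, if_neg] at h2
      · exact h2
      · simp only [pairLC]; omega
    · have h2 := congrFun h (inclLC n j)
      rw [h1, if_neg] at h2
      · exact h2
      · simp only [inclLC]; omega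
  · rintro ⟨hp, hi⟩
    refine funext_inclLC_pairLC (fun j => ?_) (fun j => ?_)
    · rw [h1]
      split_ifs with h
      · rfl
      · exact hi j (by have := j.2; simp only [inclLC] at h; omega)
    · rw [h1, hp j]
      simp

theorem rank_forgetLC_mul_add {n a : ℕ} {N : Matrix (Fin (2 * n)) (Fin n) ℂ}
    (hN : Function.Injective N.mulVec) :
    (forgetLC n a * N).rank + finrank ℂ ↥(LinearMap.range N.mulVecLin ⊓ truncLC n a) = n := by
  have h := LinearMap.finrank_range_add_finrank_ker (forgetLC n a * N).mulVecLin
  rw [Matrix.mulVecLin_mul, LinearMap.ker_comp, ker_forgetLC, Module.finrank_fin_fun] at h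
  rw [← Submodule.map_comap_eq, Matrix.rank, Matrix.mulVecLin_mul,
    ← (Submodule.equivMapOfInjective N.mulVecLin hN _).finrank_eq]
  exact h

theorem isClosed_setOf_rank_le {m p : Type*} [Fintype m] [Fintype p] (r : ℕ) :
    IsClosed {N : Matrix m p ℂ | N.rank ≤ r} := by
  classical
  have hcont : Continuous fun N : Matrix m p ℂ => N.mulVecLin.toContinuousLinearMap :=
    LinearMap.continuous_of_finiteDimensional
      ((LinearMap.toContinuousLinearMap : ((p → ℂ) →ₗ[ℂ] m → ℂ) ≃ₗ[ℂ] _).toLinearMap ∘ₗ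
        (Matrix.toLin' : Matrix m p ℂ ≃ₗ[ℂ] _).toLinearMap)
  have h := (isOpen_setOfPred_nat_le_rank (𝕜 := ℂ) (E := p → ℂ) (F := m → ℂ) (r + 1)).preimage hcont
  rw [← isOpen_compl_iff]
  convert h using 1
  ext N
  simp only [Set.mem_compl_iff, Set.mem_ofPred_eq, not_le, Set.mem_preimage, Matrix.rank,
    LinearMap.coe_toContinuousLinearMap, LinearMap.rank, ← Module.finrank_eq_rank,
    Nat.cast_le, Nat.succ_le_iff]
  exact Iff.rfl

theorem mulVec_injective_of_conjTranspose_mul_self {m p : Type*} [Fintype m] [Fintype p]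
    [DecidableEq p] {N : Matrix m p ℂ} (hN : N.conjTranspose * N = 1) :
    Function.Injective N.mulVec := by
  intro v w h
  have h2 := congrArg N.conjTranspose.mulVec h
  simpa [Matrix.mulVec_mulVec, hN] using h2

theorem isCompact_setOf_conjTranspose_mul_self {m p : Type*} [Fintype m] [Fintype p]
    [DecidableEq p] : IsCompact {N : Matrix m p ℂ | N.conjTranspose * N = 1} := by
  have hc : IsCompact (Set.univ.pi fun _ : m => Set.univ.pi fun _ : p =>
      Metric.closedBall (0 : ℂ) 1) :=
    isCompact_univ_pi fun _ => isCompact_univ_pi fun _ => isCompact_closedBall 0 1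
  refine hc.of_isClosed_subset (isClosed_eq ?_ continuous_const)
    fun (N : Matrix m p ℂ) (hN : N.conjTranspose * N = 1) i _ j _ => ?_
  · exact (Continuous.matrix_conjTranspose continuous_id).matrix_mul continuous_id
  · have h := congrFun (congrFun hN j) j
    rw [Matrix.one_apply_eq, Matrix.mul_apply] at h
    have h2 : ∑ i, ‖N i j‖ ^ 2 = 1 := by
      have h3 := congrArg Complex.re h
      simpa [Matrix.conjTranspose_apply, ← Complex.normSq_eq_conj_mul_self,
        Complex.normSq_eq_norm_sq, ← Complex.ofReal_pow] using h3
    have h4 := single_le_sum (f := fun i => ‖N i j‖ ^ 2) (fun i _ => sq_nonneg _) (mem_univ i)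
    rw [mem_closedBall_zero_iff]
    nlinarith [norm_nonneg (N i j)]

theorem exists_orthonormal_frame {m : Type*} [Fintype m] {r : ℕ} (H : Submodule ℂ (m → ℂ))
    (hH : finrank ℂ H = r) :
    ∃ N : Matrix m (Fin r) ℂ, N.conjTranspose * N = 1 ∧ LinearMap.range N.mulVecLin = H := by
  classical
  let e := WithLp.linearEquiv 2 ℂ (m → ℂ)
  let H' : Submodule ℂ (EuclideanSpace ℂ m) := H.comap e.toLinearMap
  have hf : finrank ℂ H' = r := by
    have h : H' = H.map e.symm.toLinearMap := Submodule.comap_equiv_eq_map_symm e H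
    rw [h, ← hH]
    exact LinearEquiv.finrank_map_eq e.symm H
  let b := (stdOrthonormalBasis ℂ H').reindex (finCongr hf)
  let N : Matrix m (Fin r) ℂ := Matrix.of fun i j => (b j : EuclideanSpace ℂ m) i
  have hN : N.conjTranspose * N = 1 := by
    ext j k
    have h := orthonormal_iff_ite.1 b.orthonormal j k
    rw [Submodule.coe_inner, PiLp.inner_apply] at h
    rw [Matrix.mul_apply, Matrix.one_apply, ← h]
    refine sum_congr rfl fun i _ => ?_
    simp [N, mul_comm]
  refine ⟨N, hN, Submodule.eq_of_le_of_finrank_eq ?_ ?_⟩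
  · rw [Matrix.range_mulVecLin]
    refine Submodule.span_le.2 ?_
    rintro _ ⟨j, rfl⟩
    exact (b j).2
  · rw [hH, LinearMap.finrank_range_of_inj (mulVec_injective_of_conjTranspose_mul_self hN),
      Module.finrank_fin_fun]

theorem truncLC_mono (n : ℕ) : Monotone (truncLC n) :=
  fun _ _ h _ hv => ⟨hv.1, fun i hi => hv.2 i (h.trans hi)⟩

theorem truncLC_zero (n : ℕ) : truncLC n 0 = ⊥ :=
  (Submodule.eq_bot_iff _).2 fun _ hv =>
    funext_inclLC_pairLC (fun j => hv.2 j (Nat.zero_le _)) hv.1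

theorem mem_truncLC_of_succ {n k : ℕ} (hk : k < n) {v : Fin (2 * n) → ℂ}
    (hv : v ∈ truncLC n (k + 1)) (h : v (inclLC n ⟨k, hk⟩) = 0) : v ∈ truncLC n k := by
  refine ⟨hv.1, fun i hi => ?_⟩
  rcases hi.eq_or_lt with h' | h'
  · have : i = ⟨k, hk⟩ := Fin.ext h'.symm
    rw [this, h]
  · exact hv.2 i h'

theorem finrank_inf_truncLC_mono {n : ℕ} (H : Submodule ℂ (Fin (2 * n) → ℂ)) :
    Monotone fun a => finrank ℂ ↥(H ⊓ truncLC n a) :=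
  fun _ _ h => Submodule.finrank_mono (inf_le_inf_left H (truncLC_mono n h))

theorem finrank_inf_truncLC_succ_le {n k : ℕ} (hk : k < n) (H : Submodule ℂ (Fin (2 * n) → ℂ)) :
    finrank ℂ ↥(H ⊓ truncLC n (k + 1)) ≤ finrank ℂ ↥(H ⊓ truncLC n k) + 1 := by
  let f : ↥(H ⊓ truncLC n (k + 1)) →ₗ[ℂ] ℂ :=
    LinearMap.proj (inclLC n ⟨k, hk⟩) ∘ₗ Submodule.subtype _
  have h1 := LinearMap.finrank_range_add_finrank_ker f
  have h2 : finrank ℂ (LinearMap.range f) ≤ 1 :=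
    (Submodule.finrank_le _).trans (finrank_self ℂ).le
  have h3 : finrank ℂ (LinearMap.ker f) ≤ finrank ℂ ↥(H ⊓ truncLC n k) := by
    rw [(Submodule.equivMapOfInjective _ (Submodule.subtype_injective _) _).finrank_eq]
    refine Submodule.finrank_mono ?_
    rintro _ ⟨v, hv, rfl⟩
    exact ⟨v.2.1, mem_truncLC_of_succ hk v.2.2 hv⟩
  omega

theorem finrank_inf_truncLC_le {n : ℕ} (H : Submodule ℂ (Fin (2 * n) → ℂ)) {a : ℕ} (ha : a ≤ n) :
    finrank ℂ ↥(H ⊓ truncLC n a) ≤ a := by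
  induction a with
  | zero => simp [truncLC_zero]
  | succ k ih =>
    have := finrank_inf_truncLC_succ_le ha H
    have := ih (Nat.le_of_succ_le ha)
    omega

theorem exists_apply_inclLC_ne_zero {n k : ℕ} (hk : k < n) {H : Submodule ℂ (Fin (2 * n) → ℂ)}
    (h : finrank ℂ ↥(H ⊓ truncLC n k) < finrank ℂ ↥(H ⊓ truncLC n (k + 1))) :
    ∃ g ∈ H ⊓ truncLC n (k + 1), g (inclLC n ⟨k, hk⟩) ≠ 0 := by
  by_contra! hg
  exact h.not_ge (Submodule.finrank_mono fun g h' =>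
    ⟨h'.1, mem_truncLC_of_succ hk h'.2 (hg g h')⟩)

theorem apply_inclLC_eq_zero {n k : ℕ} (hk : k < n) {H : Submodule ℂ (Fin (2 * n) → ℂ)}
    (h : ¬ finrank ℂ ↥(H ⊓ truncLC n k) < finrank ℂ ↥(H ⊓ truncLC n (k + 1)))
    {g : Fin (2 * n) → ℂ} (hg : g ∈ H ⊓ truncLC n (k + 1)) : g (inclLC n ⟨k, hk⟩) = 0 := by
  have h1 : H ⊓ truncLC n k = H ⊓ truncLC n (k + 1) :=
    Submodule.eq_of_le_of_finrank_le (inf_le_inf_left H (truncLC_mono n k.le_succ)) (not_lt.1 h)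
  rw [← h1] at hg
  exact hg.2.2 _ le_rfl

/-- The coordinates that parametrize the Lagrangian subspaces `H` with
`finrank ℂ (H ⊓ truncLC n a) = d a` for all `a ≤ n`. -/
def pivotLC (n : ℕ) (d : ℕ → ℕ) (k : Fin n) : Fin (2 * n) :=
  if d k < d (k + 1) then inclLC n k else pairLC n k

theorem eq_zero_of_apply_pivotLC {n : ℕ} {d : ℕ → ℕ} {H : Submodule ℂ (Fin (2 * n) → ℂ)}
    (hiso : ∀ x ∈ H, ∀ y ∈ H, formLC n x y = 0)
    (hd : ∀ a ≤ n, finrank ℂ ↥(H ⊓ truncLC n a) = d a) {v : Fin (2 * n) → ℂ} (hv : v ∈ H)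
    (h0 : ∀ k, v (pivotLC n d k) = 0) : v = 0 := by
  have h1 : ∀ k (hk : k < n), v (pairLC n ⟨k, hk⟩) = 0 := by
    intro k
    induction k using Nat.strong_induction_on with
    | _ k ih =>
      intro hk
      by_cases hp : d k < d (k + 1)
      · rw [← hd k hk.le, ← hd (k + 1) hk] at hp
        obtain ⟨g, hg, hgk⟩ := exists_apply_inclLC_ne_zero hk hp
        have h2 := hiso g hg.1 v hv
        rw [formLC, sum_eq_single ⟨k, hk⟩ _ (fun h => absurd (mem_univ _) h), hg.2.1, mul_zero,
          sub_zero] at h2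
        · exact (mul_eq_zero.1 h2).resolve_left hgk
        · intro i _ hik
          rw [hg.2.1, mul_zero, sub_zero]
          rcases lt_or_gt_of_ne (fun h => hik (Fin.ext h) : (i : ℕ) ≠ k) with h | h
          · rw [ih i h i.2, mul_zero]
          · rw [hg.2.2 i h, zero_mul]
      · have := h0 ⟨k, hk⟩
        rwa [pivotLC, if_neg hp] at this
  have h2 : ∀ j ≤ n, v ∈ truncLC n (n - j) := by
    intro j
    induction j with
    | zero => exact fun _ => ⟨fun i => h1 i i.2, fun i hi => absurd i.2 (not_lt.2 hi)⟩
    | succ j ih =>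
      intro hj
      have hk : n - (j + 1) < n := by omega
      have h3 := ih (by omega)
      rw [show n - j = n - (j + 1) + 1 by omega] at h3
      refine mem_truncLC_of_succ hk h3 ?_
      by_cases hp : d (n - (j + 1)) < d (n - (j + 1) + 1)
      · have := h0 ⟨_, hk⟩
        rwa [pivotLC, if_pos hp] at this
      · rw [← hd _ hk.le, ← hd _ hk] at hp
        exact apply_inclLC_eq_zero hk hp ⟨hv, h3⟩
  have h3 := h2 n le_rfl
  rwa [Nat.sub_self, truncLC_zero, Submodule.mem_bot] at h3

theorem card_filter_range_lt_succ {n : ℕ} {d : ℕ → ℕ} (h0 : d 0 = 0)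
    (h1 : ∀ k < n, d k ≤ d (k + 1)) (h2 : ∀ k < n, d (k + 1) ≤ d k + 1) {a : ℕ} (ha : a ≤ n) :
    #{k ∈ range a | d k < d (k + 1)} = d a := by
  induction a with
  | zero => simp [h0]
  | succ a ih =>
    have := ih (by omega)
    have := h1 a ha
    have := h2 a ha
    rw [range_add_one, filter_insert]
    split_ifs
    · rw [card_insert_of_notMem (by simp)]
      omega
    · omega

theorem exists_apply_pivotLC_eq_single {n : ℕ} {d : ℕ → ℕ} {H : Submodule ℂ (Fin (2 * n) → ℂ)}
    (hiso : ∀ x ∈ H, ∀ y ∈ H, formLC n x y = 0)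
    (hd : ∀ a ≤ n, finrank ℂ ↥(H ⊓ truncLC n a) = d a)
    (hcard : ∀ a ≤ n, #{k ∈ range a | d k < d (k + 1)} = d a)
    {k : Fin n} (hk : d k < d (k + 1)) :
    ∃ h ∈ H ⊓ truncLC n (k + 1), ∀ j, h (pivotLC n d j) = (Pi.single k 1 : Fin n → ℂ) j := by
  let T : Finset ℕ := {j ∈ range (k + 1) | d j < d (j + 1)}
  have hT : ∀ j : T, (j : ℕ) < n := fun j =>
    (mem_range.1 (mem_filter.1 j.2).1).trans_le k.2
  let φ : ↥(H ⊓ truncLC n (k + 1)) →ₗ[ℂ] T → ℂ :=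
    LinearMap.pi fun j => LinearMap.proj (inclLC n ⟨j, hT j⟩) ∘ₗ Submodule.subtype _
  have hφ : Function.Injective φ := by
    rw [← LinearMap.ker_eq_bot, LinearMap.ker_eq_bot']
    intro v hv
    refine Subtype.ext (eq_zero_of_apply_pivotLC hiso hd v.2.1 fun j => ?_)
    rw [pivotLC]
    split_ifs with hj
    · rcases lt_or_ge (j : ℕ) (k + 1) with h | h
      · exact congrFun hv ⟨j, mem_filter.2 ⟨mem_range.2 h, hj⟩⟩
      · exact v.2.2.2 j h
    · exact v.2.2.1 j
  have hfin : finrank ℂ ↥(H ⊓ truncLC n (k + 1)) = finrank ℂ (T → ℂ) := by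
    rw [Module.finrank_fintype_fun_eq_card, Fintype.card_coe, hd _ k.2, hcard _ k.2]
  have hkT : (k : ℕ) ∈ T := mem_filter.2 ⟨mem_range.2 (Nat.lt_succ_self _), hk⟩
  obtain ⟨h, hh⟩ := (LinearMap.injective_iff_surjective_of_finrank_eq_finrank hfin).1 hφ
    (Pi.single ⟨k, hkT⟩ 1)
  refine ⟨h, h.2, fun j => ?_⟩
  by_cases hj : d j < d (j + 1)
  · rw [pivotLC, if_pos hj]
    rcases lt_or_ge (j : ℕ) (k + 1) with hlt | hge
    · have h1 := congrFun hh ⟨j, mem_filter.2 ⟨mem_range.2 hlt, hj⟩⟩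
      refine h1.trans ?_
      simp only [Pi.single_apply, Subtype.mk.injEq, Fin.ext_iff]
    · rw [h.2.2.2 j hge, Pi.single_eq_of_ne]
      rintro rfl
      omega
  · rw [pivotLC, if_neg hj, h.2.2.1, Pi.single_eq_of_ne]
    rintro rfl
    exact hj hk

/-- The Lagrangian subspaces that meet `graphLC n s` for all `s ∈ S`. -/
def incidentLC (n : ℕ) (S : Set ℂ) : Set (Submodule ℂ (Fin (2 * n) → ℂ)) :=
  {H | finrank ℂ H = n ∧ (∀ x ∈ H, ∀ y ∈ H, formLC n x y = 0) ∧ ∀ s ∈ S, H ⊓ graphLC n s ≠ ⊥}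

theorem mem_incidentLC {n : ℕ} {S : Set ℂ} {H : Submodule ℂ (Fin (2 * n) → ℂ)} :
    H ∈ incidentLC n S ↔ finrank ℂ H = n ∧ (∀ x ∈ H, ∀ y ∈ H, formLC n x y = 0) ∧
      ∀ s ∈ S, H ⊓ graphLC n s ≠ ⊥ := Iff.rfl

theorem range_mulVecLin_mem_incidentLC {n : ℕ} {S : Set ℂ} {N : Matrix (Fin (2 * n)) (Fin n) ℂ}
    (hN : Function.Injective N.mulVec) : LinearMap.range N.mulVecLin ∈ incidentLC n S ↔
      (∀ c c', formLC n (N.mulVec c) (N.mulVec c') = 0) ∧ ∀ s ∈ S, (meetLC N s).det = 0 := by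
  rw [mem_incidentLC, LinearMap.finrank_range_of_inj hN, Module.finrank_fin_fun]
  simp only [inf_graphLC_ne_bot_iff hN, true_and, LinearMap.mem_range, Matrix.mulVecLin_apply,
    forall_exists_index, forall_apply_eq_imp_iff]

/-- The matrices in reduced form with pivots `pivotLC n d` whose column spaces lie in
`incidentLC n S`. -/
def reducedLC (n : ℕ) (d : ℕ → ℕ) (S : Set ℂ) : Set (Matrix (Fin (2 * n)) (Fin n) ℂ) :=
  {M | M.submatrix (pivotLC n d) id = 1 ∧ (∀ c c', formLC n (M.mulVec c) (M.mulVec c') = 0) ∧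
    (∀ s ∈ S, (meetLC M s).det = 0) ∧
    ∀ k : Fin n, d k < d (k + 1) → (fun i => M i k) ∈ truncLC n (k + 1)}

theorem col_mem_range_mulVecLin {m p : Type*} [Fintype p] (M : Matrix m p ℂ) (j : p) :
    (fun i => M i j) ∈ LinearMap.range M.mulVecLin := by
  classical
  exact ⟨Pi.single j 1, by simp [Matrix.col]; rfl⟩

theorem mulVec_injective_of_submatrix_eq_one {m p : Type*} [Fintype p] [DecidableEq p]
    {M : Matrix m p ℂ} {e : p → m} (hM : M.submatrix e id = 1) :
    Function.Injective M.mulVec := by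
  intro v w h
  have h1 : ∀ c j, M.mulVec c (e j) = c j := fun c j => by
    have := congrFun (congrArg (fun A => A.mulVec c) hM) j
    rwa [Matrix.one_mulVec] at this
  funext j
  rw [← h1 v, ← h1 w, h]

theorem range_mulVecLin_of_mem_reducedLC {n : ℕ} {d : ℕ → ℕ} {S : Set ℂ}
    (hcard : ∀ a ≤ n, #{k ∈ range a | d k < d (k + 1)} = d a)
    {M : Matrix (Fin (2 * n)) (Fin n) ℂ} (hM : M ∈ reducedLC n d S) :
    LinearMap.range M.mulVecLin ∈ incidentLC n S ∧
      ∀ a ≤ n, d a ≤ finrank ℂ ↥(LinearMap.range M.mulVecLin ⊓ truncLC n a) := by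
  have hinj := mulVec_injective_of_submatrix_eq_one hM.1
  refine ⟨(range_mulVecLin_mem_incidentLC hinj).2 ⟨hM.2.1, hM.2.2.1⟩, fun a ha => ?_⟩
  let T : Finset ℕ := {j ∈ range a | d j < d (j + 1)}
  have hT : ∀ j : T, (j : ℕ) < a := fun j => mem_range.1 (mem_filter.1 j.2).1
  let f : T → Fin n := fun j => ⟨j, (hT j).trans_le ha⟩
  let g : T → ↥(LinearMap.range M.mulVecLin ⊓ truncLC n a) := fun j =>
    ⟨fun i => M i (f j), col_mem_range_mulVecLin M (f j),
      truncLC_mono n (hT j) (hM.2.2.2 (f j) (mem_filter.1 j.2).2)⟩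
  have hf : Function.Injective f := fun j j' h => Subtype.ext (Fin.ext_iff.1 h)
  have hg : LinearIndependent ℂ g :=
    LinearIndependent.of_comp (Submodule.subtype _) ((Matrix.mulVec_injective_iff.1 hinj).comp f hf)
  have := hg.fintype_card_le_finrank
  rwa [Fintype.card_coe, hcard a ha] at this

theorem det_submatrix_pivotLC_ne_zero {n : ℕ} {d : ℕ → ℕ} {N : Matrix (Fin (2 * n)) (Fin n) ℂ}
    (hN : Function.Injective N.mulVec)
    (hiso : ∀ x ∈ LinearMap.range N.mulVecLin, ∀ y ∈ LinearMap.range N.mulVecLin,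
      formLC n x y = 0)
    (hd : ∀ a ≤ n, finrank ℂ ↥(LinearMap.range N.mulVecLin ⊓ truncLC n a) = d a) :
    (N.submatrix (pivotLC n d) id).det ≠ 0 := by
  intro h
  obtain ⟨c, hc, h0⟩ := Matrix.exists_mulVec_eq_zero_iff.2 h
  refine hc (hN ((eq_zero_of_apply_pivotLC hiso hd ⟨c, rfl⟩ fun k => ?_).trans
    (Matrix.mulVec_zero N).symm))
  exact congrFun h0 k

theorem range_mulVecLin_mul_of_det_ne_zero {m p : Type*} [Fintype p] [DecidableEq p]
    (N : Matrix m p ℂ) {A : Matrix p p ℂ} (hA : A.det ≠ 0) :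
    LinearMap.range (N * A).mulVecLin = LinearMap.range N.mulVecLin := by
  rw [Matrix.mulVecLin_mul]
  refine LinearMap.range_comp_of_range_eq_top _ (LinearMap.range_eq_top.2 fun c => ?_)
  refine ⟨A⁻¹.mulVec c, ?_⟩
  rw [Matrix.mulVecLin_apply, Matrix.mulVec_mulVec, Matrix.mul_nonsing_inv _ hA.isUnit,
    Matrix.one_mulVec]

theorem mul_inv_mem_reducedLC {n : ℕ} {d : ℕ → ℕ} {S : Set ℂ}
    (hcard : ∀ a ≤ n, #{k ∈ range a | d k < d (k + 1)} = d a)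
    {N : Matrix (Fin (2 * n)) (Fin n) ℂ} (hN : Function.Injective N.mulVec)
    (hS : LinearMap.range N.mulVecLin ∈ incidentLC n S)
    (hd : ∀ a ≤ n, finrank ℂ ↥(LinearMap.range N.mulVecLin ⊓ truncLC n a) = d a) :
    N * (N.submatrix (pivotLC n d) id)⁻¹ ∈ reducedLC n d S ∧
      LinearMap.range (N * (N.submatrix (pivotLC n d) id)⁻¹).mulVecLin =
        LinearMap.range N.mulVecLin := by
  have hdet := det_submatrix_pivotLC_ne_zero hN hS.2.1 hd
  have hA : (N.submatrix (pivotLC n d) id)⁻¹.det ≠ 0 :=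
    ((Matrix.isUnit_nonsing_inv_det _ hdet.isUnit)).ne_zero
  have hr := range_mulVecLin_mul_of_det_ne_zero N hA
  set M := N * (N.submatrix (pivotLC n d) id)⁻¹ with hMdef
  have h1 : M.submatrix (pivotLC n d) id = 1 := by
    rw [← Matrix.mul_nonsing_inv _ hdet.isUnit]
    rfl
  have hinj := mulVec_injective_of_submatrix_eq_one h1
  rw [← hr, range_mulVecLin_mem_incidentLC hinj] at hS
  refine ⟨⟨h1, hS.1, hS.2, fun k hk => ?_⟩, hr⟩
  rw [← hr] at hd
  have hiso := ((range_mulVecLin_mem_incidentLC (S := S) hinj).2 hS).2.1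
  obtain ⟨h, hh, hs⟩ := exists_apply_pivotLC_eq_single hiso hd hcard hk
  have h2 : (fun i => M i k) = h := by
    rw [← sub_eq_zero]
    refine eq_zero_of_apply_pivotLC hiso hd (Submodule.sub_mem _ ?_ hh.1) fun j => ?_
    · exact col_mem_range_mulVecLin M k
    · rw [Pi.sub_apply, hs, sub_eq_zero]
      have := congrFun (congrFun h1 j) k
      rw [Matrix.submatrix_apply, id, Matrix.one_apply] at this
      rw [this, Pi.single_apply]
  rw [h2]
  exact hh.2

theorem finite_of_isBounded_of_forall_eval {σ : Type*} [Finite σ] {Z : Set (σ → ℂ)}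
    (hb : Bornology.IsBounded Z)
    (hZ : ∀ x, (∀ p : MvPolynomial σ ℂ, (∀ y ∈ Z, MvPolynomial.eval y p = 0) →
      MvPolynomial.eval x p = 0) → x ∈ Z) : Z.Finite := by
  have h : Z = {x | ∀ p ∈ {p : MvPolynomial σ ℂ | ∀ y ∈ Z, MvPolynomial.eval y p = 0},
      MvPolynomial.eval x p = 0} :=
    Set.Subset.antisymm (fun x hx p hp => hp x hx) fun x hx => hZ x hx
  rw [h] at hb ⊢
  exact zeroLocus_finite_of_isBounded _ hb

/-- The generic `m × p` matrix. -/
noncomputable def genericLC (m p : Type*) : Matrix m p (MvPolynomial (m × p) ℂ) :=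
  Matrix.of fun i j => MvPolynomial.X (i, j)

theorem mem_of_forall_eval_reducedLC {n : ℕ} {d : ℕ → ℕ} {S : Set ℂ}
    (x : Fin (2 * n) × Fin n → ℂ)
    (hx : ∀ p : MvPolynomial (Fin (2 * n) × Fin n) ℂ,
      (∀ M ∈ reducedLC n d S, MvPolynomial.eval (fun ij => M ij.1 ij.2) p = 0) →
        MvPolynomial.eval x p = 0) :
    Matrix.of (fun i j => x (i, j)) ∈ reducedLC n d S := by
  let X := genericLC (Fin (2 * n)) (Fin n)
  have hX : ∀ (y : Fin (2 * n) × Fin n → ℂ) i j, MvPolynomial.eval y (X i j) = y (i, j) :=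
    fun y i j => MvPolynomial.eval_X _
  refine ⟨?_, fun c c' => ?_, fun s hs => ?_, fun k hk => ⟨fun i => ?_, fun i hi => ?_⟩⟩
  · ext i j
    have h := hx (X (pivotLC n d i) j - MvPolynomial.C ((1 : Matrix (Fin n) (Fin n) ℂ) i j))
      fun M hM => by
        rw [map_sub, hX, MvPolynomial.eval_C, sub_eq_zero]
        exact congrFun (congrFun hM.1 i) j
    rwa [map_sub, hX, MvPolynomial.eval_C, sub_eq_zero] at h
  · let P : (Fin n → ℂ) → Fin (2 * n) → MvPolynomial (Fin (2 * n) × Fin n) ℂ :=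
      fun c i => ∑ j, X i j * MvPolynomial.C (c j)
    have hP : ∀ (M : Matrix (Fin (2 * n)) (Fin n) ℂ) c i,
        MvPolynomial.eval (fun ij => M ij.1 ij.2) (P c i) = M.mulVec c i := fun M c i => by
      simp only [P, map_sum, map_mul, hX, MvPolynomial.eval_C, Matrix.mulVec, dotProduct]
    let Q := ∑ i : Fin n, (P c (inclLC n i) * P c' (pairLC n i) -
      P c' (inclLC n i) * P c (pairLC n i))
    have hQ : ∀ M : Matrix (Fin (2 * n)) (Fin n) ℂ,
        MvPolynomial.eval (fun ij => M ij.1 ij.2) Q = formLC n (M.mulVec c) (M.mulVec c') := by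
      intro M
      simp only [Q, map_sum, map_sub, map_mul, hP, formLC]
    rw [← hQ]
    exact hx Q fun M hM => (hQ M).trans (hM.2.1 c c')
  · let A : Matrix (Fin n) (Fin n) (MvPolynomial (Fin (2 * n) × Fin n) ℂ) := Matrix.of fun i j =>
      X (pairLC n i) j - ∑ k, MvPolynomial.C (symLC n s i k) * X (inclLC n k) j
    have hA : ∀ M : Matrix (Fin (2 * n)) (Fin n) ℂ,
        MvPolynomial.eval (fun ij => M ij.1 ij.2) A.det = (meetLC M s).det := by
      intro M
      rw [RingHom.map_det]
      congr 1
      ext i j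
      simp only [A, meetLC, RingHom.mapMatrix_apply, Matrix.map_apply, Matrix.of_apply, map_sub,
        map_sum, map_mul, hX, MvPolynomial.eval_C]
    rw [← hA]
    exact hx A.det fun M hM => (hA M).trans (hM.2.2.1 s hs)
  · have h := hx (X (pairLC n i) k) fun M hM => by
      rw [hX]
      exact (hM.2.2.2 k hk).1 i
    rwa [hX] at h
  · have h := hx (X (inclLC n i) k) fun M hM => by
      rw [hX]
      exact (hM.2.2.2 k hk).2 i hi
    rwa [hX] at h

theorem continuous_formLC (n : ℕ) :
    Continuous fun v : (Fin (2 * n) → ℂ) × (Fin (2 * n) → ℂ) => formLC n v.1 v.2 := by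
  unfold formLC
  fun_prop

theorem continuous_meetLC (n : ℕ) (s : ℂ) :
    Continuous fun N : Matrix (Fin (2 * n)) (Fin n) ℂ => meetLC N s := by
  refine continuous_matrix fun i j => ?_
  simp only [meetLC, Matrix.of_apply]
  have h : ∀ i j, Continuous fun N : Matrix (Fin (2 * n)) (Fin n) ℂ => N i j :=
    fun i j => continuous_id.matrix_elem i j
  exact (h _ _).sub (continuous_finsetSum _ fun k _ => continuous_const.mul (h _ _))

theorem continuousAt_mul_submatrix_inv {m p : Type*} [Fintype p] [DecidableEq p] {e : p → m}
    {N : Matrix m p ℂ} (hN : (N.submatrix e id).det ≠ 0) :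
    ContinuousAt (fun N : Matrix m p ℂ => N * (N.submatrix e id)⁻¹) N := by
  have h : Continuous fun N : Matrix m p ℂ => N.submatrix e (id : p → p) :=
    continuous_id.matrix_submatrix _ _
  simp only [Matrix.inv_def, Ring.inverse_eq_inv', Matrix.mul_smul]
  exact (h.matrix_det.continuousAt.inv₀ hN).smul
    (continuous_id.matrix_mul h.matrix_adjugate).continuousAt

theorem eq_of_mem_reducedLC {n : ℕ} {d : ℕ → ℕ} {S : Set ℂ}
    {M M' : Matrix (Fin (2 * n)) (Fin n) ℂ} (hM : M ∈ reducedLC n d S) (hM' : M' ∈ reducedLC n d S)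
    (hr : LinearMap.range M.mulVecLin = LinearMap.range M'.mulVecLin)
    (hiso : ∀ x ∈ LinearMap.range M'.mulVecLin, ∀ y ∈ LinearMap.range M'.mulVecLin,
      formLC n x y = 0)
    (hd : ∀ a ≤ n, finrank ℂ ↥(LinearMap.range M'.mulVecLin ⊓ truncLC n a) = d a) :
    M = M' := by
  ext i j
  have h1 : (fun i => M i j) - (fun i => M' i j) ∈ LinearMap.range M'.mulVecLin :=
    Submodule.sub_mem _ (hr ▸ col_mem_range_mulVecLin M j) (col_mem_range_mulVecLin M' j)
  have h2 := eq_zero_of_apply_pivotLC hiso hd h1 fun k => by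
    rw [Pi.sub_apply, sub_eq_zero]
    exact (congrFun (congrFun hM.1 k) j).trans (congrFun (congrFun hM'.1 k) j).symm
  exact sub_eq_zero.1 (congrFun h2 i)

/-- If a family of lower bounds on the dimensions of the intersections with the flag `truncLC n`
forces equality on `incidentLC n S`, then it cuts out a finite set. -/
theorem finite_of_forall_finrank_eq {n : ℕ} {d : ℕ → ℕ} {S : Set ℂ}
    (hrig : ∀ H ∈ incidentLC n S, (∀ a ≤ n, d a ≤ finrank ℂ ↥(H ⊓ truncLC n a)) →
      ∀ a ≤ n, finrank ℂ ↥(H ⊓ truncLC n a) = d a) :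
    {H ∈ incidentLC n S | ∀ a ≤ n, d a ≤ finrank ℂ ↥(H ⊓ truncLC n a)}.Finite := by
  rcases Set.eq_empty_or_nonempty
    {H ∈ incidentLC n S | ∀ a ≤ n, d a ≤ finrank ℂ ↥(H ⊓ truncLC n a)} with h0 | ⟨H₀, hS₀, hd₀⟩
  · rw [h0]
    exact Set.finite_empty
  have hd := hrig H₀ hS₀ hd₀
  have hcard : ∀ a ≤ n, #{k ∈ range a | d k < d (k + 1)} = d a := by
    refine fun a => card_filter_range_lt_succ ?_ (fun k hk => ?_) fun k hk => ?_
    · simp [← hd 0 (Nat.zero_le _), truncLC_zero]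
    · rw [← hd k hk.le, ← hd _ hk]
      exact finrank_inf_truncLC_mono H₀ k.le_succ
    · rw [← hd k hk.le, ← hd _ hk]
      exact finrank_inf_truncLC_succ_le hk H₀
  have hdn : ∀ a ≤ n, d a ≤ n := fun a ha => by
    rw [← hd a ha]
    exact (finrank_inf_truncLC_le H₀ ha).trans ha
  let K : Set (Matrix (Fin (2 * n)) (Fin n) ℂ) := {N | N.conjTranspose * N = 1} ∩
    ((⋂ c, ⋂ c', {N | formLC n (N.mulVec c) (N.mulVec c') = 0}) ∩
      ((⋂ s ∈ S, {N | (meetLC N s).det = 0}) ∩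
        ⋂ a ∈ Set.Iic n, {N | (forgetLC n a * N).rank ≤ n - d a}))
  have hKc : IsCompact K := by
    refine isCompact_setOf_conjTranspose_mul_self.inter_right (IsClosed.inter ?_ (IsClosed.inter
      ?_ ?_))
    · refine isClosed_iInter fun c => isClosed_iInter fun c' => isClosed_eq ?_ continuous_const
      exact (continuous_formLC n).comp ((continuous_id.matrix_mulVec continuous_const).prodMk
        (continuous_id.matrix_mulVec continuous_const))
    · exact isClosed_biInter fun s _ =>
        isClosed_eq (continuous_meetLC n s).matrix_det continuous_const
    · exact isClosed_biInter fun a _ => (isClosed_setOf_rank_le (n - d a)).preimage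
        (continuous_const.matrix_mul continuous_id)
  have hK : ∀ N : Matrix (Fin (2 * n)) (Fin n) ℂ, N.conjTranspose * N = 1 →
      (N ∈ K ↔ LinearMap.range N.mulVecLin ∈ incidentLC n S ∧
        ∀ a ≤ n, d a ≤ finrank ℂ ↥(LinearMap.range N.mulVecLin ⊓ truncLC n a)) := by
    intro N hN
    have hinj := mulVec_injective_of_conjTranspose_mul_self hN
    rw [range_mulVecLin_mem_incidentLC hinj]
    simp only [K, Set.mem_inter_iff, Set.mem_iInter, Set.mem_ofPred_eq, Set.mem_Iic, hN, true_and,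
      and_assoc]
    refine and_congr_right fun _ => and_congr_right fun _ => forall₂_congr fun a ha => ?_
    have h1 := rank_forgetLC_mul_add (a := a) hinj
    have h2 := hdn a ha
    omega
  let Φ : Matrix (Fin (2 * n)) (Fin n) ℂ → Fin (2 * n) × Fin n → ℂ :=
    fun N ij => (N * (N.submatrix (pivotLC n d) id)⁻¹) ij.1 ij.2
  have hΦ : ContinuousOn Φ K := by
    intro N hN
    obtain ⟨h1, h2⟩ := (hK N hN.1).1 hN
    have hdet := det_submatrix_pivotLC_ne_zero (mulVec_injective_of_conjTranspose_mul_self hN.1)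
      h1.2.1 (hrig _ h1 h2)
    refine (continuousAt_pi.2 fun ij => ?_).continuousWithinAt
    exact ((continuous_id.matrix_elem ij.1 ij.2).continuousAt).comp
      (continuousAt_mul_submatrix_inv hdet)
  let Z : Set (Fin (2 * n) × Fin n → ℂ) :=
    {x | Matrix.of (fun i j => x (i, j)) ∈ reducedLC n d S}
  have hZK : Z ⊆ Φ '' K := by
    intro x hx
    obtain ⟨M, hM⟩ : ∃ M : Matrix (Fin (2 * n)) (Fin n) ℂ, M = Matrix.of fun i j => x (i, j) :=
      ⟨_, rfl⟩
    change Matrix.of (fun i j => x (i, j)) ∈ reducedLC n d S at hx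
    rw [← hM] at hx
    obtain ⟨h1, h2⟩ := range_mulVecLin_of_mem_reducedLC hcard hx
    have h3 := hrig _ h1 h2
    obtain ⟨N, hN, hNr⟩ := exists_orthonormal_frame _ h1.1
    have h1' : LinearMap.range N.mulVecLin ∈ incidentLC n S := by rwa [hNr]
    have h2' : ∀ a ≤ n, d a ≤ finrank ℂ ↥(LinearMap.range N.mulVecLin ⊓ truncLC n a) := by
      rwa [hNr]
    refine ⟨N, (hK N hN).2 ⟨h1', h2'⟩, ?_⟩
    obtain ⟨h4, h5⟩ := mul_inv_mem_reducedLC hcard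
      (mulVec_injective_of_conjTranspose_mul_self hN) h1' (hrig _ h1' h2')
    have h6 := eq_of_mem_reducedLC h4 hx (h5.trans hNr) h1.2.1 h3
    funext ij
    exact (congrFun (congrFun h6 ij.1) ij.2).trans (by rw [hM, Matrix.of_apply])
  have hZ : Z.Finite := by
    refine finite_of_isBounded_of_forall_eval
      ((hKc.image_of_continuousOn hΦ).isBounded.subset hZK) fun x hx => ?_
    refine mem_of_forall_eval_reducedLC x fun p hp => hx p fun y hy => ?_
    exact hp (Matrix.of fun i j => y (i, j)) hy
  refine (hZ.image fun x => LinearMap.range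
    (Matrix.of fun i j => x (i, j) : Matrix (Fin (2 * n)) (Fin n) ℂ).mulVecLin).subset ?_
  rintro H ⟨hH, hHd⟩
  obtain ⟨N, hN, rfl⟩ := exists_orthonormal_frame H hH.1
  obtain ⟨h4, h5⟩ := mul_inv_mem_reducedLC hcard
    (mulVec_injective_of_conjTranspose_mul_self hN) hH (hrig _ hH hHd)
  exact ⟨Φ N, h4, h5⟩

theorem finite_of_forall_sum_finrank_le {n m : ℕ} {S : Set ℂ}
    (hm : ∀ H ∈ incidentLC n S, ∑ a ∈ range n, finrank ℂ ↥(H ⊓ truncLC n (a + 1)) ≤ m) :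
    {H ∈ incidentLC n S | m ≤ ∑ a ∈ range n, finrank ℂ ↥(H ⊓ truncLC n (a + 1))}.Finite := by
  refine Set.Finite.of_finite_fibers
    (fun H (a : Fin (n + 1)) => finrank ℂ ↥(H ⊓ truncLC n a)) ?_ ?_
  · refine (Set.Finite.pi' fun _ : Fin (n + 1) => Set.finite_Iic n).subset ?_
    rintro _ ⟨H, -, rfl⟩ a
    have ha := Nat.lt_succ_iff.1 a.2
    exact (finrank_inf_truncLC_le H ha).trans ha
  · rintro _ ⟨H₀, hH₀, rfl⟩
    refine (finite_of_forall_finrank_eq (S := S) (d := fun a => finrank ℂ ↥(H₀ ⊓ truncLC n a))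
      fun H hH hle => ?_).subset ?_
    · have h1 : ∀ a ∈ range n, finrank ℂ ↥(H₀ ⊓ truncLC n (a + 1)) ≤
          finrank ℂ ↥(H ⊓ truncLC n (a + 1)) := fun a ha => hle _ (mem_range.1 ha)
      have h2 := (sum_eq_sum_iff_of_le h1).1
        (le_antisymm (sum_le_sum h1) ((hm H hH).trans hH₀.2))
      rintro (_ | a) ha
      · rw [truncLC_zero, inf_bot_eq, inf_bot_eq]
      · exact (h2 a (mem_range.2 ha)).symm
    · rintro H ⟨⟨hH, -⟩, hf⟩
      exact ⟨hH, fun a ha => (congrFun hf ⟨a, Nat.lt_succ_iff.2 ha⟩).ge⟩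

theorem finite_setOf_ofReal_inf_graphLC_ne_bot {n : ℕ} {S : Set ℂ}
    {H : Submodule ℂ (Fin (2 * n) → ℂ)} (hH : H ∈ incidentLC n S) :
    {t : ℝ | H ⊓ graphLC n t ≠ ⊥}.Finite := by
  obtain ⟨N, hN, rfl⟩ := exists_orthonormal_frame H hH.1
  exact (finite_setOf_inf_graphLC_ne_bot (mulVec_injective_of_conjTranspose_mul_self hN)
    hH.2.1).preimage Complex.ofReal_injective.injOn

theorem exists_finite_incidentLC (n k : ℕ) :
    ∃ s : Fin k → ℝ, Function.Injective s ∧ (∀ i, s i ≠ 0) ∧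
      {H ∈ incidentLC n (Set.range fun i => (s i : ℂ)) |
        n * (n + 1) / 2 ≤ ∑ a ∈ range n, finrank ℂ ↥(H ⊓ truncLC n (a + 1)) + k}.Finite := by
  induction k with
  | zero =>
    refine ⟨Fin.elim0, fun i => i.elim0, fun i => i.elim0, ?_⟩
    refine finite_of_forall_sum_finrank_le fun H _ => ?_
    have h : ∑ a ∈ range n, finrank ℂ ↥(H ⊓ truncLC n (a + 1)) ≤ ∑ a ∈ range n, (a + 1) :=
      sum_le_sum fun a ha => finrank_inf_truncLC_le H (mem_range.1 ha)
    have h' := sum_range_succ' (fun a => a) n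
    rw [sum_range_id, Nat.add_sub_cancel, add_zero, mul_comm] at h'
    rwa [h']
  | succ k ih =>
    obtain ⟨s, hs, hs0, hfin⟩ := ih
    obtain ⟨t, ht⟩ := (((Set.finite_singleton (0 : ℝ)).union (Set.finite_range s)).union
      (hfin.biUnion fun H hH => finite_setOf_ofReal_inf_graphLC_ne_bot hH.1)).exists_notMem
    simp only [Set.mem_union, Set.mem_singleton_iff, Set.mem_range, Set.mem_iUnion, not_or,
      not_exists, Set.mem_ofPred_eq] at ht
    obtain ⟨⟨ht0, hts⟩, htH⟩ := ht
    refine ⟨Fin.cons t s, Fin.cons_injective_iff.2 ⟨fun ⟨i, hi⟩ => hts i hi, hs⟩,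
      Fin.cases ht0 hs0, ?_⟩
    have hw : ∀ H ∈ incidentLC n (Set.range fun i => ((Fin.cons t s : Fin (k + 1) → ℝ) i : ℂ)),
        ∑ a ∈ range n, finrank ℂ ↥(H ⊓ truncLC n (a + 1)) ≤ n * (n + 1) / 2 - (k + 1) := by
      intro H hH
      by_contra! hlt
      refine htH H ⟨⟨hH.1, hH.2.1, ?_⟩, by omega⟩ (hH.2.2 t ⟨0, rfl⟩)
      rintro _ ⟨i, rfl⟩
      exact hH.2.2 _ ⟨i.succ, rfl⟩
    exact (finite_of_forall_sum_finrank_le hw).subset fun H hH =>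
      ⟨hH.1, Nat.sub_le_iff_le_add.2 hH.2⟩

theorem card_filter_le_finrank_inf_truncLC {n l : ℕ} {μ : Fin l → ℕ} (hpos : ∀ i, 0 < μ i)
    {H : Submodule ℂ (Fin (2 * n) → ℂ)}
    (hH : ∀ i : Fin l, (i : ℕ) + 1 ≤ finrank ℂ ↥(H ⊓ oscLC n (n + 1 - μ i) 0)) (a : ℕ) :
    #{i | n + 1 - μ i ≤ a} ≤ finrank ℂ ↥(H ⊓ truncLC n a) := by
  rcases ({i | n + 1 - μ i ≤ a} : Finset (Fin l)).eq_empty_or_nonempty with h | h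
  · rw [h, card_empty]
    exact Nat.zero_le _
  · obtain ⟨j, hj, hmax⟩ := exists_max_image _ id h
    have h1 : ({i | n + 1 - μ i ≤ a} : Finset (Fin l)) ⊆ Iic j :=
      fun i hi => mem_Iic.2 (hmax i hi)
    refine (card_le_card h1).trans ?_
    rw [Fin.card_Iic]
    refine (hH j).trans (Submodule.finrank_mono (inf_le_inf_left H ?_))
    have := hpos j
    exact (oscLC_zero_le_truncLC (by omega)).trans (truncLC_mono n (mem_filter.1 hj).2)

theorem sum_le_sum_finrank_inf_truncLC {n l : ℕ} {μ : Fin l → ℕ} (hpos : ∀ i, 0 < μ i)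
    (hle : ∀ i, μ i ≤ n) {H : Submodule ℂ (Fin (2 * n) → ℂ)}
    (hH : ∀ i : Fin l, (i : ℕ) + 1 ≤ finrank ℂ ↥(H ⊓ oscLC n (n + 1 - μ i) 0)) :
    ∑ i, μ i ≤ ∑ a ∈ range n, finrank ℂ ↥(H ⊓ truncLC n (a + 1)) := by
  calc ∑ i, μ i = ∑ i, #{a ∈ range n | n + 1 - μ i ≤ a + 1} := by
        refine sum_congr rfl fun i _ => ?_
        have h : {a ∈ range n | n + 1 - μ i ≤ a + 1} = Ico (n - μ i) n := by
          ext a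
          simp only [mem_filter, mem_range, mem_Ico]
          omega
        have := hle i
        rw [h, Nat.card_Ico]
        omega
    _ = ∑ a ∈ range n, #{i | n + 1 - μ i ≤ a + 1} := by
        simp only [card_filter]
        exact sum_comm
    _ ≤ _ := sum_le_sum fun a _ => card_filter_le_finrank_inf_truncLC hpos hH (a + 1)

theorem truncLC_le_graphLC_zero (n a : ℕ) : truncLC n a ≤ graphLC n 0 :=
  fun v hv i => by simp [hv.1 i, symLC]

theorem StrictAnti.apply_add_le {n l : ℕ} {μ : Fin l → ℕ} (hanti : StrictAnti μ)
    (hle : ∀ i, μ i ≤ n) (i : Fin l) : μ i + i ≤ n := by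
  obtain ⟨i, hi⟩ := i
  induction i with
  | zero => exact hle _
  | succ i ih =>
    have h1 := ih (Nat.lt_of_succ_lt hi)
    have h2 := hanti (Fin.mk_lt_mk.2 i.lt_succ_self : (⟨i, Nat.lt_of_succ_lt hi⟩ : Fin l) < ⟨_, hi⟩)
    simp only at h1 ⊢
    omega

theorem two_mul_sum_range_sub_add (l m : ℕ) :
    2 * ∑ i ∈ range l, (l + m - i) + m * (m + 1) = (l + m) * (l + m + 1) := by
  induction l with
  | zero => simp
  | succ l ih =>
    rw [sum_range_succ', Nat.sub_zero]
    simp only [show ∀ i, l + 1 + m - (i + 1) = l + m - i from fun i => by omega]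
    linear_combination ih

theorem StrictAnti.le_one_of_add_le {n l : ℕ} {μ : Fin l → ℕ} (hanti : StrictAnti μ)
    (hle : ∀ i, μ i ≤ n) (h : l + (n * (n + 1) / 2 - ∑ i, μ i) ≤ n) :
    n * (n + 1) / 2 - ∑ i, μ i ≤ 1 := by
  obtain ⟨m, rfl⟩ := Nat.exists_eq_add_of_le ((Nat.le_add_right _ _).trans h)
  have h1 : ∑ i, μ i ≤ ∑ i ∈ range l, (l + m - i) := by
    rw [sum_range]
    refine sum_le_sum fun i _ => ?_
    have := hanti.apply_add_le hle i
    omega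
  have h2 := two_mul_sum_range_sub_add l m
  by_contra! h3
  have h4 : 2 ≤ m := by omega
  have h5 : 3 * m ≤ m * (m + 1) := by nlinarith
  omega

theorem not_conjStableLC {n l : ℕ} {μ : Fin l → ℕ} (hanti : StrictAnti μ) (hpos : ∀ i, 0 < μ i)
    (hle : ∀ i, μ i ≤ n) (hr : 1 < n * (n + 1) / 2 - ∑ i, μ i)
    {s : Fin (n * (n + 1) / 2 - ∑ i, μ i) → ℝ} (hs : Function.Injective s) (hs0 : ∀ i, s i ≠ 0)
    {H : Submodule ℂ (Fin (2 * n) → ℂ)} (hHn : finrank ℂ H = n)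
    (hiso : ∀ x ∈ H, ∀ y ∈ H, formLC n x y = 0)
    (hH : ∀ i : Fin l, (i : ℕ) + 1 ≤ finrank ℂ ↥(H ⊓ oscLC n (n + 1 - μ i) 0))
    (hHs : ∀ k, H ⊓ graphLC n (s k) ≠ ⊥) : ¬ conjStableLC n H := by
  intro hc
  have h1 := sum_finrank_inf_graphLC_le hc hiso (insert 0 (univ.image s))
  rw [sum_insert (by simpa using hs0), sum_image hs.injOn, hHn, Complex.ofReal_zero] at h1
  have h2 : l ≤ finrank ℂ ↥(H ⊓ graphLC n 0) := by
    have h3 := card_filter_le_finrank_inf_truncLC hpos hH n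
    rw [filter_true_of_mem, card_univ, Fintype.card_fin] at h3
    · exact h3.trans (Submodule.finrank_mono (inf_le_inf_left H (truncLC_le_graphLC_zero n n)))
    · intro i _
      have := hpos i
      omega
  have h3 : ∑ _k : Fin (n * (n + 1) / 2 - ∑ i, μ i), 1 ≤
      ∑ k, finrank ℂ ↥(H ⊓ graphLC n (s k)) :=
    sum_le_sum fun k _ => Submodule.one_le_finrank_iff.2 (hHs k)
  rw [sum_const, card_univ, Fintype.card_fin, smul_eq_mul, mul_one] at h3
  exact hr.not_ge (hanti.le_one_of_add_le hle (by omega))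

theorem inf_graphLC_ne_bot_of_inf_oscLC_ne_bot {n : ℕ} {s : ℂ}
    {H : Submodule ℂ (Fin (2 * n) → ℂ)} (h : H ⊓ oscLC n n s ≠ ⊥) : H ⊓ graphLC n s ≠ ⊥ :=
  ne_bot_of_le_ne_bot h (inf_le_inf_left H (oscLC_le_graphLC n s))

end

/-- Theorem 4.2: for a strict partition `μ` with parts at most `n` and
`r = n(n+1)/2 − |μ| > 1`, there are real numbers `s_1, …, s_r` such that the set of
Lagrangian subspaces `H ⊆ ℂ^{2n}` lying in the Schubert variety `X_μ F_•(0)` and meeting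
each `F_n(s_k)` nontrivially is finite and contains no real point. -/
theorem stmt_5 (n : ℕ) (hn : 1 ≤ n) (l : ℕ) (μ : Fin l → ℕ)
    (hanti : StrictAnti μ) (hpos : ∀ i, 0 < μ i) (hle : ∀ i, μ i ≤ n)
    (hr : 1 < n * (n + 1) / 2 - ∑ i, μ i) :
    ∃ s : Fin (n * (n + 1) / 2 - ∑ i, μ i) → ℝ,
      {H : Submodule ℂ (Fin (2 * n) → ℂ) |
          Module.finrank ℂ H = n ∧
          (∀ x ∈ H, ∀ y ∈ H, formLC n x y = 0) ∧
          (∀ i : Fin l, (i : ℕ) + 1 ≤ Module.finrank ℂ ↥(H ⊓ oscLC n (n + 1 - μ i) 0)) ∧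
          (∀ k, H ⊓ oscLC n n ((s k : ℝ) : ℂ) ≠ ⊥)}.Finite ∧
      ∀ H ∈ {H : Submodule ℂ (Fin (2 * n) → ℂ) |
          Module.finrank ℂ H = n ∧
          (∀ x ∈ H, ∀ y ∈ H, formLC n x y = 0) ∧
          (∀ i : Fin l, (i : ℕ) + 1 ≤ Module.finrank ℂ ↥(H ⊓ oscLC n (n + 1 - μ i) 0)) ∧
          (∀ k, H ⊓ oscLC n n ((s k : ℝ) : ℂ) ≠ ⊥)},
        ¬ conjStableLC n H := by
  obtain ⟨s, hs, hs0, hfin⟩ := exists_finite_incidentLC n (n * (n + 1) / 2 - ∑ i, μ i)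
  refine ⟨s, hfin.subset ?_, ?_⟩
  · rintro H ⟨hHn, hiso, hH, hHs⟩
    refine ⟨⟨hHn, hiso, ?_⟩, ?_⟩
    · rintro _ ⟨k, rfl⟩
      exact inf_graphLC_ne_bot_of_inf_oscLC_ne_bot (hHs k)
    · have := sum_le_sum_finrank_inf_truncLC hpos hle hH
      omega
  · rintro H ⟨hHn, hiso, hH, hHs⟩
    exact not_conjStableLC hanti hpos hle hr hs hs0 hHn hiso hH
      fun k => inf_graphLC_ne_bot_of_inf_oscLC_ne_bot (hHs k)
end
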